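/- Let n ≥ 2 and 1 < r, s < ∞. If (1/r, 1/s) lies in the interior of the triangle L_n, then the lacunary spherical maximal function satisfies the sparse bound ‖M_lac : (r,s)_m‖ < ∞. -/

import Mathlib

open MeasureTheory Metric Set
open scoped ENNReal NNReal

noncomputable section

abbrev Rn (n : ℕ) := EuclideanSpace ℝ (Fin n)

/-- The normalized rotation-invariant measure on the unit sphere of `ℝⁿ`. -/
def sphMeasure (n : ℕ) : Measure (Rn n) :=
  ((μH[(n : ℝ) - 1]) (sphere (0 : Rn n) 1))⁻¹ • (μH[(n : ℝ) - 1]).restrict (sphere (0 : Rn n) 1)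

/-- The spherical average `A_t f (x)`. -/
def sphereAvg (n : ℕ) (t : ℝ) (f : Rn n → ℝ) (x : Rn n) : ℝ :=
  ∫ y, f (x - t • y) ∂(sphMeasure n)

/-- The lacunary spherical maximal function. -/
def Mlac (n : ℕ) (f : Rn n → ℝ) (x : Rn n) : ℝ :=
  ⨆ j : ℤ, sphereAvg n ((2 : ℝ) ^ j) (fun z => |f z|) x

/-- The full spherical maximal function. -/
def Mfull (n : ℕ) (f : Rn n → ℝ) (x : Rn n) : ℝ :=
  ⨆ t : {t : ℝ // 0 < t}, sphereAvg n (t : ℝ) (fun z => |f z|) x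

/-- An axis-parallel cube in `ℝⁿ`. -/
structure Cube (n : ℕ) where
  corner : Fin n → ℝ
  side : ℝ
  side_pos : 0 < side

/-- The set of points of a cube. -/
def Cube.toSet {n : ℕ} (Q : Cube n) : Set (Rn n) :=
  {x | ∀ i, Q.corner i ≤ x i ∧ x i ≤ Q.corner i + Q.side}

/-- `⟨f⟩_{Q,r}`, the normalized `L^r` average of `f` over the cube `Q`. -/
def cubeAvg {n : ℕ} (Q : Cube n) (r : ℝ) (f : Rn n → ℝ) : ℝ :=
  ((volume Q.toSet).toReal⁻¹ * ∫ x in Q.toSet, |f x| ^ r) ^ (1 / r)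

/-- The plain average of `w` over a cube `Q`. -/
def avgCube {n : ℕ} (Q : Cube n) (w : Rn n → ℝ) : ℝ :=
  (volume Q.toSet).toReal⁻¹ * ∫ x in Q.toSet, w x

/-- A sparse collection of cubes. -/
def IsSparse {n : ℕ} (𝒮 : Set (Cube n)) : Prop :=
  ∃ E : Cube n → Set (Rn n),
    (∀ S ∈ 𝒮, MeasurableSet (E S)) ∧ (∀ S ∈ 𝒮, E S ⊆ S.toSet) ∧
    (∀ S ∈ 𝒮, volume S.toSet < 4 * volume (E S)) ∧
    𝒮.PairwiseDisjoint E

/-- An admissible family `{F_S}` for the `m`-sparse form: pairwise disjoint, `F_S ⊆ S`. -/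
def IsAdmissible {n : ℕ} (𝒮 : Set (Cube n)) (F : Cube n → Set (Rn n)) : Prop :=
  (∀ S ∈ 𝒮, MeasurableSet (F S)) ∧ (∀ S ∈ 𝒮, F S ⊆ S.toSet) ∧ 𝒮.PairwiseDisjoint F

/-- The `(r,s)_m`-sparse form `Λ_{𝒮,r,s,m}(f,g)`. -/
def sparseFormM {n : ℕ} (𝒮 : Set (Cube n)) (F : Cube n → Set (Rn n)) (r s : ℝ)
    (f g : Rn n → ℝ) : ℝ≥0∞ :=
  ∑' S : 𝒮, volume (S : Cube n).toSet * ENNReal.ofReal (cubeAvg (S : Cube n) r f) *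
    ENNReal.ofReal (cubeAvg (S : Cube n) s ((F (S : Cube n)).indicator g))

/-- The supremum of `(r,s)_m` sparse forms over all sparse collections and admissible families. -/
def supSparseFormM (n : ℕ) (r s : ℝ) (f g : Rn n → ℝ) : ℝ≥0∞ :=
  ⨆ (𝒮 : Set (Cube n)) (F : Cube n → Set (Rn n)) (_ : IsSparse 𝒮) (_ : IsAdmissible 𝒮 F),
    sparseFormM 𝒮 F r s f g

/-- The sparse bound `‖T : (r,s)_m‖ < ∞`. -/
def SparseBoundM (n : ℕ) (r s : ℝ) (T : (Rn n → ℝ) → Rn n → ℝ) : Prop :=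
  ∃ C : ℝ, 0 ≤ C ∧ ∀ f g : Rn n → ℝ, Measurable f → Measurable g →
    (∀ x, 0 ≤ f x) → (∀ x, 0 ≤ g x) →
    (∃ M, ∀ x, f x ≤ M) → (∃ M, ∀ x, g x ≤ M) →
    HasCompactSupport f → HasCompactSupport g →
    ENNReal.ofReal (∫ x, T f x * g x) ≤ ENNReal.ofReal C * supSparseFormM n r s f g

/-- The closed triangle `L_n` with vertices `(0,1)`, `(1,0)`, `(n/(n+1), n/(n+1))`. -/
def Lregion (n : ℕ) : Set (ℝ × ℝ) :=
  convexHull ℝ {((0 : ℝ), (1 : ℝ)), (1, 0), ((n : ℝ)/(n+1), (n : ℝ)/(n+1))}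

/-- The closed triangle `L'_n` with vertices `(0,0)`, `(1,1)`, `(n/(n+1), 1/(n+1))`. -/
def Lregion' (n : ℕ) : Set (ℝ × ℝ) :=
  convexHull ℝ {((0 : ℝ), (0 : ℝ)), (1, 1), ((n : ℝ)/(n+1), 1/((n : ℝ)+1))}

/-- The closed trapezium `F_n`. -/
def Fregion (n : ℕ) : Set (ℝ × ℝ) :=
  convexHull ℝ {((0 : ℝ), (1 : ℝ)), (((n : ℝ)-1)/n, 1/(n : ℝ)),
    (((n : ℝ)-1)/n, ((n : ℝ)-1)/n),
    (((n : ℝ)^2 - n)/((n : ℝ)^2 + 1), ((n : ℝ)^2 - n + 2)/((n : ℝ)^2 + 1))}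

/-- The closed trapezium `F'_n`. -/
def Fregion' (n : ℕ) : Set (ℝ × ℝ) :=
  convexHull ℝ {((0 : ℝ), (0 : ℝ)), (((n : ℝ)-1)/n, ((n : ℝ)-1)/n),
    (((n : ℝ)-1)/n, 1/(n : ℝ)),
    (((n : ℝ)^2 - n)/((n : ℝ)^2 + 1), ((n : ℝ)-1)/((n : ℝ)^2 + 1))}

/-- A dyadic cube `2^q([0,1)^n + m)`. -/
def IsDyadic {n : ℕ} (Q : Cube n) : Prop :=
  ∃ (q : ℤ) (m : Fin n → ℤ), Q.side = (2 : ℝ) ^ q ∧ ∀ i, Q.corner i = (2 : ℝ) ^ q * m i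

/-- The concentric cube `(1/3)Q` of one third the side length. -/
def Cube.third {n : ℕ} (Q : Cube n) : Cube n :=
  ⟨fun i => Q.corner i + Q.side / 3, Q.side / 3, by have := Q.side_pos; linarith⟩

/-- `A_Q f = A_{ℓQ/4}(f · 1_{(1/3)Q})`. -/
def AQ {n : ℕ} (Q : Cube n) (f : Rn n → ℝ) (x : Rn n) : ℝ :=
  sphereAvg n (Q.side / 4) (Q.third.toSet.indicator f) x

/-- `M̃_Q f = sup_{ℓQ/8 ≤ t < ℓQ/4} A_t (f · 1_{(1/3)Q})`. -/
def MtildeQ {n : ℕ} (Q : Cube n) (f : Rn n → ℝ) (x : Rn n) : ℝ :=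
  ⨆ t : {t : ℝ // Q.side / 8 ≤ t ∧ t < Q.side / 4},
    sphereAvg n (t : ℝ) (Q.third.toSet.indicator f) x

/-- A weight: a positive locally integrable function. -/
def IsWeight {n : ℕ} (w : Rn n → ℝ) : Prop :=
  (∀ x, 0 < w x) ∧ LocallyIntegrable w volume

/-- The Muckenhoupt class `A₁`. -/
def MemA1 {n : ℕ} (w : Rn n → ℝ) : Prop :=
  IsWeight w ∧ ∃ C : ℝ, ∀ Q : Cube n, ∀ᵐ x ∂volume, x ∈ Q.toSet → avgCube Q w ≤ C * w x

/-- The Muckenhoupt class `A_p`, `1 < p < ∞`. -/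
def MemAp {n : ℕ} (p : ℝ) (w : Rn n → ℝ) : Prop :=
  IsWeight w ∧ ∃ C : ℝ, ∀ Q : Cube n,
    avgCube Q w * (avgCube Q fun x => w x ^ (1 - p/(p-1))) ^ (p - 1) ≤ C

/-- The reverse Hölder class `RH_ρ`. -/
def MemRH {n : ℕ} (ρ : ℝ) (w : Rn n → ℝ) : Prop :=
  IsWeight w ∧ ∃ C : ℝ, ∀ Q : Cube n, cubeAvg Q ρ w ≤ C * avgCube Q w

/-- The measure `w dx` associated to a weight. -/
def wMeasure {n : ℕ} (w : Rn n → ℝ) : Measure (Rn n) :=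
  volume.withDensity fun x => ENNReal.ofReal (w x)

/-- The dual exponent `x' = x/(x-1)`. -/
def dualExp (x : ℝ) : ℝ := x / (x - 1)

/-- `φ_lac(r)`, defined through `1/φ_lac(1/r)` as in Corollary 5.4(1). -/
def phiLac (n : ℕ) (r : ℝ) : ℝ :=
  if 1/r ≤ (n : ℝ)/(n+1) then (1 - 1/(r*n))⁻¹ else ((n : ℝ)*(1 - 1/r))⁻¹

/-- `φ_full(r)`, the piecewise linear function of Statement 16. -/
def phiFull (n : ℕ) (r : ℝ) : ℝ :=
  if 1/r ≤ ((n : ℝ)^2 - n)/((n : ℝ)^2 + 1) then (1 - 1/(r*n))⁻¹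
  else (((n : ℝ)-1)/n + (((n : ℝ)+1)/((n : ℝ)-1)) * ((((n : ℝ)-1))/n - 1/r))⁻¹

end

open MeasureTheory Metric Set
open scoped ENNReal NNReal

section Aux

local notation "D2" => (2:ℝ)
variable {n : ℕ}

section SphereBasics

lemma sph_mass (n : ℕ) : sphMeasure n univ ≤ 1 := by
  unfold sphMeasure
  simp only [Measure.smul_apply, Measure.restrict_apply_univ, smul_eq_mul]
  exact ENNReal.inv_mul_le_one _

instance sph_finite (n : ℕ) : IsFiniteMeasure (sphMeasure n) :=
  ⟨lt_of_le_of_lt (sph_mass n) ENNReal.one_lt_top⟩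

lemma sph_real_mass (n : ℕ) : (sphMeasure n).real univ ≤ 1 := by
  unfold Measure.real
  have := ENNReal.toReal_mono ENNReal.one_ne_top (sph_mass n)
  simpa using this

lemma sph_supp (n : ℕ) : ∀ᵐ y ∂(sphMeasure n), ‖y‖ = 1 := by
  unfold sphMeasure
  apply Measure.ae_smul_measure
  filter_upwards [ae_restrict_mem (isClosed_sphere (x := (0 : Rn n)) (ε := 1)).measurableSet] with y hy
  simpa using hy

lemma sph_map (n : ℕ) (L : Rn n ≃ₗᵢ[ℝ] Rn n) : (sphMeasure n).map L = sphMeasure n := by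
  unfold sphMeasure
  rw [Measure.map_smul]
  congr 1
  have h1 : sphere (0 : Rn n) 1 = L ⁻¹' (sphere (0 : Rn n) 1) := by
    ext x; simp
  have hm : Measurable L := L.continuous.measurable
  conv_lhs => rw [h1]
  rw [← Measure.restrict_map hm isClosed_sphere.measurableSet]
  congr 1
  exact L.toIsometryEquiv.map_hausdorffMeasure _

lemma sph_integral_comp (n : ℕ) (L : Rn n ≃ₗᵢ[ℝ] Rn n) {F : Type*} [NormedAddCommGroup F]
    [NormedSpace ℝ F] (h : Rn n → F) :
    ∫ y, h (L y) ∂(sphMeasure n) = ∫ y, h y ∂(sphMeasure n) := by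
  conv_rhs => rw [← sph_map n L]
  exact (L.toHomeomorph.measurableEmbedding.integral_map _).symm

lemma exists_isom {x y : Rn n} (h : ‖x‖ = ‖y‖) : ∃ L : Rn n ≃ₗᵢ[ℝ] Rn n, L x = y :=
  ⟨(ℝ ∙ (x - y))ᗮ.reflection, Submodule.reflection_sub h⟩

lemma sph_ball_const {x y : Rn n} (h : ‖x‖ = ‖y‖) (ρ : ℝ) :
    sphMeasure n (closedBall x ρ) = sphMeasure n (closedBall y ρ) := by
  obtain ⟨L, hL⟩ := exists_isom h
  conv_rhs => rw [← sph_map n L]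
  rw [Measure.map_apply L.continuous.measurable isClosed_closedBall.measurableSet]
  congr 1
  ext z
  simp only [mem_closedBall, mem_preimage, ← hL, L.dist_map]

end SphereBasics

section SphereBall

lemma sph_ball_sphere (hn : 2 ≤ n) {x : Rn n} (hx : ‖x‖ = 1) {ρ : ℝ} (hρ : 0 < ρ) :
    sphMeasure n (closedBall x ρ) ≤ ENNReal.ofReal (2 ^ n * ρ ^ (n - 1)) := by
  have : Nontrivial (Rn n) := by
    have : Nonempty (Fin n) := ⟨⟨0, by omega⟩⟩
    infer_instance
  set c := volume (ball (0 : Rn n) 1) with hc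
  have hc0 : c ≠ 0 := (measure_ball_pos _ _ one_pos).ne'
  have hct : c ≠ ⊤ := measure_ball_lt_top.ne
  set S := ball (0 : Rn n) (1 + ρ) \ ball 0 1 with hS
  have hSm : MeasurableSet S := measurableSet_ball.diff measurableSet_ball
  have hvS : ENNReal.ofReal ρ * c ≤ volume S := by
    rw [hS, measure_sdiff (ball_subset_ball (by linarith)) measurableSet_ball.nullMeasurableSet
      hct]
    rw [Measure.addHaar_ball _ _ (by linarith : (0:ℝ) ≤ 1 + ρ)]
    rw [← hc]
    apply ENNReal.le_sub_of_add_le_right hct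
    calc ENNReal.ofReal ρ * c + c = ENNReal.ofReal (1 + ρ) * c := by
          rw [ENNReal.ofReal_add zero_le_one hρ.le]; simp; ring
      _ ≤ _ := by
          gcongr
          rw [finrank_euclideanSpace_fin]
          calc 1 + ρ = (1 + ρ) ^ 1 := by ring
            _ ≤ (1 + ρ) ^ n := pow_le_pow_right₀ (by linarith) (by omega)
  have hsub : ∀ z ∈ S, sphMeasure n (closedBall x ρ) ≤ sphMeasure n (closedBall z (2 * ρ)) := by
    intro z hz
    have h1 : 1 ≤ ‖z‖ := by simpa using hz.2
    have h2 : ‖z‖ < 1 + ρ := by simpa using hz.1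
    have hz0 : (‖z‖ : ℝ) ≠ 0 := by linarith
    have h3 : ‖(‖z‖⁻¹ • z : Rn n)‖ = 1 := by rw [norm_smul]; simp [hz0]
    rw [sph_ball_const (hx.trans h3.symm)]
    apply measure_mono
    apply closedBall_subset_closedBall'
    rw [dist_eq_norm]
    have : (‖z‖⁻¹ • z : Rn n) - z = (‖z‖⁻¹ - 1) • z := by rw [sub_smul, one_smul]
    rw [this, norm_smul, Real.norm_eq_abs, ← abs_of_nonneg (norm_nonneg z), ← abs_mul, sub_mul,
      abs_of_nonneg (norm_nonneg z), inv_mul_cancel₀ hz0]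
    have : |1 - 1 * ‖z‖| ≤ ρ := by
      rw [abs_le]
      constructor <;> linarith
    linarith
  have hint : ∫⁻ z, sphMeasure n (closedBall z (2 * ρ)) ≤ ENNReal.ofReal ((2 * ρ) ^ n) * c := by
    have hm : MeasurableSet {p : Rn n × Rn n | dist p.2 p.1 ≤ 2 * ρ} :=
      (isClosed_le (by fun_prop) continuous_const).measurableSet
    have e1 : ∀ z : Rn n, sphMeasure n (closedBall z (2 * ρ)) =
        ∫⁻ y, ({p : Rn n × Rn n | dist p.2 p.1 ≤ 2 * ρ}.indicator (fun _ => (1:ℝ≥0∞))) (z, y)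
          ∂(sphMeasure n) := by
      intro z
      rw [← lintegral_indicator_one isClosed_closedBall.measurableSet]
      rfl
    simp_rw [e1]
    rw [lintegral_lintegral_swap (f := fun z y => ({p : Rn n × Rn n | dist p.2 p.1 ≤ 2 * ρ}.indicator
        (fun _ => (1:ℝ≥0∞))) (z, y)) ((measurable_const.indicator hm).aemeasurable)]
    have e2 : ∀ y : Rn n, ∫⁻ z, ({p : Rn n × Rn n | dist p.2 p.1 ≤ 2 * ρ}.indicator
        (fun _ => (1:ℝ≥0∞))) (z, y) = ENNReal.ofReal ((2 * ρ) ^ n) * c := by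
      intro y
      have : volume (closedBall y (2*ρ)) = ENNReal.ofReal ((2 * ρ) ^ n) * c := by
        rw [Measure.addHaar_closedBall _ _ (by positivity), finrank_euclideanSpace_fin]
      rw [← this, ← lintegral_indicator_one isClosed_closedBall.measurableSet]
      congr 1
      ext z
      simp [indicator, dist_comm]
    simp_rw [e2]
    rw [lintegral_const]
    calc _ ≤ ENNReal.ofReal ((2 * ρ) ^ n) * c * 1 := by gcongr; exact sph_mass n
      _ = _ := mul_one _
  have h5 : sphMeasure n (closedBall x ρ) * (ENNReal.ofReal ρ * c) ≤
      ENNReal.ofReal ((2 * ρ) ^ n) * c := by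
    calc _ ≤ sphMeasure n (closedBall x ρ) * volume S := by gcongr
      _ = ∫⁻ z in S, sphMeasure n (closedBall x ρ) := by rw [setLIntegral_const]
      _ ≤ ∫⁻ z in S, sphMeasure n (closedBall z (2 * ρ)) := setLIntegral_mono' hSm hsub
      _ ≤ _ := (setLIntegral_le_lintegral _ _).trans hint
  rw [← mul_assoc, ENNReal.mul_le_mul_iff_left hc0 hct] at h5
  have hρ' : ENNReal.ofReal ρ ≠ 0 := by simpa using hρ
  rw [← ENNReal.mul_le_mul_iff_left hρ' ENNReal.ofReal_ne_top]
  refine h5.trans (le_of_eq ?_)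
  rw [← ENNReal.ofReal_mul (by positivity)]
  congr 1
  obtain ⟨k, rfl⟩ : ∃ k, n = k + 1 := ⟨n - 1, by omega⟩
  simp only [Nat.add_sub_cancel]
  ring

lemma sph_ball (hn : 2 ≤ n) (x : Rn n) {ρ : ℝ} (hρ : 0 < ρ) :
    sphMeasure n (closedBall x ρ) ≤ ENNReal.ofReal (4 ^ n * ρ ^ (n - 1)) := by
  by_cases h : ∃ y ∈ closedBall x ρ, ‖y‖ = 1
  · obtain ⟨y, hy, hy1⟩ := h
    calc _ ≤ sphMeasure n (closedBall y (2 * ρ)) := by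
          apply measure_mono
          apply closedBall_subset_closedBall'
          rw [dist_comm]
          have : dist y x ≤ ρ := hy
          linarith
      _ ≤ _ := sph_ball_sphere hn hy1 (by positivity)
      _ ≤ _ := by
          apply ENNReal.ofReal_le_ofReal
          rw [mul_pow, ← mul_assoc]
          gcongr
          calc D2 ^ n * 2 ^ (n - 1) ≤ 2 ^ n * 2 ^ n := by
                gcongr <;> norm_num
            _ = 4 ^ n := by rw [← mul_pow]; norm_num
  · push Not at h
    have : sphMeasure n (closedBall x ρ) = 0 := by
      apply measure_mono_null _ (sph_supp n)
      intro y hy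
      exact h y hy
    rw [this]; exact zero_le

end SphereBall

section SphereODE

lemma sph_hasDerivAt (h h' : ℝ → Rn n → ℝ) (hc : Continuous (Function.uncurry h))
    (hc' : Continuous (Function.uncurry h')) (hd : ∀ t x, HasDerivAt (fun t => h t x) (h' t x) t)
    (t₀ : ℝ) : HasDerivAt (fun t => ∫ x, h t x ∂(sphMeasure n)) (∫ x, h' t₀ x ∂(sphMeasure n)) t₀ := by
  have hK : IsCompact (closedBall t₀ 1 ×ˢ sphere (0 : Rn n) 1) :=
    (isCompact_closedBall _ _).prod (isCompact_sphere _ _)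
  obtain ⟨C, hC⟩ := hK.exists_bound_of_continuousOn hc.continuousOn
  obtain ⟨C', hC'⟩ := hK.exists_bound_of_continuousOn hc'.continuousOn
  refine (hasDerivAt_integral_of_dominated_loc_of_deriv_le (F := h) (F' := h')
    (bound := fun _ => C') (s := ball t₀ 1) (ball_mem_nhds _ one_pos) ?_ ?_ ?_ ?_ ?_ ?_).2
  · exact Filter.Eventually.of_forall fun t =>
      (hc.comp (Continuous.prodMk_right t)).aestronglyMeasurable
  · refine Integrable.of_bound (hc.comp (Continuous.prodMk_right t₀)).aestronglyMeasurable C ?_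
    filter_upwards [sph_supp n] with x hx
    exact hC (t₀, x) ⟨mem_closedBall_self zero_le_one, by simpa using hx⟩
  · exact (hc'.comp (Continuous.prodMk_right t₀)).aestronglyMeasurable
  · filter_upwards [sph_supp n] with x hx t ht
    exact hC' (t, x) ⟨ball_subset_closedBall ht, by simpa using hx⟩
  · exact integrable_const _
  · filter_upwards with x t ht
    exact hd t x

lemma sph_integrable (h : Rn n → ℝ) (hc : Continuous h) : Integrable h (sphMeasure n) := by
  obtain ⟨C, hC⟩ := (isCompact_sphere (0 : Rn n) 1).exists_bound_of_continuousOn hc.continuousOn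
  refine Integrable.of_bound hc.aestronglyMeasurable C ?_
  filter_upwards [sph_supp n] with x hx
  exact hC x (by simpa using hx)

end SphereODE

section SphereODE2

lemma sph_radial {ξ η : Rn n} (h : ‖ξ‖ = ‖η‖) :
    ∫ x, Real.cos (inner ℝ x ξ) ∂(sphMeasure n) = ∫ x, Real.cos (inner ℝ x η) ∂(sphMeasure n) := by
  obtain ⟨L, hL⟩ := exists_isom h
  rw [← sph_integral_comp n L (fun x => Real.cos (inner ℝ x η))]
  congr 1
  ext x
  rw [← hL, L.inner_map_map]

lemma inner_single' (x : Rn n) (i : Fin n) (a : ℝ) :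
    inner ℝ x (EuclideanSpace.single i a) = a * x i := by
  rw [real_inner_comm, EuclideanSpace.inner_single_left]; simp

lemma sph_identity {i j : Fin n} (hij : i ≠ j) {l : ℝ} (hl : 0 < l) :
    ∫ x, (l * x j ^ 2 * Real.cos (l * x i) - x i * Real.sin (l * x i)) ∂(sphMeasure n) = 0 := by
  set G : ℝ → Rn n → ℝ := fun t x => Real.cos (l * (Real.cos t * x i + Real.sin t * x j))
  set G1 : ℝ → Rn n → ℝ := fun t x => - Real.sin (l * (Real.cos t * x i + Real.sin t * x j)) *
    (l * (-Real.sin t * x i + Real.cos t * x j))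
  set G2 : ℝ → Rn n → ℝ := fun t x => - Real.cos (l * (Real.cos t * x i + Real.sin t * x j)) *
    (l * (-Real.sin t * x i + Real.cos t * x j)) * (l * (-Real.sin t * x i + Real.cos t * x j))
    - Real.sin (l * (Real.cos t * x i + Real.sin t * x j)) *
    (l * (-Real.cos t * x i + -Real.sin t * x j))
  have hc : Continuous (Function.uncurry G) := by
    simp only [G, Function.uncurry_def]; fun_prop
  have hc1 : Continuous (Function.uncurry G1) := by
    simp only [G1, Function.uncurry_def]; fun_prop
  have hc2 : Continuous (Function.uncurry G2) := by
    simp only [G2, Function.uncurry_def]; fun_prop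
  have hin : ∀ (t : ℝ) (x : Rn n), HasDerivAt (fun t => l * (Real.cos t * x i + Real.sin t * x j))
      (l * (-Real.sin t * x i + Real.cos t * x j)) t := fun t x =>
    (((Real.hasDerivAt_cos t).mul_const _).add ((Real.hasDerivAt_sin t).mul_const _)).const_mul l
  have hin2 : ∀ (t : ℝ) (x : Rn n),
      HasDerivAt (fun t => l * (-Real.sin t * x i + Real.cos t * x j))
      (l * (-Real.cos t * x i + -Real.sin t * x j)) t := fun t x =>
    (((Real.hasDerivAt_sin t).neg.mul_const _).add
      ((Real.hasDerivAt_cos t).mul_const _)).const_mul l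
  have hd : ∀ t x, HasDerivAt (fun t => G t x) (G1 t x) t := fun t x => (hin t x).cos
  have hd1 : ∀ t x, HasDerivAt (fun t => G1 t x) (G2 t x) t := fun t x => by
    have := (hin t x).sin.neg.mul (hin2 t x)
    refine HasDerivAt.congr_deriv (f := fun t => G1 t x) this ?_
    simp only [G2, Pi.neg_apply]; ring
  have hconst : ∀ t, ∫ x, G t x ∂(sphMeasure n) = ∫ x, G 0 x ∂(sphMeasure n) := by
    have key : ∀ t, ∫ x, G t x ∂(sphMeasure n) = ∫ x, Real.cos (inner ℝ x
        (EuclideanSpace.single i (l * Real.cos t) + EuclideanSpace.single j (l * Real.sin t) : Rn n))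
        ∂(sphMeasure n) := by
      intro t
      congr 1; ext x
      rw [inner_add_right, inner_single', inner_single']
      simp only [G]; ring_nf
    have hnorm : ∀ t : ℝ, ‖(EuclideanSpace.single i (l * Real.cos t) +
        EuclideanSpace.single j (l * Real.sin t) : Rn n)‖ ^ 2 = l ^ 2 := by
      intro t
      rw [← real_inner_self_eq_norm_sq, inner_add_right, inner_single', inner_single']
      simp [hij, hij.symm]
      linear_combination l ^ 2 * Real.cos_sq_add_sin_sq t
    intro t
    rw [key, key]
    apply sph_radial
    rw [← sq_eq_sq₀ (norm_nonneg _) (norm_nonneg _), hnorm, hnorm]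
  have h1 : ∀ t, ∫ x, G1 t x ∂(sphMeasure n) = 0 := by
    intro t
    have e1 := sph_hasDerivAt G G1 hc hc1 hd t
    have e2 : (fun t => ∫ x, G t x ∂(sphMeasure n)) = fun _ => ∫ x, G 0 x ∂(sphMeasure n) :=
      funext hconst
    rw [e2] at e1
    exact e1.unique (hasDerivAt_const t _)
  have h2 : ∫ x, G2 0 x ∂(sphMeasure n) = 0 := by
    have e1 := sph_hasDerivAt G1 G2 hc1 hc2 hd1 0
    have e2 : (fun t => ∫ x, G1 t x ∂(sphMeasure n)) = fun _ => 0 := funext h1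
    rw [e2] at e1
    exact e1.unique (hasDerivAt_const _ _)
  have h3 : ∀ x, G2 0 x = (-l) * (l * x j ^ 2 * Real.cos (l * x i) - x i * Real.sin (l * x i)) := by
    intro x
    simp only [G2, Real.cos_zero, Real.sin_zero]
    ring_nf
  simp_rw [h3] at h2
  rw [integral_const_mul] at h2
  rcases mul_eq_zero.mp h2 with h | h
  · linarith
  · exact h

lemma sph_ode (i : Fin n) {l : ℝ} (hl : 0 < l) :
    l * (∫ x, Real.cos (l * x i) ∂(sphMeasure n) +
      ∫ x, -(x i ^ 2 * Real.cos (l * x i)) ∂(sphMeasure n)) =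
      ((n : ℝ) - 1) * ∫ x, x i * Real.sin (l * x i) ∂(sphMeasure n) := by
  have h1 : ∀ j ∈ Finset.univ.erase i, ∫ x, l * x j ^ 2 * Real.cos (l * x i) ∂(sphMeasure n) =
      ∫ x, x i * Real.sin (l * x i) ∂(sphMeasure n) := by
    intro j hj
    have := sph_identity (n := n) (i := i) (j := j) (by simpa [eq_comm] using hj) hl
    rw [integral_sub (sph_integrable _ (by fun_prop)) (sph_integrable _ (by fun_prop))] at this
    linarith
  have h2 := Finset.sum_congr rfl h1
  rw [← integral_finsetSum _ (fun j _ => sph_integrable _ (by fun_prop))] at h2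
  simp only [Finset.sum_const, Finset.card_erase_of_mem (Finset.mem_univ i), Finset.card_univ,
    Fintype.card_fin, nsmul_eq_mul] at h2
  have hn : 1 ≤ n := by have := i.2; omega
  rw [Nat.cast_sub hn] at h2
  rw [← integral_add (sph_integrable _ (by fun_prop)) (sph_integrable _ (by fun_prop)),
    ← integral_const_mul]
  push_cast at h2
  rw [← h2]
  apply integral_congr_ae
  filter_upwards [sph_supp n] with x hx
  have h3 : ∑ j, x j ^ 2 = 1 := by
    have := EuclideanSpace.real_norm_sq_eq x
    rw [hx] at this; linarith
  rw [← Finset.add_sum_erase _ _ (Finset.mem_univ i)] at h3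
  rw [← Finset.sum_mul, ← Finset.mul_sum]
  have : ∑ j ∈ Finset.univ.erase i, x j ^ 2 = 1 - x i ^ 2 := by linarith
  rw [this]; ring

lemma ode_decay (d : ℕ) (u u1 u2 : ℝ → ℝ) (h1 : ∀ l, HasDerivAt u (u1 l) l)
    (h2 : ∀ l, HasDerivAt u1 (u2 l) l)
    (ho : ∀ l, 0 < l → l * (u l + u2 l) = -((d : ℝ) + 1) * u1 l) :
    ∃ C : ℝ, 0 ≤ C ∧ ∀ l, (d : ℝ) + 1 ≤ l → l ^ (d + 1) * (u l) ^ 2 ≤ C := by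
  set G : ℝ → ℝ := fun l => l ^ (d + 1) * (u l ^ 2 + u1 l ^ 2) + ((d : ℝ) + 1) * l ^ d * (u l * u1 l)
  have hd1 : (0:ℝ) < (d:ℝ) + 1 := by positivity
  have hlow : ∀ l, (d : ℝ) + 1 ≤ l → l ^ (d + 1) * (u l ^ 2 + u1 l ^ 2) ≤ 2 * G l := by
    intro l hl
    have hl0 : 0 < l := by linarith
    have hp : 0 < l ^ d := by positivity
    have e1 : -(u l ^ 2 + u1 l ^ 2) ≤ 2 * (u l * u1 l) := by nlinarith [sq_nonneg (u l + u1 l)]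
    have e2 : -(((d : ℝ) + 1) * (u l ^ 2 + u1 l ^ 2)) ≤ ((d:ℝ)+1) * (2 * (u l * u1 l)) := by
      nlinarith
    have e3 : ((d : ℝ) + 1) * (u l ^ 2 + u1 l ^ 2) ≤ l * (u l ^ 2 + u1 l ^ 2) :=
      mul_le_mul_of_nonneg_right hl (by positivity)
    have e4 : 0 ≤ l ^ d * (l * (u l ^ 2 + u1 l ^ 2) + ((d:ℝ)+1) * (2 * (u l * u1 l))) :=
      mul_nonneg hp.le (by linarith)
    simp only [G]
    have : l ^ (d + 1) = l ^ d * l := pow_succ _ _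
    rw [this]
    linarith
  set H : ℝ → ℝ := fun l => G l * Real.exp (((d:ℝ)+1) / l)
  have hG : ∀ l, 0 < l → HasDerivAt G (-((d:ℝ)+1) * l ^ d / l * (u l * u1 l)) l := by
    intro l hl
    have a1 := ((hasDerivAt_id l).pow (d+1)).mul (((h1 l).pow 2).add ((h2 l).pow 2))
    have a2 := (((hasDerivAt_id l).pow d).const_mul ((d:ℝ)+1)).mul ((h1 l).mul (h2 l))
    have a3 := a1.add a2
    refine HasDerivAt.congr_deriv (f := G) a3 ?_
    · simp only [id, Pi.pow_apply, Pi.add_apply, Pi.mul_apply]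
      have hu2 : u2 l = -((d : ℝ) + 1) * u1 l / l - u l := by
        field_simp; linarith [ho l hl]
      rw [hu2]
      rcases d with _ | d
      · field_simp; simp; ring
      · simp only [Nat.add_sub_cancel, pow_succ]
        push_cast
        field_simp
        ring
  have hH : AntitoneOn H (Set.Ici ((d:ℝ)+1)) := by
    have hder : ∀ l ∈ Set.Ici ((d:ℝ)+1), HasDerivAt H ((-((d:ℝ)+1) * l ^ d / l * (u l * u1 l)) *
        Real.exp (((d:ℝ)+1) / l) + G l * (Real.exp (((d:ℝ)+1) / l) * (-((d:ℝ)+1) / l ^ 2))) l := by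
      intro l hl
      have hl0 : 0 < l := lt_of_lt_of_le hd1 hl
      refine (hG l hl0).mul (HasDerivAt.exp ?_)
      have := (hasDerivAt_inv hl0.ne').const_mul ((d:ℝ)+1)
      simp only [div_eq_mul_inv]
      refine this.congr_deriv ?_
      ring
    apply antitoneOn_of_deriv_nonpos (convex_Ici _)
    · exact fun l hl => (hder l hl).continuousAt.continuousWithinAt
    · intro l hl
      rw [interior_Ici] at hl
      exact (hder l (le_of_lt (mem_Ioi.mp hl))).differentiableAt.differentiableWithinAt
    · intro l hl
      rw [interior_Ici] at hl
      have hl' : (d:ℝ) + 1 ≤ l := le_of_lt (mem_Ioi.mp hl)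
      rw [(hder l hl').deriv]
      have hl0 : 0 < l := lt_of_lt_of_le hd1 hl'
      have e1 := hlow l hl'
      have e2 : -(u l ^ 2 + u1 l ^ 2) ≤ 2 * (u l * u1 l) := by nlinarith [sq_nonneg (u l + u1 l)]
      have : (-((d:ℝ)+1) * l ^ d / l * (u l * u1 l)) *
        Real.exp (((d:ℝ)+1) / l) + G l * (Real.exp (((d:ℝ)+1) / l) * (-((d:ℝ)+1) / l ^ 2)) =
        -(Real.exp (((d:ℝ)+1) / l) * (((d:ℝ)+1) / l ^ 2)) * (l ^ (d+1) * (u l * u1 l) + G l) := by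
        field_simp; ring
      rw [this]
      apply mul_nonpos_of_nonpos_of_nonneg
      · have : 0 ≤ Real.exp (((d:ℝ)+1) / l) * (((d:ℝ)+1) / l ^ 2) := by positivity
        linarith
      · have hp : 0 < l ^ (d+1) := by positivity
        have := mul_le_mul_of_nonneg_left e2 hp.le
        linarith
  refine ⟨2 * |H ((d:ℝ)+1)|, by positivity, fun l hl => ?_⟩
  have hl0 : 0 < l := lt_of_lt_of_le hd1 hl
  have e1 := hH (Set.self_mem_Ici) hl hl
  have e2 := hlow l hl
  have hGn : 0 ≤ G l := by
    have : 0 ≤ l ^ (d + 1) * (u l ^ 2 + u1 l ^ 2) := by positivity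
    linarith
  have e3 : G l ≤ H l := by
    have : 1 ≤ Real.exp (((d:ℝ)+1) / l) := Real.one_le_exp (by positivity)
    exact le_mul_of_one_le_right hGn this
  have e4 : l ^ (d + 1) * (u l) ^ 2 ≤ l ^ (d + 1) * (u l ^ 2 + u1 l ^ 2) := by
    gcongr; nlinarith [sq_nonneg (u1 l)]
  linarith [le_abs_self (H ((d:ℝ)+1))]

lemma sph_decay1 (hn : 2 ≤ n) (i : Fin n) :
    ∃ C : ℝ, 0 ≤ C ∧ ∀ l : ℝ, (n : ℝ) - 1 ≤ l →
      l ^ (n - 1) * (∫ x, Real.cos (l * x i) ∂(sphMeasure n)) ^ 2 ≤ C := by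
  obtain ⟨d, rfl⟩ : ∃ d, n = d + 2 := ⟨n - 2, by omega⟩
  obtain ⟨C, hC0, hC⟩ := ode_decay d (fun l => ∫ x, Real.cos (l * x i) ∂(sphMeasure (d+2)))
    (fun l => ∫ x, -(x i * Real.sin (l * x i)) ∂(sphMeasure (d+2)))
    (fun l => ∫ x, -(x i ^ 2 * Real.cos (l * x i)) ∂(sphMeasure (d+2)))
    (fun l => by
      refine sph_hasDerivAt (fun l x => Real.cos (l * x i)) (fun l x => -(x i * Real.sin (l * x i)))
        (by simp only [Function.uncurry_def]; fun_prop)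
        (by simp only [Function.uncurry_def]; fun_prop) (fun t x => ?_) l
      have := ((hasDerivAt_id t).mul_const (x i)).cos
      refine this.congr_deriv ?_; simp only [id]; ring)
    (fun l => by
      refine sph_hasDerivAt (fun l x => -(x i * Real.sin (l * x i)))
        (fun l x => -(x i ^ 2 * Real.cos (l * x i)))
        (by simp only [Function.uncurry_def]; fun_prop)
        (by simp only [Function.uncurry_def]; fun_prop) (fun t x => ?_) l
      have := (((hasDerivAt_id t).mul_const (x i)).sin.const_mul (x i)).neg
      refine this.congr_deriv ?_; simp only [id]; ring)
    (fun l hl => by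
      have := sph_ode i hl
      simp only
      rw [this, integral_neg]
      push_cast; ring)
  refine ⟨C, hC0, fun l hl => ?_⟩
  exact hC l (by push_cast at hl; linarith)

lemma sph_decay2 (hn : 2 ≤ n) :
    ∃ C : ℝ, 0 ≤ C ∧ ∀ ξ : Rn n, 1 ≤ ‖ξ‖ →
      |∫ x, Real.cos (inner ℝ x ξ) ∂(sphMeasure n)| ≤ C * ‖ξ‖ ^ (-(((n : ℝ) - 1) / 2)) := by
  set i : Fin n := ⟨0, by omega⟩
  obtain ⟨C, hC0, hC⟩ := sph_decay1 hn i
  set C' := max C ((n:ℝ) ^ (n-1))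
  have hb : ∀ l : ℝ, 1 ≤ l → l ^ (n - 1) * (∫ x, Real.cos (l * x i) ∂(sphMeasure n)) ^ 2 ≤ C' := by
    intro l hl
    rcases le_or_gt ((n:ℝ) - 1) l with h | h
    · exact (hC l h).trans (le_max_left _ _)
    · refine le_trans ?_ (le_max_right _ _)
      have : |∫ x, Real.cos (l * x i) ∂(sphMeasure n)| ≤ 1 := by
        calc _ ≤ 1 * (sphMeasure n).real univ := by
              rw [← Real.norm_eq_abs]
              apply norm_integral_le_of_norm_le_const
              filter_upwards with x
              exact Real.abs_cos_le_one _
          _ ≤ 1 := by rw [one_mul]; exact sph_real_mass n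
      have h2 : (∫ x, Real.cos (l * x i) ∂(sphMeasure n)) ^ 2 ≤ 1 := by
        rw [← sq_abs]; exact pow_le_one₀ (abs_nonneg _) this
      calc _ ≤ l ^ (n-1) * 1 := by gcongr
        _ ≤ _ := by rw [mul_one]; gcongr; linarith
  have hC'0 : 0 ≤ C' := hC0.trans (le_max_left _ _)
  refine ⟨√C', Real.sqrt_nonneg _, fun ξ hξ => ?_⟩
  have e1 : ∫ x, Real.cos (inner ℝ x ξ) ∂(sphMeasure n) =
      ∫ x, Real.cos (‖ξ‖ * x i) ∂(sphMeasure n) := by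
    rw [sph_radial (η := EuclideanSpace.single i ‖ξ‖) (by simp)]
    simp_rw [inner_single']
  rw [e1]
  have hpos : 0 < ‖ξ‖ := by linarith
  have e2 := hb ‖ξ‖ hξ
  set U := ∫ x, Real.cos (‖ξ‖ * x i) ∂(sphMeasure n)
  have e3 : (‖ξ‖ ^ (((n : ℝ) - 1) / 2) * |U|) ^ 2 ≤ C' := by
    rw [mul_pow, sq_abs, ← Real.rpow_mul_natCast hpos.le]
    have : ((n:ℝ) - 1) / 2 * ((2:ℕ):ℝ) = ((n - 1 : ℕ) : ℝ) := by
      rw [Nat.cast_sub (by omega)]; push_cast; ring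
    rw [this, Real.rpow_natCast]
    exact e2
  have e4 := Real.le_sqrt_of_sq_le e3
  rw [Real.rpow_neg hpos.le, ← div_eq_mul_inv, le_div_iff₀ (by positivity), mul_comm]
  exact e4

end SphereODE2

section NiceFns

structure Nice (f : Rn n → ℝ) : Prop where
  meas : Measurable f
  bdd : ∃ M, ∀ x, |f x| ≤ M
  int : Integrable f

lemma Nice.add {f g : Rn n → ℝ} (hf : Nice f) (hg : Nice g) : Nice (fun x => f x + g x) := by
  obtain ⟨M, hM⟩ := hf.bdd
  obtain ⟨N, hN⟩ := hg.bdd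
  exact ⟨hf.meas.add hg.meas, ⟨M + N, fun x => (abs_add_le _ _).trans (add_le_add (hM x) (hN x))⟩,
    hf.int.add hg.int⟩

lemma Nice.const_mul {f : Rn n → ℝ} (hf : Nice f) (c : ℝ) : Nice (fun x => c * f x) := by
  obtain ⟨M, hM⟩ := hf.bdd
  refine ⟨hf.meas.const_mul c, ⟨|c| * M, fun x => ?_⟩, hf.int.const_mul c⟩
  rw [abs_mul]; exact mul_le_mul_of_nonneg_left (hM x) (abs_nonneg c)

lemma Nice.sub {f g : Rn n → ℝ} (hf : Nice f) (hg : Nice g) : Nice (fun x => f x - g x) := by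
  have := hf.add (hg.const_mul (-1))
  simpa [sub_eq_add_neg] using this

lemma Nice.indicator {f : Rn n → ℝ} (hf : Nice f) {s : Set (Rn n)} (hs : MeasurableSet s) :
    Nice (s.indicator f) := by
  obtain ⟨M, hM⟩ := hf.bdd
  refine ⟨hf.meas.indicator hs, ⟨M, fun x => ?_⟩, hf.int.indicator hs⟩
  by_cases hx : x ∈ s
  · simpa [hx] using hM x
  · simpa [hx] using (abs_nonneg _).trans (hM x)

lemma Nice.sum {ι : Type*} (s : Finset ι) {f : ι → Rn n → ℝ} (hf : ∀ i ∈ s, Nice (f i)) :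
    Nice (fun x => ∑ i ∈ s, f i x) := by
  classical
  induction s using Finset.induction_on with
  | empty => simp only [Finset.sum_empty]; exact ⟨measurable_const, ⟨0, by simp⟩, integrable_zero _ _ _⟩
  | insert a s ha ih =>
    simp only [Finset.sum_insert ha]
    exact (hf a (Finset.mem_insert_self _ _)).add (ih fun i hi => hf i (Finset.mem_insert_of_mem hi))

lemma Nice.mul {f g : Rn n → ℝ} (hf : Nice f) (hg : Nice g) : Integrable (fun x => f x * g x) := by
  obtain ⟨M, hM⟩ := hf.bdd
  exact hg.int.bdd_mul hf.meas.aestronglyMeasurable (Filter.Eventually.of_forall hM)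

lemma Nice.sph_int {f : Rn n → ℝ} (hf : Nice f) (R : ℝ) (x : Rn n) :
    Integrable (fun y => f (x - R • y)) (sphMeasure n) := by
  obtain ⟨M, hM⟩ := hf.bdd
  exact Integrable.of_bound (hf.meas.comp (by fun_prop)).aestronglyMeasurable M
    (Filter.Eventually.of_forall fun y => hM _)

lemma sphereAvg_measurable {f : Rn n → ℝ} (hf : Measurable f) (R : ℝ) :
    Measurable (sphereAvg n R f) := by
  unfold sphereAvg
  have : StronglyMeasurable (fun p : Rn n × Rn n => f (p.1 - R • p.2)) :=
    (hf.comp (by fun_prop)).stronglyMeasurable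
  exact this.integral_prod_right.measurable

lemma sphereAvg_bound {f : Rn n → ℝ} {M : ℝ} (hM : ∀ x, |f x| ≤ M) (R : ℝ) (x : Rn n) :
    |sphereAvg n R f x| ≤ M := by
  have hM0 : 0 ≤ M := (abs_nonneg _).trans (hM 0)
  unfold sphereAvg
  rw [← Real.norm_eq_abs]
  calc _ ≤ M * (sphMeasure n).real univ :=
        norm_integral_le_of_norm_le_const (Filter.Eventually.of_forall fun y => hM _)
    _ ≤ M * 1 := by gcongr; exact sph_real_mass n
    _ = M := mul_one _

lemma sph_prod_integrable {f : Rn n → ℝ} (hf : Nice f) (R : ℝ) :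
    Integrable (fun p : Rn n × Rn n => f (p.1 - R • p.2)) (volume.prod (sphMeasure n)) := by
  have hm : Measurable (fun p : Rn n × Rn n => f (p.1 - R • p.2)) := hf.meas.comp (by fun_prop)
  have h1 : ∀ y : Rn n, Integrable (fun x : Rn n => f (x - R • y)) volume := fun y =>
    hf.int.comp_sub_right (R • y)
  have h2 : (fun y : Rn n => ∫ x, ‖f (x - R • y)‖) = fun _ => ∫ x, ‖f x‖ := by
    ext y
    exact integral_sub_right_eq_self (fun x => ‖f x‖) (R • y)
  have h3 : Integrable (fun y : Rn n => ∫ x, ‖f (x - R • y)‖) (sphMeasure n) := by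
    rw [h2]; exact integrable_const _
  exact (integrable_prod_iff' hm.aestronglyMeasurable).2 ⟨Filter.Eventually.of_forall h1, h3⟩

lemma Nice.sphereAvg {f : Rn n → ℝ} (hf : Nice f) (R : ℝ) : Nice (sphereAvg n R f) := by
  obtain ⟨M, hM⟩ := hf.bdd
  exact ⟨sphereAvg_measurable hf.meas R, ⟨M, sphereAvg_bound hM R⟩,
    (sph_prod_integrable hf R).integral_prod_left⟩

lemma sphereAvg_sub {f g : Rn n → ℝ} (hf : Nice f) (hg : Nice g) (R : ℝ) (x : Rn n) :
    sphereAvg n R (fun x => f x - g x) x = sphereAvg n R f x - sphereAvg n R g x :=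
  integral_sub (hf.sph_int R x) (hg.sph_int R x)

lemma sphereAvg_sum {ι : Type*} (s : Finset ι) {f : ι → Rn n → ℝ}
    (hf : ∀ i ∈ s, Nice (f i)) (R : ℝ) (x : Rn n) :
    sphereAvg n R (fun x => ∑ i ∈ s, f i x) x = ∑ i ∈ s, sphereAvg n R (f i) x :=
  integral_finsetSum _ fun i hi => (hf i hi).sph_int R x

lemma sphereAvg_add {f g : Rn n → ℝ} (hf : Nice f) (hg : Nice g) (R : ℝ) (x : Rn n) :
    sphereAvg n R (fun x => f x + g x) x = sphereAvg n R f x + sphereAvg n R g x :=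
  integral_add (hf.sph_int R x) (hg.sph_int R x)

lemma sphereAvg_const_mul (c : ℝ) (f : Rn n → ℝ) (R : ℝ) (x : Rn n) :
    sphereAvg n R (fun x => c * f x) x = c * sphereAvg n R f x :=
  integral_const_mul _ _

lemma sphereAvg_adj {f g : Rn n → ℝ} (hf : Nice f) (hg : Nice g) (R : ℝ) :
    ∫ x, sphereAvg n R f x * g x = ∫ x, f x * sphereAvg n R g x := by
  obtain ⟨M, hM⟩ := hf.bdd
  obtain ⟨N, hN⟩ := hg.bdd
  have h1 : Integrable (fun p : Rn n × Rn n => f (p.1 - R • p.2) * g p.1)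
      (volume.prod (sphMeasure n)) :=
    (sph_prod_integrable hf R).mul_bdd (hg.meas.comp measurable_fst).aestronglyMeasurable
      (Filter.Eventually.of_forall fun p => hN _)
  have h2 : Integrable (fun p : Rn n × Rn n => f p.1 * g (p.1 - R • p.2))
      (volume.prod (sphMeasure n)) :=
    (sph_prod_integrable hg R).bdd_mul (hf.meas.comp measurable_fst).aestronglyMeasurable
      (Filter.Eventually.of_forall fun p => hM _)
  have e1 : ∀ x, sphereAvg n R f x * g x = ∫ y, f (x - R • y) * g x ∂(sphMeasure n) := by
    intro x; rw [integral_mul_const]; rfl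
  have e2 : ∀ x, f x * sphereAvg n R g x = ∫ y, f x * g (x - R • y) ∂(sphMeasure n) := by
    intro x; rw [integral_const_mul]; rfl
  simp_rw [e1, e2]
  rw [integral_integral_swap (f := fun x y => f (x - R • y) * g x) h1,
    integral_integral_swap (f := fun x y => f x * g (x - R • y)) h2]
  rw [← sph_integral_comp n (LinearIsometryEquiv.neg ℝ) (fun y => ∫ x, f x * g (x - R • y))]
  congr 1; ext y
  rw [← integral_add_right_eq_self (fun x => f (x - R • y) * g x) (R • y)]
  simp

lemma form_bound1 {f g : Rn n → ℝ} (hf : Nice f) (hg : Nice g) (R : ℝ) {M : ℝ}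
    (hM : ∀ x, |f x| ≤ M) : |∫ x, sphereAvg n R f x * g x| ≤ M * ∫ x, |g x| := by
  rw [← Real.norm_eq_abs, ← integral_const_mul]
  refine norm_integral_le_of_norm_le (hg.int.abs.const_mul M) (Filter.Eventually.of_forall fun x => ?_)
  rw [Real.norm_eq_abs, abs_mul]
  exact mul_le_mul_of_nonneg_right (sphereAvg_bound hM R x) (abs_nonneg _)

lemma form_bound2 {f g : Rn n → ℝ} (hf : Nice f) (hg : Nice g) (R : ℝ) {M : ℝ}
    (hM : ∀ x, |g x| ≤ M) : |∫ x, sphereAvg n R f x * g x| ≤ M * ∫ x, |f x| := by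
  rw [sphereAvg_adj hf hg]
  simp_rw [mul_comm (f _)]
  exact form_bound1 hg hf R hM

end NiceFns

section FourierSide
open FourierTransform

lemma sph_sin_zero (ξ : Rn n) : ∫ y, Real.sin (inner ℝ y ξ) ∂(sphMeasure n) = 0 := by
  have h := sph_integral_comp n (LinearIsometryEquiv.neg ℝ) (fun y => Real.sin (inner ℝ y ξ))
  simp only [LinearIsometryEquiv.coe_neg, inner_neg_left, Real.sin_neg, integral_neg] at h
  linarith

lemma sph_fourier {g : Rn n → ℝ} (hg : Nice g) (ξ : Rn n) :
    𝓕 (fun x => (sphereAvg n 1 g x : ℂ)) ξ =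
      ((∫ y, Real.cos (inner ℝ y ((2 * Real.pi) • ξ)) ∂(sphMeasure n) : ℝ) : ℂ) *
        𝓕 (fun x => (g x : ℂ)) ξ := by
  have hchar : ∫ y, (Real.fourierChar (-(inner ℝ y ξ)) : ℂ) ∂(sphMeasure n) =
      ((∫ y, Real.cos (inner ℝ y ((2 * Real.pi) • ξ)) ∂(sphMeasure n) : ℝ) : ℂ) := by
    have : ∀ y : Rn n, (Real.fourierChar (-(inner ℝ y ξ)) : ℂ) =
        (Real.cos (inner ℝ y ((2 * Real.pi) • ξ)) : ℂ) - (Real.sin (inner ℝ y ((2 * Real.pi) • ξ)) : ℂ) * Complex.I := by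
      intro y
      rw [Real.fourierChar_apply, inner_smul_right, Complex.ofReal_cos, Complex.ofReal_sin]
      have : (((2 * Real.pi * -inner ℝ y ξ : ℝ) : ℂ) * Complex.I) =
        (-(((2 * Real.pi * inner ℝ y ξ : ℝ) : ℂ))) * Complex.I := by push_cast; ring
      rw [this, Complex.exp_mul_I, Complex.cos_neg, Complex.sin_neg]
      ring
    simp_rw [this]
    rw [integral_sub, integral_mul_const, integral_complex_ofReal, integral_complex_ofReal, sph_sin_zero]
    · simp
    · exact (sph_integrable (fun y => Real.cos (inner ℝ y ((2*Real.pi)•ξ))) (by fun_prop)).ofReal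
    · exact (Integrable.ofReal (sph_integrable (fun y => Real.sin (inner ℝ y ((2*Real.pi)•ξ)))
        (by fun_prop))).mul_const _
  rw [Real.fourier_eq, ← hchar, Real.fourier_eq]
  have h1 : Integrable (fun p : Rn n × Rn n => Real.fourierChar (-(inner ℝ p.1 ξ)) •
      (g (p.1 - (1:ℝ) • p.2) : ℂ)) (volume.prod (sphMeasure n)) := by
    have h0 : Integrable (fun p : Rn n × Rn n => (g (p.1 - (1:ℝ) • p.2) : ℂ))
      (volume.prod (sphMeasure n)) := (sph_prod_integrable hg 1).ofReal
    have hc : Continuous (fun p : Rn n × Rn n => (Real.fourierChar (-(inner ℝ p.1 ξ)) : ℂ)) := by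
      fun_prop
    have hb : Integrable (fun p : Rn n × Rn n => (Real.fourierChar (-(inner ℝ p.1 ξ)) : ℂ) *
      (g (p.1 - (1:ℝ) • p.2) : ℂ)) (volume.prod (sphMeasure n)) :=
      h0.bdd_mul (c := 1) hc.aestronglyMeasurable
        (Filter.Eventually.of_forall fun p => (Circle.norm_coe _).le)
    simpa only [Circle.smul_def, smul_eq_mul] using hb
  have e1 : ∀ x, Real.fourierChar (-(inner ℝ x ξ)) • (sphereAvg n 1 g x : ℂ) =
      ∫ y, Real.fourierChar (-(inner ℝ x ξ)) • (g (x - (1:ℝ) • y) : ℂ) ∂(sphMeasure n) := by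
    intro x
    unfold sphereAvg
    simp only [Circle.smul_def, smul_eq_mul]
    rw [integral_const_mul, integral_complex_ofReal]
  simp_rw [e1]
  rw [integral_integral_swap h1, ← integral_mul_const]
  congr 1; ext y
  rw [← integral_add_right_eq_self (fun x => Real.fourierChar (-(inner ℝ x ξ)) •
    (g (x - (1:ℝ) • y) : ℂ)) y, ← integral_const_mul]
  congr 1; ext x
  simp only [one_smul, add_sub_cancel_right, Circle.smul_def, smul_eq_mul, inner_add_left, neg_add,
    AddChar.map_add_eq_mul, Circle.coe_mul]
  ring

end FourierSide

section Planch
open FourierTransform SchwartzMap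
open scoped ContDiff

lemma plancherel {h : Rn n → ℂ} (h1 : Integrable h) (h2 : MemLp h 2) :
    eLpNorm (𝓕 h) 2 volume = eLpNorm h 2 volume := by
  set H : Lp (α := Rn n) ℂ 2 := h2.toLp h with hH
  have hc : Continuous (𝓕 h) := VectorFourier.fourierIntegral_continuous Real.continuous_fourierChar
    (by exact continuous_inner) h1
  have key : ∀ᵐ x ∂(volume : Measure (Rn n)), (𝓕 H) x = 𝓕 h x := by
    refine ae_eq_of_integral_contDiff_smul_eq ((Lp.memLp _).locallyIntegrable (by norm_num)) hc.locallyIntegrable ?_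
    intro g hg hgs
    have hg' : ContDiff ℝ ∞ (fun x => (g x : ℂ)) := Complex.ofRealCLM.contDiff.comp hg
    have hgs' : HasCompactSupport (fun x => (g x : ℂ)) := hgs.comp_left Complex.ofReal_zero
    let ψ : 𝓢(Rn n, ℂ) := hgs'.toSchwartzMap hg'
    have hψ : ∀ x, ψ x = (g x : ℂ) := fun x => rfl
    have e1 := congrArg (fun T => T ψ) (Lp.fourier_toTemperedDistribution_eq H)
    simp only [TemperedDistribution.fourier_apply, Lp.toTemperedDistribution_apply] at e1
    have e2 : ∫ x, (𝓕 ψ) x • H x = ∫ x, (𝓕 ψ) x • h x := by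
      apply integral_congr_ae
      filter_upwards [h2.coeFn_toLp] with x hx
      rw [hx]
    have e3 : ∫ x, (𝓕 ψ) x • h x = ∫ x, ψ x • 𝓕 h x := by
      have := VectorFourier.integral_fourierIntegral_smul_eq_flip (L := innerₗ (Rn n)) (μ := volume) (ν := volume)
        Real.continuous_fourierChar (by exact continuous_inner) ψ.integrable h1
      rw [flip_innerₗ] at this
      exact this
    rw [e2, e3] at e1
    simpa only [hψ, Complex.real_smul, smul_eq_mul] using e1.symm
  rw [← eLpNorm_congr_ae key, ← eLpNorm_congr_ae (h2.coeFn_toLp)]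
  have := Lp.norm_fourier_eq H
  rw [Lp.norm_def, Lp.norm_def] at this
  exact (ENNReal.toReal_eq_toReal_iff' (Lp.eLpNorm_ne_top _) (Lp.eLpNorm_ne_top _)).1 this
end Planch
section Kernel
open FourierTransform SchwartzMap
open scoped ContDiff

lemma kernel_exists (n : ℕ) : ∃ φ : 𝓢(Rn n, ℂ), ∀ ξ, (‖ξ‖ ≤ 1 → 𝓕 (φ : Rn n → ℂ) ξ = 1) ∧
    ‖1 - 𝓕 (φ : Rn n → ℂ) ξ‖ ≤ 1 := by
  let b : ContDiffBump (0 : Rn n) := ⟨1, 2, by norm_num, by norm_num⟩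
  have hb : ContDiff ℝ ∞ (fun x => (b x : ℂ)) := Complex.ofRealCLM.contDiff.comp b.contDiff
  have hbs : HasCompactSupport (fun x => (b x : ℂ)) := b.hasCompactSupport.comp_left Complex.ofReal_zero
  let χ : 𝓢(Rn n, ℂ) := hbs.toSchwartzMap hb
  refine ⟨𝓕⁻ χ, fun ξ => ?_⟩
  have e : 𝓕 ((𝓕⁻ χ : 𝓢(Rn n, ℂ)) : Rn n → ℂ) ξ = (b ξ : ℂ) := by
    rw [← SchwartzMap.fourier_coe]; simp [χ]
  rw [e]
  constructor
  · intro h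
    rw [b.one_of_mem_closedBall (by simpa using h)]; simp
  · rw [← Complex.ofReal_one, ← Complex.ofReal_sub, Complex.norm_real, Real.norm_eq_abs,
      abs_of_nonneg (by linarith [b.le_one (x := ξ)])]
    linarith [b.nonneg (x := ξ)]

lemma schwartz_dec (φ : 𝓢(Rn n, ℂ)) (k : ℕ) : ∃ C, 0 ≤ C ∧ ∀ x, ‖φ x‖ ≤ C * ((1 + ‖x‖) ^ k)⁻¹ ∧
    ‖fderiv ℝ φ x‖ ≤ C * ((1 + ‖x‖) ^ k)⁻¹ := by
  have h0 := fun x => SchwartzMap.one_add_le_sup_seminorm_apply (𝕜 := ℝ) (m := (k, 1)) (k := k) (n := 0) le_rfl (by simp) φ x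
  have h1 := fun x => SchwartzMap.one_add_le_sup_seminorm_apply (𝕜 := ℝ) (m := (k, 1)) (k := k) (n := 1) le_rfl le_rfl φ x
  set C := 2 ^ (k, 1).1 * ((Finset.Iic (k, 1)).sup fun m => SchwartzMap.seminorm ℝ m.1 m.2) φ
  have hC : 0 ≤ C := by positivity
  refine ⟨C, hC, fun x => ?_⟩
  have hp : 0 < (1 + ‖x‖) ^ k := by positivity
  rw [← div_eq_mul_inv, le_div_iff₀ hp, le_div_iff₀ hp]
  constructor
  · have := h0 x
    rw [norm_iteratedFDeriv_zero] at this
    linarith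
  · have := h1 x
    rw [← norm_iteratedFDeriv_fderiv, norm_iteratedFDeriv_zero] at this
    linarith

lemma kernel_mod (φ : 𝓢(Rn n, ℂ)) : ∃ C, 0 ≤ C ∧ ∀ h : Rn n,
    ∫ x, ‖φ (x + h) - φ x‖ ≤ C * ‖h‖ := by
  obtain ⟨A, hA, hφ⟩ := schwartz_dec φ (n + 1)
  have hI : Integrable (fun x : Rn n => ((1 + ‖x‖) ^ (n+1))⁻¹) := by
    have := integrable_one_add_norm (E := Rn n) (μ := volume) (r := (n:ℝ) + 1) (by simp)
    refine this.congr (Filter.Eventually.of_forall fun x => ?_)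
    simp only
    rw [Real.rpow_neg (by positivity), ← Real.rpow_natCast]; push_cast; rfl
  obtain ⟨J, hJd⟩ : ∃ J, J = ∫ x : Rn n, ((1 + ‖x‖) ^ (n+1))⁻¹ := ⟨_, rfl⟩
  have hJ : 0 ≤ J := hJd ▸ integral_nonneg fun x => by positivity
  have hφ1 : 0 ≤ ∫ x, ‖φ x‖ := integral_nonneg fun x => norm_nonneg _
  refine ⟨2 ^ (n+1) * A * J + 2 * ∫ x, ‖φ x‖, by positivity, fun h => ?_⟩
  have hi : Integrable (fun x => φ (x + h)) := φ.integrable.comp_add_right h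
  rcases le_total ‖h‖ 1 with hh | hh
  · have : ∫ x, ‖φ (x + h) - φ x‖ ≤ ∫ x : Rn n, 2 ^ (n+1) * A * ‖h‖ * ((1 + ‖x‖) ^ (n+1))⁻¹ := by
      refine integral_mono (hi.sub φ.integrable).norm (hI.const_mul _) fun x => ?_
      have hseg : ∀ z ∈ segment ℝ x (x + h), ‖fderiv ℝ φ z‖ ≤ 2 ^ (n+1) * A * ((1 + ‖x‖) ^ (n+1))⁻¹ := by
        intro z hz
        have hd : ‖x - z‖ ≤ 1 := by
          rw [segment_eq_image'] at hz
          obtain ⟨t, ht, rfl⟩ := hz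
          simp only [add_sub_cancel_left, sub_add_cancel_left, norm_neg, norm_smul, Real.norm_eq_abs, abs_of_nonneg ht.1]
          nlinarith [ht.1, ht.2, norm_nonneg h]
        have h2 : 1 + ‖x‖ ≤ 2 * (1 + ‖z‖) := by
          have := norm_add_le (x - z) z
          rw [sub_add_cancel] at this
          linarith [norm_nonneg z]
        refine (hφ z).2.trans ?_
        have h3 : (1 + ‖x‖) ^ (n+1) ≤ 2 ^ (n+1) * (1 + ‖z‖) ^ (n+1) := by
          rw [← mul_pow]; gcongr
        have h4 : ((1 + ‖z‖) ^ (n+1))⁻¹ ≤ 2 ^ (n+1) * ((1 + ‖x‖) ^ (n+1))⁻¹ := by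
          rw [← div_eq_mul_inv, inv_eq_one_div, div_le_div_iff₀ (by positivity) (by positivity)]
          linarith
        calc _ ≤ A * (2 ^ (n+1) * ((1 + ‖x‖) ^ (n+1))⁻¹) := by gcongr
          _ = _ := by ring
      have := (convex_segment x (x+h)).norm_image_sub_le_of_norm_fderiv_le (𝕜 := ℝ) (f := φ)
        (fun z _ => φ.differentiableAt) hseg (left_mem_segment ℝ x (x+h)) (right_mem_segment ℝ x (x+h))
      rw [add_sub_cancel_left] at this
      calc _ ≤ _ := this
        _ = _ := by ring
    rw [integral_const_mul, ← hJd] at this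
    calc _ ≤ 2 ^ (n+1) * A * ‖h‖ * J := this
      _ = 2 ^ (n+1) * A * J * ‖h‖ := by ring
      _ ≤ _ := by gcongr; linarith
  · have q1 : Integrable (fun x => ‖φ (x + h)‖) := hi.norm
    have q2 : Integrable (fun x => ‖φ x‖) := φ.integrable.norm
    have q3 : ∫ x, ‖φ (x + h)‖ = ∫ x, ‖φ x‖ := integral_add_right_eq_self (fun x => ‖φ x‖) h
    have q4 : Integrable (fun x => ‖φ (x + h) - φ x‖) := (hi.sub φ.integrable).norm
    set P := ∫ x, ‖φ x‖
    calc ∫ x, ‖φ (x + h) - φ x‖ ≤ ∫ x, (‖φ (x + h)‖ + ‖φ x‖) :=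
          integral_mono q4 (q1.add q2) fun x => norm_sub_le _ _
      _ = 2 * P := by
          rw [integral_add q1 q2, q3]; ring
      _ ≤ (2 * P) * ‖h‖ := le_mul_of_one_le_right (by positivity) hh
      _ ≤ _ := by
          have : 0 ≤ 2 ^ (n+1) * A * J := by positivity
          exact mul_le_mul_of_nonneg_right (le_add_of_nonneg_left this) (norm_nonneg _)

end Kernel
section Kernel2
open FourierTransform SchwartzMap
open scoped ContDiff

noncomputable def kd (φ : 𝓢(Rn n, ℂ)) (δ : ℝ) (x : Rn n) : ℂ := ((δ ^ n)⁻¹ : ℝ) • φ (δ⁻¹ • x)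

lemma kd_cont (φ : 𝓢(Rn n, ℂ)) (δ : ℝ) : Continuous (kd φ δ) := by
  unfold kd
  have := φ.continuous
  fun_prop

lemma kd_int (φ : 𝓢(Rn n, ℂ)) {δ : ℝ} (hδ : 0 < δ) : Integrable (kd φ δ) := by
  have : Integrable (fun x => φ (δ⁻¹ • x)) := (integrable_comp_smul_iff volume φ (inv_ne_zero hδ.ne')).2 φ.integrable
  exact this.smul ((δ ^ n)⁻¹ : ℝ)

lemma kd_fourier (φ : 𝓢(Rn n, ℂ)) {δ : ℝ} (hδ : 0 < δ) (ξ : Rn n) :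
    𝓕 (kd φ δ) ξ = 𝓕 (φ : Rn n → ℂ) (δ • ξ) := by
  rw [Real.fourier_eq, Real.fourier_eq]
  have h := Measure.integral_comp_inv_smul_of_nonneg volume
    (fun x : Rn n => Real.fourierChar (-(inner ℝ x (δ • ξ))) • φ x) hδ.le
  have e : ∀ x : Rn n, Real.fourierChar (-(inner ℝ x ξ)) • kd φ δ x = ((δ ^ n)⁻¹ : ℝ) •
      (Real.fourierChar (-(inner ℝ (δ⁻¹ • x) (δ • ξ))) • φ (δ⁻¹ • x)) := by
    intro x
    rw [real_inner_smul_left, real_inner_smul_right, inv_mul_cancel_left₀ hδ.ne']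
    unfold kd
    rw [smul_comm]
  simp_rw [e]
  rw [integral_smul, h, smul_smul, finrank_euclideanSpace_fin, inv_mul_cancel₀ (by positivity), one_smul]

lemma kd_mod (φ : 𝓢(Rn n, ℂ)) : ∃ C, 0 ≤ C ∧ ∀ δ : ℝ, 0 < δ → ∀ h : Rn n,
    ∫ x, ‖kd φ δ (x + h) - kd φ δ x‖ ≤ C * δ⁻¹ * ‖h‖ := by
  obtain ⟨C, hC, H⟩ := kernel_mod φ
  refine ⟨C, hC, fun δ hδ h => ?_⟩
  have h1 := Measure.integral_comp_inv_smul_of_nonneg volume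
    (fun x : Rn n => ‖φ (x + δ⁻¹ • h) - φ x‖) hδ.le
  have e : ∀ x : Rn n, ‖kd φ δ (x + h) - kd φ δ x‖ = (δ ^ n)⁻¹ * ‖φ (δ⁻¹ • x + δ⁻¹ • h) - φ (δ⁻¹ • x)‖ := by
    intro x
    unfold kd
    rw [← smul_sub, norm_smul, Real.norm_eq_abs, abs_of_pos (by positivity), smul_add]
  simp_rw [e]
  rw [integral_const_mul, h1, finrank_euclideanSpace_fin, smul_eq_mul, inv_mul_cancel_left₀ (by positivity)]
  refine (H _).trans ?_
  rw [norm_smul, Real.norm_eq_abs, abs_of_pos (by positivity)]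
  exact (by ring : _ = _).le

lemma kd_sph (hn : 2 ≤ n) (φ : 𝓢(Rn n, ℂ)) : ∃ C, 0 ≤ C ∧ ∀ δ : ℝ, 0 < δ → ∀ u : Rn n,
    ∫ y, ‖kd φ δ (u + y)‖ ∂(sphMeasure n) ≤ C * δ⁻¹ := by
  obtain ⟨A, hA, hφ⟩ := schwartz_dec φ n
  refine ⟨2 * (A * 2 ^ n * 4 ^ n), by positivity, fun δ hδ u => ?_⟩
  have hcc : Continuous fun y => ‖kd φ δ (u + y)‖ :=
    ((kd_cont φ δ).comp (by fun_prop : Continuous fun y => u + y)).norm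
  rw [integral_eq_lintegral_of_nonneg_ae (Filter.Eventually.of_forall fun y => norm_nonneg _)
    hcc.aestronglyMeasurable]
  refine ENNReal.toReal_le_of_le_ofReal (by positivity) ?_
  have hpt : ∀ y, ENNReal.ofReal ‖kd φ δ (u + y)‖ ≤ ∑' k : ℕ,
      (closedBall (-u) (2 ^ k * δ)).indicator (fun _ => ENNReal.ofReal ((δ ^ n)⁻¹ * (A * (2 ^ n * ((2 ^ k) ^ n)⁻¹)))) y := by
    intro y
    have hex : ∃ k : ℕ, ‖u + y‖ ≤ 2 ^ k * δ := by
      obtain ⟨k, hk⟩ := pow_unbounded_of_one_lt (‖u + y‖ / δ) (one_lt_two)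
      exact ⟨k, by rw [div_lt_iff₀ hδ] at hk; exact hk.le⟩
    classical
    set k := Nat.find hex
    have hk : ‖u + y‖ ≤ 2 ^ k * δ := Nat.find_spec hex
    refine le_trans ?_ (ENNReal.le_tsum k)
    rw [indicator_of_mem (by rw [mem_closedBall, dist_eq_norm, sub_neg_eq_add, add_comm]; exact hk)]
    apply ENNReal.ofReal_le_ofReal
    unfold kd
    rw [norm_smul, Real.norm_eq_abs, abs_of_pos (by positivity)]
    gcongr
    refine (hφ _).1.trans ?_
    gcongr
    have hlow : D2 ^ k ≤ 2 * (1 + ‖δ⁻¹ • (u + y)‖) := by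
      rcases Nat.eq_zero_or_pos k with h0 | h0
      · rw [h0, pow_zero]; linarith [norm_nonneg (δ⁻¹ • (u + y))]
      · have := Nat.find_min hex (m := k - 1) (by omega)
        push Not at this
        rw [norm_smul, Real.norm_eq_abs, abs_of_pos (by positivity)]
        have h2 : D2 ^ k = 2 * 2 ^ (k - 1) := by
          rw [← pow_succ']; congr 1; omega
        have h3 : D2 ^ (k-1) ≤ δ⁻¹ * ‖u + y‖ := by
          rw [inv_mul_eq_div, le_div_iff₀ hδ]; exact this.le
        linarith
    rw [← div_eq_mul_inv, inv_eq_one_div, div_le_div_iff₀ (by positivity) (by positivity), one_mul, ← mul_pow]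
    gcongr
  calc ∫⁻ y, ENNReal.ofReal ‖kd φ δ (u + y)‖ ∂(sphMeasure n) ≤ _ := lintegral_mono hpt
    _ = ∑' k : ℕ, ENNReal.ofReal ((δ ^ n)⁻¹ * (A * (2 ^ n * ((2 ^ k) ^ n)⁻¹))) * sphMeasure n (closedBall (-u) (2 ^ k * δ)) := by
        rw [lintegral_tsum fun k => (measurable_const.indicator isClosed_closedBall.measurableSet).aemeasurable]
        congr 1; ext k
        rw [lintegral_indicator_const isClosed_closedBall.measurableSet]
    _ ≤ ∑' k : ℕ, ENNReal.ofReal (A * 2 ^ n * 4 ^ n * δ⁻¹ * (1 / 2) ^ k) := by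
        refine ENNReal.tsum_le_tsum fun k => ?_
        refine (mul_le_mul_right (sph_ball hn _ (by positivity)) _).trans ?_
        rw [← ENNReal.ofReal_mul (by positivity)]
        apply le_of_eq; congr 1
        obtain ⟨m, rfl⟩ : ∃ m, n = m + 1 := ⟨n - 1, by omega⟩
        simp only [Nat.add_sub_cancel, mul_pow, pow_succ (2 ^ k : ℝ), pow_succ δ, one_div, inv_pow]
        field_simp
    _ = ENNReal.ofReal (2 * (A * 2 ^ n * 4 ^ n) * δ⁻¹) := by
        rw [← ENNReal.ofReal_tsum_of_nonneg (fun k => by positivity) (summable_geometric_two.mul_left _), tsum_mul_left, tsum_geometric_two]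
        congr 1; ring
end Kernel2
section Smooth
open FourierTransform SchwartzMap
open scoped ContDiff Convolution

lemma memLp_two_of_bdd {F : Type*} [NormedAddCommGroup F] {h : Rn n → F} (hi : Integrable h) {M : ℝ} (hM : ∀ x, ‖h x‖ ≤ M) :
    MemLp h 2 := by
  rw [memLp_two_iff_integrable_sq_norm hi.aestronglyMeasurable]
  refine (hi.norm.const_mul M).mono' (hi.aestronglyMeasurable.norm.pow 2) (Filter.Eventually.of_forall fun x => ?_)
  rw [Real.norm_eq_abs, abs_of_nonneg (by positivity), sq]
  exact mul_le_mul_of_nonneg_right (hM x) (norm_nonneg _)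

set_option maxHeartbeats 1000000 in
lemma smoothing (hn : 2 ≤ n) : ∃ C, 0 ≤ C ∧ ∀ δ : ℝ, 0 < δ → δ ≤ 1 → ∀ g : Rn n → ℝ, Nice g →
    ∃ w : Rn n → ℝ, Nice w ∧ (∀ x, |w x| ≤ C * δ⁻¹ * ∫ x, |g x|) ∧
      (∀ M, (∀ x, |g x| ≤ M) → ∀ x y, |w x - w y| ≤ C * δ⁻¹ * M * ‖x - y‖) ∧
      eLpNorm (fun x => sphereAvg n 1 g x - w x) 2 volume ≤
        ENNReal.ofReal (C * δ ^ (((n:ℝ)-1)/2)) * eLpNorm g 2 volume := by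
  obtain ⟨φ, hφ⟩ := kernel_exists n
  obtain ⟨C1, hC1, H1⟩ := kd_mod φ
  obtain ⟨C2, hC2, H2⟩ := kd_sph hn φ
  obtain ⟨C3, hC3, H3⟩ := sph_decay2 hn
  refine ⟨C1 + C2 + C3, by positivity, fun δ hδ hδ1 g hg => ?_⟩
  have hv := hg.sphereAvg 1
  set v := sphereAvg n 1 g with hvdef
  have hki := kd_int φ hδ
  have hkc := kd_cont φ δ
  have hvi : Integrable (fun x => (v x : ℂ)) := hv.int.ofReal
  let W : Rn n → ℂ := kd φ δ ⋆[ContinuousLinearMap.mul ℂ ℂ, volume] (fun x => (v x : ℂ))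
  have hW : ∀ x, W x = ∫ z, kd φ δ (x - z) * (v z : ℂ) := fun x => convolution_eq_swap _
  have hWi : Integrable W := hki.integrable_convolution _ hvi
  have hkx : ∀ x, Integrable (fun z => kd φ δ (x - z)) := fun x => hki.comp_sub_left x
  have hkb : ∃ M, ∀ x, ‖kd φ δ x‖ ≤ M := by
    obtain ⟨A, hA, hd⟩ := schwartz_dec φ 0
    refine ⟨(δ ^ n)⁻¹ * A, fun x => ?_⟩
    unfold kd
    rw [norm_smul, Real.norm_eq_abs, abs_of_pos (by positivity)]
    gcongr
    simpa using (hd (δ⁻¹ • x)).1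
  obtain ⟨Mk, hMk⟩ := hkb
  have hprod : ∀ x, Integrable (fun z => kd φ δ (x - z) * (v z : ℂ)) := fun x =>
    hvi.bdd_mul (c := Mk) (hkc.comp (by fun_prop : Continuous fun z => x - z)).aestronglyMeasurable
      (Filter.Eventually.of_forall fun z => hMk _)
  -- sup bound
  have hsup : ∀ x, ‖W x‖ ≤ C2 * δ⁻¹ * ∫ x, |g x| := by
    intro x
    have hkn : Nice (fun z => ‖kd φ δ (x - z)‖) :=
      ⟨((hkc.comp (by fun_prop : Continuous fun z => x - z)).norm).measurable, ⟨Mk, fun z => by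
        rw [abs_norm]; exact hMk _⟩, (hkx x).norm⟩
    have hga : Nice (fun x => |g x|) := ⟨hg.meas.abs, by
      obtain ⟨M, hM⟩ := hg.bdd; exact ⟨M, fun x => by rw [abs_abs]; exact hM x⟩, hg.int.abs⟩
    have hkz : ∀ z, sphereAvg n 1 (fun z => ‖kd φ δ (x - z)‖) z ≤ C2 * δ⁻¹ := by
      intro z
      have h2 := H2 δ hδ (x - z)
      have : ∀ y : Rn n, x - (z - (1:ℝ) • y) = x - z + y := fun y => by rw [one_smul]; abel
      simp only [sphereAvg, this]
      exact h2
    rw [hW]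
    calc ‖∫ z, kd φ δ (x - z) * (v z : ℂ)‖ ≤ ∫ z, ‖kd φ δ (x - z)‖ * sphereAvg n 1 (fun x => |g x|) z := by
          refine norm_integral_le_of_norm_le (hkn.mul (hga.sphereAvg 1)) (Filter.Eventually.of_forall fun z => ?_)
          rw [norm_mul, Complex.norm_real]
          refine mul_le_mul_of_nonneg_left ?_ (norm_nonneg _)
          exact norm_integral_le_integral_norm _
      _ = ∫ z, sphereAvg n 1 (fun z => ‖kd φ δ (x - z)‖) z * |g z| := (sphereAvg_adj hkn hga 1).symm
      _ ≤ ∫ z, (C2 * δ⁻¹) * |g z| := by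
          refine integral_mono ((hkn.sphereAvg 1).mul hga) (hga.int.const_mul _) fun z => ?_
          exact mul_le_mul_of_nonneg_right (hkz z) (abs_nonneg _)
      _ = _ := integral_const_mul _ _
  -- Lipschitz
  have hlip : ∀ M, (∀ x, |g x| ≤ M) → ∀ x y, ‖W x - W y‖ ≤ C1 * δ⁻¹ * M * ‖x - y‖ := by
    intro M hM x y
    have hM0 : 0 ≤ M := (abs_nonneg _).trans (hM 0)
    rw [hW, hW, ← integral_sub (hprod x) (hprod y)]
    have hd : Integrable (fun z => ‖kd φ δ (x - z) - kd φ δ (y - z)‖ * M) :=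
      (((hkx x).sub (hkx y)).norm).mul_const M
    calc _ ≤ ∫ z, ‖kd φ δ (x - z) - kd φ δ (y - z)‖ * M := by
          refine norm_integral_le_of_norm_le hd (Filter.Eventually.of_forall fun z => ?_)
          rw [← sub_mul, norm_mul, Complex.norm_real]
          exact mul_le_mul_of_nonneg_left (sphereAvg_bound hM 1 z) (norm_nonneg _)
      _ = (∫ z, ‖kd φ δ (z + (x - y)) - kd φ δ z‖) * M := by
          rw [integral_mul_const]
          congr 1
          rw [← integral_sub_left_eq_self (fun z => ‖kd φ δ (z + (x - y)) - kd φ δ z‖) volume y]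
          congr 1; ext z; congr 3; abel
      _ ≤ (C1 * δ⁻¹ * ‖x - y‖) * M := mul_le_mul_of_nonneg_right (H1 δ hδ _) hM0
      _ = _ := by ring
  -- nice
  have hWc : Continuous W := by
    obtain ⟨M, hM⟩ := hg.bdd
    have hM0 : 0 ≤ M := (abs_nonneg _).trans (hM 0)
    exact (LipschitzWith.of_dist_le_mul (K := ⟨C1 * δ⁻¹ * M, by positivity⟩) fun x y => by
      rw [dist_eq_norm, dist_eq_norm]; exact hlip M hM x y).continuous
  have hI0 : 0 ≤ ∫ x, |g x| := integral_nonneg fun x => abs_nonneg _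
  refine ⟨fun x => (W x).re, ⟨(Complex.continuous_re.comp hWc).measurable,
    ⟨_, fun x => (Complex.abs_re_le_norm _).trans (hsup x)⟩, hWi.re⟩, fun x => ?_, fun M hM x y => ?_, ?_⟩
  · refine ((Complex.abs_re_le_norm _).trans (hsup x)).trans ?_
    gcongr; linarith
  · have hM0 : 0 ≤ M := (abs_nonneg _).trans (hM 0)
    rw [← Complex.sub_re]
    refine ((Complex.abs_re_le_norm _).trans (hlip M hM x y)).trans ?_
    gcongr; linarith
  · obtain ⟨M, hM⟩ := hg.bdd
    have hgi : Integrable (fun x => (g x : ℂ)) := hg.int.ofReal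
    have hg2 : MemLp (fun x => (g x : ℂ)) 2 := memLp_two_of_bdd hgi (M := M) fun x => by
      rw [Complex.norm_real]; exact hM x
    have hD : Integrable (fun x => (v x : ℂ) - W x) := hvi.sub hWi
    have hD2 : MemLp (fun x => (v x : ℂ) - W x) 2 :=
      memLp_two_of_bdd hD (M := M + C2 * δ⁻¹ * ∫ x, |g x|) fun x => by
        refine (norm_sub_le _ _).trans (add_le_add ?_ (hsup x))
        rw [Complex.norm_real]; exact sphereAvg_bound hM 1 x
    have hfour : ∀ ξ, ‖𝓕 (fun x => (v x : ℂ) - W x) ξ‖ ≤ (C3 * δ ^ (((n:ℝ)-1)/2)) * ‖𝓕 (fun x => (g x : ℂ)) ξ‖ := by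
      intro ξ
      have e1 : 𝓕 (fun x => (v x : ℂ) - W x) ξ = 𝓕 (fun x => (v x : ℂ)) ξ - 𝓕 W ξ := by
        simp only [Real.fourier_eq, smul_sub]
        exact integral_sub ((Real.fourierIntegral_convergent_iff ξ).2 hvi)
          ((Real.fourierIntegral_convergent_iff ξ).2 hWi)
      rw [e1, show 𝓕 W ξ = _ from Real.fourier_mul_convolution_eq hki hvi ξ, kd_fourier φ hδ,
        hvdef, sph_fourier hg, ← one_sub_mul, ← mul_assoc, norm_mul, norm_mul, Complex.norm_real]
      refine mul_le_mul_of_nonneg_right ?_ (norm_nonneg _)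
      rcases le_total ‖δ • ξ‖ 1 with h | h
      · rw [(hφ _).1 h]; simp; positivity
      · rw [norm_smul, Real.norm_eq_abs, abs_of_pos hδ] at h
        have hx : δ⁻¹ ≤ ‖(2 * Real.pi) • ξ‖ := by
          rw [norm_smul, Real.norm_eq_abs, abs_of_pos Real.two_pi_pos, inv_eq_one_div, div_le_iff₀ hδ]
          nlinarith [Real.pi_gt_three, norm_nonneg ξ]
        have hx1 : 1 ≤ δ⁻¹ := (one_le_inv₀ hδ).2 hδ1
        calc _ ≤ 1 * (C3 * ‖(2 * Real.pi) • ξ‖ ^ (-(((n:ℝ)-1)/2))) :=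
              mul_le_mul (hφ _).2 (H3 _ (hx1.trans hx)) (abs_nonneg _) zero_le_one
          _ ≤ C3 * (δ⁻¹) ^ (-(((n:ℝ)-1)/2)) := by
              rw [one_mul]
              refine mul_le_mul_of_nonneg_left ?_ hC3
              refine Real.rpow_le_rpow_of_nonpos (by positivity) hx ?_
              have : D2 ≤ n := by exact_mod_cast hn
              linarith
          _ = _ := by rw [Real.rpow_neg (by positivity), Real.inv_rpow hδ.le, inv_inv]
    calc eLpNorm (fun x => v x - (W x).re) 2 volume ≤ eLpNorm (fun x => (v x : ℂ) - W x) 2 volume := by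
          refine eLpNorm_mono fun x => ?_
          have := Complex.abs_re_le_norm ((v x : ℂ) - W x)
          rwa [Complex.sub_re, Complex.ofReal_re] at this
      _ = eLpNorm (𝓕 (fun x => (v x : ℂ) - W x)) 2 volume := (plancherel hD hD2).symm
      _ ≤ ENNReal.ofReal (C3 * δ ^ (((n:ℝ)-1)/2)) * eLpNorm (𝓕 (fun x => (g x : ℂ))) 2 volume :=
          eLpNorm_le_mul_eLpNorm_of_ae_le_mul (Filter.Eventually.of_forall hfour) 2
      _ = ENNReal.ofReal (C3 * δ ^ (((n:ℝ)-1)/2)) * eLpNorm g 2 volume := by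
          rw [plancherel hgi hg2]
          congr 1
          exact eLpNorm_congr_norm_ae (Filter.Eventually.of_forall fun x => Complex.norm_real _)
      _ ≤ _ := by
          gcongr; linarith

end Smooth

section Cells

noncomputable def cidx (h : ℝ) (v : Fin n → ℝ) (x : Rn n) : Fin n → ℤ := fun i => ⌊(x i + v i) / h⌋

def cell (h : ℝ) (v : Fin n → ℝ) (m : Fin n → ℤ) : Set (Rn n) := {x | cidx h v x = m}

noncomputable def cE (h : ℝ) (v : Fin n → ℝ) (f : Rn n → ℝ) (x : Rn n) : ℝ :=
  (h ^ n)⁻¹ * ∫ y in cell h v (cidx h v x), f y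

lemma cidx_meas (h : ℝ) (v : Fin n → ℝ) : Measurable (cidx h v) := by
  unfold cidx
  refine measurable_pi_lambda _ fun i => Int.measurable_floor.comp ?_
  fun_prop

lemma cell_meas (h : ℝ) (v : Fin n → ℝ) (m : Fin n → ℤ) : MeasurableSet (cell h v m) :=
  cidx_meas h v (measurableSet_singleton m)

lemma mem_cell {h : ℝ} (hh : 0 < h) {v : Fin n → ℝ} {m : Fin n → ℤ} {x : Rn n} :
    x ∈ cell h v m ↔ ∀ i, h * m i - v i ≤ x i ∧ x i < h * m i - v i + h := by
  simp only [cell, cidx, mem_ofPred_eq, funext_iff, Int.floor_eq_iff, le_div_iff₀ hh, div_lt_iff₀ hh]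
  refine forall_congr' fun i => ?_
  constructor <;> rintro ⟨h1, h2⟩ <;> constructor <;> nlinarith

lemma box_vol (c : Fin n → ℝ) {h : ℝ} (hh : 0 < h) :
    volume {x : Rn n | ∀ i, c i ≤ x i ∧ x i < c i + h} = ENNReal.ofReal (h ^ n) ∧
    volume {x : Rn n | ∀ i, c i ≤ x i ∧ x i ≤ c i + h} = ENNReal.ofReal (h ^ n) := by
  have e := (EuclideanSpace.volume_preserving_symm_measurableEquiv_toLp (Fin n))
  have h1 : {x : Rn n | ∀ i, c i ≤ x i ∧ x i < c i + h} =
      (MeasurableEquiv.toLp 2 (Fin n → ℝ)).symm ⁻¹' (Set.pi univ fun i => Ico (c i) (c i + h)) := by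
    ext x; rw [mem_preimage, mem_univ_pi]; rfl
  have h2 : {x : Rn n | ∀ i, c i ≤ x i ∧ x i ≤ c i + h} =
      (MeasurableEquiv.toLp 2 (Fin n → ℝ)).symm ⁻¹' (Set.pi univ fun i => Icc (c i) (c i + h)) := by
    ext x; rw [mem_preimage, mem_univ_pi]; rfl
  rw [h1, h2, e.measure_preimage_equiv, e.measure_preimage_equiv, volume_pi_pi, volume_pi_pi]
  simp [ENNReal.ofReal_pow hh.le]

lemma cell_vol {h : ℝ} (hh : 0 < h) (v : Fin n → ℝ) (m : Fin n → ℤ) :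
    volume (cell h v m) = ENNReal.ofReal (h ^ n) := by
  rw [← (box_vol (fun i => h * m i - v i) hh).1]
  congr 1; ext x; exact mem_cell hh

lemma cell_vol_real {h : ℝ} (hh : 0 < h) (v : Fin n → ℝ) (m : Fin n → ℤ) :
    volume.real (cell h v m) = h ^ n := by
  rw [Measure.real, cell_vol hh, ENNReal.toReal_ofReal (by positivity)]

lemma cell_diam {h : ℝ} (hh : 0 < h) {v : Fin n → ℝ} {x y : Rn n}
    (hxy : cidx h v x = cidx h v y) : ‖x - y‖ ≤ n * h := by
  have hx := (mem_cell hh (v := v) (m := cidx h v x) (x := x)).1 rfl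
  have hy := (mem_cell hh (v := v) (m := cidx h v x) (x := y)).1 hxy.symm
  rw [EuclideanSpace.norm_eq]
  calc √(∑ i, ‖(x - y) i‖ ^ 2) ≤ ∑ i, ‖(x - y) i‖ := by
        rw [Real.sqrt_le_left (Finset.sum_nonneg fun i _ => norm_nonneg _)]
        exact Finset.sum_sq_le_sq_sum_of_nonneg fun i _ => norm_nonneg _
    _ ≤ ∑ i : Fin n, h := Finset.sum_le_sum fun i _ => by
        rw [PiLp.sub_apply, Real.norm_eq_abs, abs_le]
        constructor <;> linarith [hx i, hy i, (hx i).1, (hx i).2, (hy i).1, (hy i).2]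
    _ = _ := by simp

lemma cE_measurable (h : ℝ) (v : Fin n → ℝ) (f : Rn n → ℝ) : Measurable (cE h v f) := by
  have : Measurable (fun m : Fin n → ℤ => (h ^ n)⁻¹ * ∫ y in cell h v m, f y) := measurable_of_countable _
  exact this.comp (cidx_meas h v)

lemma cE_bound {h : ℝ} (hh : 0 < h) (v : Fin n → ℝ) {f : Rn n → ℝ} {M : ℝ} (hM : ∀ x, |f x| ≤ M) (x : Rn n) :
    |cE h v f x| ≤ M := by
  have h1 := norm_setIntegral_le_of_norm_le_const (μ := volume) (f := f) (s := cell h v (cidx h v x)) (C := M)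
    (by rw [cell_vol hh]; exact ENNReal.ofReal_lt_top) (fun y _ => hM y)
  rw [cell_vol_real hh] at h1
  unfold cE
  rw [abs_mul, abs_of_pos (by positivity), inv_mul_le_iff₀ (by positivity), mul_comm]
  exact h1

lemma cE_prod_int {h : ℝ} (hh : 0 < h) (v : Fin n → ℝ) {f : Rn n → ℝ} (hf : Nice f) :
    Integrable (fun p : Rn n × Rn n => (cell h v (cidx h v p.1)).indicator f p.2) (volume.prod volume) ∧
    ∫ x, ∫ y, |(cell h v (cidx h v x)).indicator f y| = h ^ n * ∫ y, |f y| := by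
  have hset : MeasurableSet {p : Rn n × Rn n | cidx h v p.2 = cidx h v p.1} :=
    measurableSet_eq_fun ((cidx_meas h v).comp measurable_snd) ((cidx_meas h v).comp measurable_fst)
  have heq : (fun p : Rn n × Rn n => (cell h v (cidx h v p.1)).indicator f p.2) =
      {p : Rn n × Rn n | cidx h v p.2 = cidx h v p.1}.indicator (fun p => f p.2) := by
    ext p; rfl
  have hm : Measurable (fun p : Rn n × Rn n => (cell h v (cidx h v p.1)).indicator f p.2) := by
    rw [heq]; exact (hf.meas.comp measurable_snd).indicator hset
  have hcol : ∀ y, (fun x => (cell h v (cidx h v x)).indicator f y) =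
      (cell h v (cidx h v y)).indicator (fun _ => f y) := by
    intro y; ext x; simp only [indicator, cell, mem_ofPred_eq]
    congr 1; exact propext eq_comm
  have h1 : ∀ y, Integrable (fun x => (cell h v (cidx h v x)).indicator f y) := by
    intro y; rw [hcol, integrable_indicator_iff (cell_meas _ _ _)]
    exact integrableOn_const (by rw [cell_vol hh]; exact ENNReal.ofReal_ne_top)
  have h2 : (fun y => ∫ x, ‖(cell h v (cidx h v x)).indicator f y‖) = fun y => h ^ n * |f y| := by
    ext y
    have : ∀ x, ‖(cell h v (cidx h v x)).indicator f y‖ = (cell h v (cidx h v y)).indicator (fun _ => |f y|) x := by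
      intro x; rw [show (cell h v (cidx h v x)).indicator f y = (cell h v (cidx h v y)).indicator (fun _ => f y) x from congrFun (hcol y) x, norm_indicator_eq_indicator_norm]; rfl
    simp_rw [this]
    rw [integral_indicator_const _ (cell_meas _ _ _), cell_vol_real hh, smul_eq_mul]
  have h3 : Integrable (fun y => ∫ x, ‖(cell h v (cidx h v x)).indicator f y‖) := by
    rw [h2]; exact hf.int.abs.const_mul _
  have hI := (integrable_prod_iff' hm.aestronglyMeasurable).2 ⟨Filter.Eventually.of_forall h1, h3⟩
  refine ⟨hI, ?_⟩
  calc _ = ∫ y, ∫ x, ‖(cell h v (cidx h v x)).indicator f y‖ :=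
        integral_integral_swap (f := fun x y => ‖(cell h v (cidx h v x)).indicator f y‖) hI.norm
    _ = _ := by rw [h2, integral_const_mul]

lemma cE_eq (h : ℝ) (v : Fin n → ℝ) (f : Rn n → ℝ) (x : Rn n) :
    cE h v f x = (h ^ n)⁻¹ * ∫ y, (cell h v (cidx h v x)).indicator f y := by
  rw [integral_indicator (cell_meas _ _ _)]; rfl

lemma Nice.cE {h : ℝ} (hh : 0 < h) (v : Fin n → ℝ) {f : Rn n → ℝ} (hf : Nice f) : Nice (cE h v f) := by
  obtain ⟨M, hM⟩ := hf.bdd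
  refine ⟨cE_measurable h v f, ⟨M, cE_bound hh v hM⟩, ?_⟩
  have := (cE_prod_int hh v hf).1.integral_prod_left.const_mul (h ^ n)⁻¹
  exact this.congr (Filter.Eventually.of_forall fun x => (cE_eq h v f x).symm)

lemma cE_L1 {h : ℝ} (hh : 0 < h) (v : Fin n → ℝ) {f : Rn n → ℝ} (hf : Nice f) :
    ∫ x, |cE h v f x| ≤ ∫ x, |f x| := by
  have hp := cE_prod_int hh v hf
  calc ∫ x, |cE h v f x| ≤ ∫ x, (h ^ n)⁻¹ * ∫ y, |(cell h v (cidx h v x)).indicator f y| := by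
        refine integral_mono (hf.cE hh v).int.abs (hp.1.norm.integral_prod_left.const_mul _) fun x => ?_
        change |cE h v f x| ≤ _
        rw [cE_eq, abs_mul, abs_of_pos (by positivity)]
        exact mul_le_mul_of_nonneg_left (abs_integral_le_integral_abs) (by positivity)
    _ = _ := by rw [integral_const_mul, hp.2, inv_mul_cancel_left₀ (by positivity)]

lemma cE_adj {h : ℝ} (hh : 0 < h) (v : Fin n → ℝ) {f g : Rn n → ℝ} (hf : Nice f) (hg : Nice g) :
    ∫ x, cE h v f x * g x = ∫ x, f x * cE h v g x := by
  obtain ⟨N, hN⟩ := hg.bdd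
  have h1 : Integrable (fun p : Rn n × Rn n => (cell h v (cidx h v p.1)).indicator f p.2 * g p.1)
      (volume.prod volume) :=
    (cE_prod_int hh v hf).1.mul_bdd (hg.meas.comp measurable_fst).aestronglyMeasurable
      (Filter.Eventually.of_forall fun p => hN _)
  have e1 : ∀ x, cE h v f x * g x = (h ^ n)⁻¹ * ∫ y, (cell h v (cidx h v x)).indicator f y * g x := by
    intro x; rw [integral_mul_const, cE_eq, mul_assoc]
  have e2 : ∀ y, f y * cE h v g y = (h ^ n)⁻¹ * ∫ x, (cell h v (cidx h v x)).indicator f y * g x := by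
    intro y; rw [cE_eq, mul_left_comm, ← integral_const_mul]
    congr 2; ext x
    simp only [indicator, cell, mem_ofPred_eq, eq_comm (a := cidx h v x)]
    by_cases hc : cidx h v y = cidx h v x <;> simp [hc]
  simp_rw [e1, e2]
  rw [integral_const_mul, integral_const_mul,
    integral_integral_swap (f := fun x y => (cell h v (cidx h v x)).indicator f y * g x) h1]

lemma cE_lip {h : ℝ} (hh : 0 < h) (v : Fin n → ℝ) {w : Rn n → ℝ} (hw : Nice w) {L : ℝ} (hL0 : 0 ≤ L)
    (hL : ∀ x y, |w x - w y| ≤ L * ‖x - y‖) (x : Rn n) : |w x - cE h v w x| ≤ L * (n * h) := by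
  have hfin : volume (cell h v (cidx h v x)) < ⊤ := by rw [cell_vol hh]; exact ENNReal.ofReal_lt_top
  have e : w x - cE h v w x = (h ^ n)⁻¹ * ∫ y in cell h v (cidx h v x), (w x - w y) := by
    have hc : Integrable (fun _ : Rn n => w x) (volume.restrict (cell h v (cidx h v x))) :=
      integrableOn_const hfin.ne
    rw [integral_sub hc hw.int.integrableOn, setIntegral_const, cell_vol_real hh,
      smul_eq_mul, mul_sub, inv_mul_cancel_left₀ (by positivity)]; rfl
  rw [e, abs_mul, abs_of_pos (by positivity), inv_mul_le_iff₀ (by positivity), mul_comm]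
  have := norm_setIntegral_le_of_norm_le_const (μ := volume) (f := fun y => w x - w y)
    (s := cell h v (cidx h v x)) (C := L * (n * h)) hfin (fun y hy => (hL x y).trans
      (mul_le_mul_of_nonneg_left (cell_diam hh (v := v) (Eq.symm hy)) hL0))
  rwa [cell_vol_real hh] at this

end Cells

section Phi

lemma Nice.l2 {F : Rn n → ℝ} (hF : Nice F) {M A : ℝ} (hM : ∀ x, |F x| ≤ M) (hA : ∫ x, |F x| ≤ A) :
    eLpNorm F 2 volume ≤ ENNReal.ofReal (√(M * A)) := by
  have hm := memLp_two_of_bdd hF.int hM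
  rw [hm.eLpNorm_eq_integral_rpow_norm (by norm_num) (by norm_num)]
  apply ENNReal.ofReal_le_ofReal
  have hM0 : 0 ≤ M := (abs_nonneg _).trans (hM 0)
  simp only [ENNReal.toReal_ofNat]
  rw [← one_div, ← Real.sqrt_eq_rpow]
  apply Real.sqrt_le_sqrt
  calc ∫ x, ‖F x‖ ^ D2 ≤ ∫ x, M * |F x| := by
        refine integral_mono_of_nonneg (Filter.Eventually.of_forall fun x => by positivity) (hF.int.abs.const_mul M)
          (Filter.Eventually.of_forall fun x => ?_)
        simp only [Real.rpow_two, Real.norm_eq_abs, sq]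
        exact mul_le_mul_of_nonneg_right (hM x) (abs_nonneg _)
    _ ≤ _ := by rw [integral_const_mul]; gcongr

lemma cs_bound {F H : Rn n → ℝ} (hF : Nice F) (hH : Nice H) {P Q : ℝ} (hP0 : 0 ≤ P)
    (hQ0 : 0 ≤ Q) (hP : eLpNorm F 2 volume ≤ ENNReal.ofReal P) (hQ : eLpNorm H 2 volume ≤ ENNReal.ofReal Q) :
    |∫ x, F x * H x| ≤ P * Q := by
  have h1 := eLpNorm_smul_le_mul_eLpNorm (p := 2) (q := 2) (r := 1) (μ := volume) (f := H) (φ := F) hH.meas.aestronglyMeasurable hF.meas.aestronglyMeasurable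
  have h2 : eLpNorm (F • H) 1 volume ≤ ENNReal.ofReal (P * Q) := by
    rw [ENNReal.ofReal_mul hP0]
    exact h1.trans (by gcongr)
  have h3 : ‖∫ x, F x * H x‖ₑ ≤ ENNReal.ofReal (P * Q) := by
    refine (enorm_integral_le_lintegral_enorm _).trans ?_
    rw [eLpNorm_one_eq_lintegral_enorm] at h2
    exact h2
  rw [← ofReal_norm] at h3
  exact (ENNReal.ofReal_le_ofReal_iff (by positivity)).1 h3

lemma phi_core (hn : 2 ≤ n) : ∃ K : ℝ, 1 ≤ K ∧ ∀ f g : Rn n → ℝ, Nice f → Nice g →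
    (∀ x, |f x| ≤ 1) → (∀ x, |g x| ≤ 1) → ∀ a b : ℝ, 0 < a → 0 < b → ∫ x, |f x| ≤ a → ∫ x, |g x| ≤ b →
    ∀ (h : ℝ) (v : Fin n → ℝ), 0 < h → ∀ δ : ℝ, 0 < δ → δ ≤ 1 →
    |∫ x, sphereAvg n 1 (fun x => f x - cE h v f x) x * g x| ≤ K * δ⁻¹ * a * min b h +
      K * δ ^ (((n:ℝ)-1)/2) * √(a * b) ∧
    |∫ x, sphereAvg n 1 (fun x => f x - cE h v f x) x * g x| ≤ 2 * a ∧
    |∫ x, sphereAvg n 1 (fun x => f x - cE h v f x) x * g x| ≤ 2 * b := by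
  obtain ⟨C, hC, H⟩ := smoothing hn
  refine ⟨2 * n * C + 2 * C + 1, by have : 0 ≤ 2 * n * C := by positivity
                                    linarith, ?_⟩
  intro f g hf hg hf1 hg1 a b ha hb hfa hgb h v hh δ hδ hδ1
  obtain ⟨w, hw, hw1, hw2, hw3⟩ := H δ hδ hδ1 g hg
  have hE := hf.cE hh v
  have hF := hf.sub hE
  have hEb := cE_bound hh v hf1
  have hF2 : ∀ x, |f x - cE h v f x| ≤ 2 := fun x => by
    have := abs_sub (f x) (cE h v f x); linarith [hf1 x, hEb x]
  have hFa : ∫ x, |f x - cE h v f x| ≤ 2 * a := by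
    calc _ ≤ ∫ x, (|f x| + |cE h v f x|) := integral_mono hF.int.abs (hf.int.abs.add hE.int.abs) fun x => abs_sub _ _
      _ = (∫ x, |f x|) + ∫ x, |cE h v f x| := integral_add hf.int.abs hE.int.abs
      _ ≤ _ := by linarith [cE_L1 hh v hf]
  have hs : √(2 * (2 * a)) * √(1 * b) = 2 * √(a * b) := by
    rw [← Real.sqrt_mul (by positivity), show 2 * (2 * a) * (1 * b) = 2 ^ 2 * (a * b) by ring,
      Real.sqrt_mul (by positivity), Real.sqrt_sq (by positivity)]
  refine ⟨?_, ?_, ?_⟩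
  · rw [sphereAvg_adj hF hg]
    have hv := hg.sphereAvg 1
    have hvw := hv.sub hw
    have e : ∫ x, (f x - cE h v f x) * sphereAvg n 1 g x = (∫ x, (f x - cE h v f x) * (sphereAvg n 1 g x - w x)) +
        ∫ x, (f x - cE h v f x) * w x := by
      rw [← integral_add (hF.mul hvw) (hF.mul hw)]
      congr 1; ext x; ring
    have e1 : |∫ x, (f x - cE h v f x) * (sphereAvg n 1 g x - w x)| ≤ 2 * C * δ ^ (((n:ℝ)-1)/2) * √(a * b) := by
      have := cs_bound hF hvw (P := √(2 * (2 * a))) (Q := C * δ ^ (((n:ℝ)-1)/2) * √(1 * b)) (by positivity) (by positivity)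
        (hF.l2 hF2 hFa) (hw3.trans (by
          rw [ENNReal.ofReal_mul (p := C * δ ^ (((n:ℝ)-1)/2)) (by positivity)]
          exact mul_le_mul' le_rfl (hg.l2 hg1 hgb)))
      calc _ ≤ _ := this
        _ = C * δ ^ (((n:ℝ)-1)/2) * (√(2 * (2 * a)) * √(1 * b)) := by ring
        _ = _ := by rw [hs]; ring
    have e2 : |∫ x, (f x - cE h v f x) * w x| ≤ 2 * C * δ⁻¹ * a * b := by
      have hb' : ∀ x, |w x| ≤ C * δ⁻¹ * b := fun x => (hw1 x).trans (by gcongr)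
      calc _ ≤ ∫ x, |f x - cE h v f x| * (C * δ⁻¹ * b) := by
            rw [← Real.norm_eq_abs]
            refine norm_integral_le_of_norm_le (hF.int.abs.mul_const _) (Filter.Eventually.of_forall fun x => ?_)
            rw [Real.norm_eq_abs, abs_mul]
            exact mul_le_mul_of_nonneg_left (hb' x) (abs_nonneg _)
        _ = (∫ x, |f x - cE h v f x|) * (C * δ⁻¹ * b) := integral_mul_const _ _
        _ ≤ (2 * a) * (C * δ⁻¹ * b) := by gcongr
        _ = _ := by ring
    have e3 : |∫ x, (f x - cE h v f x) * w x| ≤ n * C * δ⁻¹ * a * h := by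
      have hl := cE_lip hh v hw (L := C * δ⁻¹ * 1) (by positivity) (hw2 1 hg1)
      have hEw := hw.cE hh v
      have e4 : ∫ x, (f x - cE h v f x) * w x = ∫ x, f x * (w x - cE h v w x) := by
        simp_rw [sub_mul, mul_sub]
        rw [integral_sub (hf.mul hw) (hE.mul hw), integral_sub (hf.mul hw) (hf.mul hEw), cE_adj hh v hf hw]
      rw [e4]
      calc _ ≤ ∫ x, |f x| * (C * δ⁻¹ * 1 * (n * h)) := by
            rw [← Real.norm_eq_abs]
            refine norm_integral_le_of_norm_le (hf.int.abs.mul_const _) (Filter.Eventually.of_forall fun x => ?_)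
            rw [Real.norm_eq_abs, abs_mul]
            exact mul_le_mul_of_nonneg_left (hl x) (abs_nonneg _)
        _ = (∫ x, |f x|) * (C * δ⁻¹ * 1 * (n * h)) := integral_mul_const _ _
        _ ≤ a * (C * δ⁻¹ * 1 * (n * h)) := by gcongr
        _ = _ := by ring
    have hnC : 0 ≤ n * C := by positivity
    have e5 : |∫ x, (f x - cE h v f x) * w x| ≤ (2 * n * C + 2 * C + 1) * δ⁻¹ * a * min b h := by
      have hd : 0 < δ⁻¹ * a := by positivity
      rcases min_cases b h with ⟨h1, _⟩ | ⟨h1, _⟩ <;> rw [h1]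
      · refine e2.trans ?_
        gcongr; linarith
      · refine e3.trans ?_
        gcongr; linarith
    have e6 : 2 * C * δ ^ (((n:ℝ)-1)/2) * √(a * b) ≤ (2 * n * C + 2 * C + 1) * δ ^ (((n:ℝ)-1)/2) * √(a * b) := by
      gcongr; linarith
    rw [e]
    have := abs_add_le (∫ x, (f x - cE h v f x) * (sphereAvg n 1 g x - w x)) (∫ x, (f x - cE h v f x) * w x)
    linarith
  · have := form_bound2 hF hg 1 hg1
    linarith
  · have := form_bound1 hF hg 1 hF2
    linarith

lemma phi_num3 (n : ℕ) (hn : 2 ≤ n) {K X a b h : ℝ} (hK : 1 ≤ K) (ha : 0 < a) (hb : 0 < b)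
    (H : ∀ δ : ℝ, 0 < δ → δ ≤ 1 → X ≤ K * δ⁻¹ * a * min b h + K * δ ^ (((n:ℝ)-1)/2) * √(a * b))
    (Ha : X ≤ 2 * a) (Hb : X ≤ 2 * b) : X ≤ 2 * K * (a * b) ^ ((n:ℝ)/(n+1)) := by
  have hab : 0 < a * b := mul_pos ha hb
  have hn1 : (0:ℝ) < n + 1 := by positivity
  have hn2 : D2 ≤ n := by exact_mod_cast hn
  rcases le_total (a * b) 1 with h1 | h1
  · have hδ : 0 < (a*b) ^ (1/((n:ℝ)+1)) := Real.rpow_pos_of_pos hab _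
    have h2 := H _ hδ (Real.rpow_le_one hab.le h1 (by positivity))
    have e1 : ((a*b) ^ (1/((n:ℝ)+1)))⁻¹ * (a * b) = (a*b)^((n:ℝ)/(n+1)) := by
      rw [← Real.rpow_neg hab.le]
      nth_rw 2 [← Real.rpow_one (a*b)]
      rw [← Real.rpow_add hab]
      congr 1; field_simp; ring
    have e2 : ((a*b) ^ (1/((n:ℝ)+1))) ^ (((n:ℝ)-1)/2) * √(a * b) = (a*b)^((n:ℝ)/(n+1)) := by
      rw [← Real.rpow_mul hab.le, Real.sqrt_eq_rpow, ← Real.rpow_add hab]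
      congr 1; field_simp; ring
    calc X ≤ _ := h2
      _ ≤ K * ((a*b) ^ (1/((n:ℝ)+1)))⁻¹ * a * b + K * ((a*b) ^ (1/((n:ℝ)+1))) ^ (((n:ℝ)-1)/2) * √(a * b) := by
        gcongr; exact min_le_left _ _
      _ = K * (((a*b) ^ (1/((n:ℝ)+1)))⁻¹ * (a * b)) + K * (((a*b) ^ (1/((n:ℝ)+1))) ^ (((n:ℝ)-1)/2) * √(a * b)) := by ring
      _ = _ := by rw [e1, e2]; ring
  · have h2 : (a * b) ^ (1/2 : ℝ) ≤ (a*b)^((n:ℝ)/(n+1)) := by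
      apply Real.rpow_le_rpow_of_exponent_le h1
      rw [div_le_div_iff₀ (by norm_num) hn1]; linarith
    rw [← Real.sqrt_eq_rpow] at h2
    have h3 : X ≤ 2 * √(a * b) := by
      rcases le_total a b with h | h
      · have : a ≤ √(a*b) := Real.le_sqrt_of_sq_le (by nlinarith)
        linarith
      · have : b ≤ √(a*b) := Real.le_sqrt_of_sq_le (by nlinarith)
        linarith
    have h4 : 0 ≤ (a*b)^((n:ℝ)/(n+1)) := by positivity
    nlinarith

lemma phi_num4 (n : ℕ) (hn : 2 ≤ n) {K X a b h : ℝ} (hK : 1 ≤ K) (ha : 0 < a) (hb : 0 < b)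
    (hh : 0 < h) (hh4 : h ≤ 4)
    (H : ∀ δ : ℝ, 0 < δ → δ ≤ 1 → X ≤ K * δ⁻¹ * a * min b h + K * δ ^ (((n:ℝ)-1)/2) * √(a * b))
    (Hb : X ≤ 2 * b) : X ≤ 18 * K * h ^ (1/8 : ℝ) * (a * b) ^ (1/2 : ℝ) := by
  have hab : 0 < a * b := mul_pos ha hb
  have hn2 : D2 ≤ n := by exact_mod_cast hn
  obtain ⟨t, ht⟩ : ∃ t, t = h ^ (1/8 : ℝ) := ⟨_, rfl⟩
  have ht0 : 0 < t := ht ▸ Real.rpow_pos_of_pos hh _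
  have ht8 : t ^ 8 = h := by
    rw [ht, ← Real.rpow_natCast, ← Real.rpow_mul hh.le]; norm_num
  have ht2 : t ^ 4 ≤ 2 := by
    by_contra hc
    push Not at hc
    nlinarith [show t ^ 8 = t ^ 4 * t ^ 4 by ring]
  have ht1 : t ≤ 3/2 := by
    by_contra hc
    push Not at hc
    have : (3/2 : ℝ) ^ 4 < t ^ 4 := by gcongr
    norm_num at this; linarith
  have h2 := H (t^4/2) (by positivity) (by linarith)
  obtain ⟨c, hc⟩ : ∃ c, c = √(a * b) := ⟨_, rfl⟩
  have hc0 : 0 < c := hc ▸ Real.sqrt_pos.2 hab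
  have hc2 : c ^ 2 = a * b := by rw [hc, Real.sq_sqrt hab.le]
  rw [← Real.sqrt_eq_rpow, ← ht, ← hc]
  rw [← hc] at h2
  have h3 : (t^4/2) ^ (((n:ℝ)-1)/2) ≤ t ^ 2 := by
    calc (t^4/2) ^ (((n:ℝ)-1)/2) ≤ (t^4/2) ^ (1/2 : ℝ) := by
          apply Real.rpow_le_rpow_of_exponent_ge (by positivity) (by linarith); linarith
      _ ≤ (t^4) ^ (1/2 : ℝ) := by gcongr; linarith [pow_pos ht0 4]
      _ = t ^ 2 := by rw [← Real.sqrt_eq_rpow, show t ^ 4 = (t^2)^2 by ring, Real.sqrt_sq (by positivity)]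
  have h4 : X ≤ 2 * K * t ^ 4 * a + K * t ^ 2 * c := by
    calc X ≤ _ := h2
      _ ≤ K * (t^4/2)⁻¹ * a * h + K * t ^ 2 * c := by
        gcongr; exact min_le_right _ _
      _ = _ := by rw [← ht8]; field_simp
  have h5 : t ^ 2 ≤ 3/2 * t := by nlinarith
  have h6 : t ^ 4 ≤ 9/4 * t ^ 2 := by nlinarith [sq_nonneg t]
  have hK0 : 0 < K := by linarith
  rcases le_total a b with h | h
  · have : a ≤ c := by rw [hc]; exact Real.le_sqrt_of_sq_le (by nlinarith)
    have h7 : t ^ 4 ≤ 4 * t := by linarith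
    calc X ≤ _ := h4
      _ ≤ 2 * K * (4 * t) * c + K * (3/2 * t) * c := by gcongr
      _ ≤ _ := by nlinarith [mul_pos (mul_pos hK0 ht0) hc0]
  · have hca : c ≤ a := by rw [hc]; exact Real.sqrt_le_iff.2 ⟨ha.le, by nlinarith⟩
    have h8 : X ≤ 9 * K * t ^ 2 * a := by
      calc X ≤ _ := h4
        _ ≤ 2 * K * (9/4 * t ^ 2) * a + K * t ^ 2 * a := by gcongr
        _ ≤ _ := by nlinarith [mul_pos (mul_pos hK0 (pow_pos ht0 2)) ha]
    rcases le_total X 0 with hX | hX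
    · exact hX.trans (by positivity)
    refine abs_le_of_sq_le_sq' ?_ (by positivity) |>.2
    calc X ^ 2 = X * X := sq X
      _ ≤ (9 * K * t ^ 2 * a) * (2 * b) := mul_le_mul h8 Hb hX (by positivity)
      _ = 18 * K * t ^ 2 * c ^ 2 := by rw [hc2]; ring
      _ ≤ 18 * K * t ^ 2 * c ^ 2 * (18 * K) := le_mul_of_one_le_right (by positivity) (by linarith)
      _ = _ := by ring

lemma phi_bound (hn : 2 ≤ n) : ∃ C : ℝ, 1 ≤ C ∧ ∀ f g : Rn n → ℝ, Nice f → Nice g →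
    (∀ x, |f x| ≤ 1) → (∀ x, |g x| ≤ 1) → ∀ a b : ℝ, 0 < a → 0 < b → ∫ x, |f x| ≤ a → ∫ x, |g x| ≤ b →
    ∀ (h : ℝ) (v : Fin n → ℝ), 0 < h → h ≤ 4 →
    ∃ X, X = |∫ x, sphereAvg n 1 (fun x => f x - cE h v f x) x * g x| ∧
    X ≤ C * a ∧ X ≤ C * b ∧ X ≤ C * (a * b) ^ ((n:ℝ)/(n+1)) ∧
    X ≤ C * h ^ (1/8 : ℝ) * (a * b) ^ (1/2 : ℝ) := by
  obtain ⟨K, hK, H⟩ := phi_core hn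
  refine ⟨18 * K, by linarith, ?_⟩
  intro f g hf hg hf1 hg1 a b ha hb hfa hgb h v hh hh4
  refine ⟨_, rfl, ?_⟩
  have H1 := H f g hf hg hf1 hg1 a b ha hb hfa hgb h v hh
  have hA := (H1 1 one_pos le_rfl).2.1
  have hB := (H1 1 one_pos le_rfl).2.2
  refine ⟨by nlinarith, by nlinarith, ?_, ?_⟩
  · refine (phi_num3 n hn hK ha hb (fun δ h1 h2 => (H1 δ h1 h2).1) hA hB).trans ?_
    gcongr; linarith
  · exact phi_num4 n hn hK ha hb hh hh4 (fun δ h1 h2 => (H1 δ h1 h2).1) hB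

end Phi

section Interp

lemma reg_min {a b : ℝ} (ha : 0 < a) (hb : 0 < b) {X C : ℝ} (hC : 0 < C) (h1 : X ≤ C * a)
    (h2 : X ≤ C * b) (h3 : X ≤ C * (a * b) ^ ((n:ℝ)/(n+1))) {p : ℝ × ℝ} (hp : p ∈ Lregion n) :
    X ≤ C * (a ^ p.1 * b ^ p.2) := by
  rcases le_or_gt X 0 with hX | hX
  · exact hX.trans (by positivity)
  have hY : 0 < X / C := by positivity
  have hconv : Convex ℝ {p : ℝ × ℝ | Real.log (X / C) ≤ p.1 * Real.log a + p.2 * Real.log b} := by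
    apply convex_halfSpace_ge
    constructor
    · intro x y; simp; ring
    · intro c x; simp; ring
  have hsub : Lregion n ⊆ {p : ℝ × ℝ | Real.log (X / C) ≤ p.1 * Real.log a + p.2 * Real.log b} := by
    apply convexHull_min _ hconv
    rintro q (rfl | rfl | rfl)
    · simp only [mem_ofPred_eq, zero_mul, one_mul, zero_add]
      exact Real.log_le_log hY (by rw [div_le_iff₀ hC]; linarith)
    · simp only [mem_ofPred_eq, zero_mul, one_mul, add_zero]
      exact Real.log_le_log hY (by rw [div_le_iff₀ hC]; linarith)
    · simp only [mem_ofPred_eq]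
      rw [← mul_add, ← Real.log_mul ha.ne' hb.ne', ← Real.log_rpow (mul_pos ha hb)]
      exact Real.log_le_log hY (by rw [div_le_iff₀ hC]; linarith)
  have h4 := hsub hp
  simp only [mem_ofPred_eq] at h4
  rw [← Real.log_rpow ha, ← Real.log_rpow hb, ← Real.log_mul (by positivity) (by positivity)] at h4
  have h5 := (Real.log_le_log_iff hY (by positivity)).1 h4
  rw [div_le_iff₀ hC] at h5
  linarith

lemma reg_theta {p : ℝ × ℝ} (hp : p ∈ interior (Lregion n)) : ∃ θ : ℝ, 0 < θ ∧ θ < 1 ∧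
    ∀ σ τ : ℝ, (σ = 1 ∨ σ = -1) → (τ = 1 ∨ τ = -1) →
    ((p.1 + σ * θ - θ / 2) / (1 - θ), (p.2 + τ * θ - θ / 2) / (1 - θ)) ∈ Lregion n := by
  have key : ∀ σ τ : ℝ, ∀ᶠ θ in nhdsWithin (0:ℝ) (Ioi 0),
      ((p.1 + σ * θ - θ / 2) / (1 - θ), (p.2 + τ * θ - θ / 2) / (1 - θ)) ∈ Lregion n := by
    intro σ τ
    have hc : ContinuousAt (fun θ : ℝ => ((p.1 + σ * θ - θ / 2) / (1 - θ), (p.2 + τ * θ - θ / 2) / (1 - θ))) 0 := by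
      apply ContinuousAt.prodMk
      · exact ContinuousAt.div (by fun_prop) (by fun_prop) (by norm_num)
      · exact ContinuousAt.div (by fun_prop) (by fun_prop) (by norm_num)
    have := hc.eventually_mem (s := Lregion n) (by simpa using mem_interior_iff_mem_nhds.1 hp)
    exact this.filter_mono nhdsWithin_le_nhds
  have h1 : ∀ᶠ θ in nhdsWithin (0:ℝ) (Ioi 0), θ < 1 ∧ 0 < θ :=
    (((eventually_lt_nhds (by norm_num : (0:ℝ) < 1)).filter_mono nhdsWithin_le_nhds)).and (eventually_mem_nhdsWithin)
  obtain ⟨θ, ⟨h2, h3⟩, a1, a2, a3, a4⟩ := (h1.and ((key 1 1).and ((key 1 (-1)).and ((key (-1) 1).and (key (-1) (-1)))))).exists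
  refine ⟨θ, h3, h2, ?_⟩
  rintro σ τ (rfl | rfl) (rfl | rfl) <;> assumption

lemma reg_sum (hn : 2 ≤ n) {p : ℝ × ℝ} (hp : p ∈ Lregion n) : 1 ≤ p.1 + p.2 := by
  have hconv : Convex ℝ {p : ℝ × ℝ | 1 ≤ p.1 + p.2} := by
    apply convex_halfSpace_ge
    constructor
    · intro x y; simp; ring
    · intro c x; simp; ring
  have hn2 : D2 ≤ n := by exact_mod_cast hn
  have hsub : Lregion n ⊆ {p : ℝ × ℝ | 1 ≤ p.1 + p.2} := by
    apply convexHull_min _ hconv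
    rintro q (rfl | rfl | rfl)
    · simp
    · simp
    · simp only [mem_ofPred_eq]
      rw [← add_div, le_div_iff₀ (by positivity)]; linarith
  exact hsub hp

lemma reg_interp {r s : ℝ} {θ : ℝ} (h0 : 0 < θ) (h1 : θ < 1)
    {a b : ℝ} (ha : 0 < a) (hb : 0 < b) {X C D : ℝ} (hC : 0 < C) (hD : 0 < D)
    (hX : 0 ≤ X) (e1 : X ≤ C * a)
    (e2 : X ≤ C * b) (e3 : X ≤ C * (a * b) ^ ((n:ℝ)/(n+1))) (e4 : X ≤ C * D * (a * b) ^ (1/2 : ℝ)) {σ τ : ℝ}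
    (hp : ((1/r + σ * θ - θ / 2) / (1 - θ), (1/s + τ * θ - θ / 2) / (1 - θ)) ∈ Lregion n) :
    X ≤ C * D ^ θ * (a ^ (1/r + σ * θ) * b ^ (1/s + τ * θ)) := by
  have h5 := reg_min ha hb hC e1 e2 e3 hp
  simp only at h5
  have h1' : 0 < 1 - θ := by linarith
  calc X = X ^ (1 - θ) * X ^ θ := by
        rw [← Real.rpow_add_of_nonneg hX h1'.le h0.le]; simp
    _ ≤ (C * (a ^ ((1/r + σ * θ - θ / 2) / (1 - θ)) * b ^ ((1/s + τ * θ - θ / 2) / (1 - θ)))) ^ (1 - θ) *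
        (C * D * (a * b) ^ (1/2 : ℝ)) ^ θ := by
        apply mul_le_mul (Real.rpow_le_rpow hX h5 h1'.le) (Real.rpow_le_rpow hX e4 h0.le) (by positivity) (by positivity)
    _ = (C ^ (1-θ) * C ^ θ) * D ^ θ * ((a ^ (((1/r + σ * θ - θ / 2) / (1 - θ)) * (1-θ)) * a ^ (1/2 * θ)) *
          (b ^ (((1/s + τ * θ - θ / 2) / (1 - θ)) * (1-θ)) * b ^ (1/2 * θ))) := by
        rw [Real.mul_rpow hC.le (by positivity), Real.mul_rpow (by positivity) (by positivity),
          Real.mul_rpow (by positivity) (by positivity), Real.mul_rpow hC.le hD.le,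
          Real.mul_rpow ha.le hb.le, Real.mul_rpow (by positivity) (by positivity)]
        simp only [← Real.rpow_mul ha.le, ← Real.rpow_mul hb.le]
        ring
    _ = _ := by
        rw [← Real.rpow_add hC, ← Real.rpow_add ha, ← Real.rpow_add hb, div_mul_cancel₀ _ h1'.ne', div_mul_cancel₀ _ h1'.ne']
        rw [show 1 - θ + θ = 1 by ring, Real.rpow_one, show 1/r + σ * θ - θ / 2 + 1/2 * θ = 1/r + σ * θ by ring,
          show 1/s + τ * θ - θ / 2 + 1/2 * θ = 1/s + τ * θ by ring]

noncomputable def Bf (R h : ℝ) (v : Fin n → ℝ) (f g : Rn n → ℝ) : ℝ :=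
  ∫ x, sphereAvg n R (fun x => f x - cE h v f x) x * g x

lemma cE_add (h : ℝ) (v : Fin n → ℝ) {f g : Rn n → ℝ} (hf : Nice f) (hg : Nice g) (x : Rn n) :
    cE h v (fun x => f x + g x) x = cE h v f x + cE h v g x := by
  unfold cE
  rw [integral_add hf.int.integrableOn hg.int.integrableOn]; ring

lemma cE_const_mul (h : ℝ) (v : Fin n → ℝ) (c : ℝ) (f : Rn n → ℝ) (x : Rn n) :
    cE h v (fun x => c * f x) x = c * cE h v f x := by
  unfold cE
  rw [integral_const_mul]; ring

lemma Bf_add_left (R : ℝ) {h : ℝ} (hh : 0 < h) (v : Fin n → ℝ) {f f' g : Rn n → ℝ} (hf : Nice f) (hf' : Nice f') (hg : Nice g) :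
    Bf R h v (fun x => f x + f' x) g = Bf R h v f g + Bf R h v f' g := by
  unfold Bf
  have h1 := hf.sub (hf.cE hh v)
  have h2 := hf'.sub (hf'.cE hh v)
  rw [← integral_add ((h1.sphereAvg R).mul hg) ((h2.sphereAvg R).mul hg)]
  congr 1; ext x
  rw [← add_mul, ← sphereAvg_add h1 h2]
  congr 2; ext y
  rw [cE_add h v hf hf']; ring

lemma Bf_add_right (R : ℝ) {h : ℝ} (hh : 0 < h) (v : Fin n → ℝ) {f g g' : Rn n → ℝ} (hf : Nice f) (hg : Nice g) (hg' : Nice g') :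
    Bf R h v f (fun x => g x + g' x) = Bf R h v f g + Bf R h v f g' := by
  unfold Bf
  have h1 := (hf.sub (hf.cE hh v)).sphereAvg R
  rw [← integral_add (h1.mul hg) (h1.mul hg')]
  congr 1; ext x; ring

lemma Bf_smul_left (R h : ℝ) (v : Fin n → ℝ) (c : ℝ) (f g : Rn n → ℝ) :
    Bf R h v (fun x => c * f x) g = c * Bf R h v f g := by
  unfold Bf
  rw [← integral_const_mul]
  congr 1; ext x
  rw [← mul_assoc, ← sphereAvg_const_mul]
  congr 2; ext y
  rw [cE_const_mul]; ring

lemma Bf_smul_right (R h : ℝ) (v : Fin n → ℝ) (c : ℝ) (f g : Rn n → ℝ) :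
    Bf R h v f (fun x => c * g x) = c * Bf R h v f g := by
  unfold Bf
  rw [← integral_const_mul]
  congr 1; ext x; ring

lemma Bf_sum_left {ι : Type*} (t : Finset ι) (R : ℝ) {h : ℝ} (hh : 0 < h) (v : Fin n → ℝ) {f : ι → Rn n → ℝ} {g : Rn n → ℝ}
    (hf : ∀ i, Nice (f i)) (hg : Nice g) :
    Bf R h v (fun x => ∑ i ∈ t, f i x) g = ∑ i ∈ t, Bf R h v (f i) g := by
  classical
  induction t using Finset.induction_on with
  | empty => simpa using Bf_smul_left R h v 0 (fun _ => 0) g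
  | insert i t hi ih =>
    simp only [Finset.sum_insert hi]
    rw [Bf_add_left R hh v (hf i) (Nice.sum t fun i _ => hf i) hg, ih]

lemma Bf_sum_right {ι : Type*} (t : Finset ι) (R : ℝ) {h : ℝ} (hh : 0 < h) (v : Fin n → ℝ) {f : Rn n → ℝ} {g : ι → Rn n → ℝ}
    (hf : Nice f) (hg : ∀ i, Nice (g i)) :
    Bf R h v f (fun x => ∑ i ∈ t, g i x) = ∑ i ∈ t, Bf R h v f (g i) := by
  classical
  induction t using Finset.induction_on with
  | empty => simpa using Bf_smul_right R h v 0 f (fun _ => 0)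
  | insert i t hi ih =>
    simp only [Finset.sum_insert hi]
    rw [Bf_add_right R hh v hf (hg i) (Nice.sum t fun i _ => hg i), ih]

lemma Bf_triv (R : ℝ) {h : ℝ} (hh : 0 < h) (v : Fin n → ℝ) {f g : Rn n → ℝ} (hf : Nice f) (hg : Nice g) :
    (∀ M, (∀ x, |f x| ≤ M) → |Bf R h v f g| ≤ 2 * M * ∫ x, |g x|) ∧
    (∀ M, (∀ x, |g x| ≤ M) → |Bf R h v f g| ≤ 2 * M * ∫ x, |f x|) := by
  have hE := hf.cE hh v
  have hF := hf.sub hE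
  constructor
  · intro M hM
    apply form_bound1 hF hg R
    intro x
    have := abs_sub (f x) (cE h v f x); linarith [hM x, cE_bound hh v hM x]
  · intro M hM
    have hM0 : 0 ≤ M := (abs_nonneg _).trans (hM 0)
    have hFa : ∫ x, |f x - cE h v f x| ≤ 2 * ∫ x, |f x| := by
      calc _ ≤ ∫ x, (|f x| + |cE h v f x|) := integral_mono hF.int.abs (hf.int.abs.add hE.int.abs) fun x => abs_sub _ _
        _ = (∫ x, |f x|) + ∫ x, |cE h v f x| := integral_add hf.int.abs hE.int.abs
        _ ≤ _ := by linarith [cE_L1 hh v hf]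
    calc _ ≤ _ := form_bound2 hF hg R hM
      _ ≤ M * (2 * ∫ x, |f x|) := by gcongr
      _ = _ := by ring

end Interp

section Lev

noncomputable def lev (f : Rn n → ℝ) (i : ℤ) : Rn n → ℝ :=
  {x | D2 ^ i ≤ f x ∧ f x < D2 ^ (i + 1)}.indicator f

lemma Nice.lev {f : Rn n → ℝ} (hf : Nice f) (i : ℤ) : Nice (lev f i) := by
  apply hf.indicator
  exact (measurableSet_le measurable_const hf.meas).inter (measurableSet_lt hf.meas measurable_const)

lemma Nice.rpow {f : Rn n → ℝ} (hf : Nice f) (h0 : ∀ x, 0 ≤ f x) {r : ℝ} (hr : 1 ≤ r) :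
    Nice (fun x => f x ^ r) := by
  obtain ⟨M, hM⟩ := hf.bdd
  have hb : ∀ x, ‖f x ^ (r - 1)‖ ≤ M ^ (r-1) := fun x => by
    rw [Real.norm_eq_abs, abs_of_nonneg (Real.rpow_nonneg (h0 x) _)]
    exact Real.rpow_le_rpow (h0 x) ((le_abs_self _).trans (hM x)) (by linarith)
  refine ⟨hf.meas.pow_const r, ⟨M ^ r, fun x => ?_⟩, ?_⟩
  · rw [abs_of_nonneg (Real.rpow_nonneg (h0 x) _)]
    exact Real.rpow_le_rpow (h0 x) ((le_abs_self _).trans (hM x)) (by linarith)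
  · have := hf.int.bdd_mul (hf.meas.pow_const (r-1)).aestronglyMeasurable (Filter.Eventually.of_forall hb)
    refine this.congr (Filter.Eventually.of_forall fun x => ?_)
    simp only
    rcases (h0 x).eq_or_lt with h | h
    · rw [← h, mul_zero, Real.zero_rpow (by linarith)]
    · nth_rw 2 [← Real.rpow_one (f x)]
      rw [← Real.rpow_add h]; simp

lemma lev_nonneg {f : Rn n → ℝ} (h0 : ∀ x, 0 ≤ f x) (i : ℤ) (x : Rn n) : 0 ≤ lev f i x :=
  indicator_nonneg (fun x _ => h0 x) x

lemma lev_sum {f : Rn n → ℝ} (h0 : ∀ x, 0 ≤ f x) (N : ℕ) (hN : ∀ x, f x < D2 ^ ((N:ℤ) + 1)) (x : Rn n) :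
    0 ≤ f x - ∑ i ∈ Finset.Icc (-(N:ℤ)) N, lev f i x ∧
    f x - ∑ i ∈ Finset.Icc (-(N:ℤ)) N, lev f i x ≤ D2 ^ (-(N:ℤ)) := by
  rcases (h0 x).eq_or_lt with h | h
  · have : ∀ i, lev f i x = 0 := fun i => by
      unfold lev
      by_cases hx : x ∈ {x | D2 ^ i ≤ f x ∧ f x < D2 ^ (i + 1)}
      · rw [indicator_of_mem hx, ← h]
      · rw [indicator_of_notMem hx]
    simp only [this, Finset.sum_const_zero, ← h]
    refine ⟨by simp, ?_⟩
    simp only [sub_zero]; positivity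
  · obtain ⟨k, hk1, hk2⟩ := exists_mem_Ico_zpow h (by norm_num : (1:ℝ) < 2)
    have hne : ∀ j, j ≠ k → lev f j x = 0 := fun j hj => by
      apply indicator_of_notMem
      rintro ⟨a, b⟩
      have h1 := (zpow_lt_zpow_iff_right₀ (by norm_num : (1:ℝ) < 2)).1 (a.trans_lt hk2)
      have h2 := (zpow_lt_zpow_iff_right₀ (by norm_num : (1:ℝ) < 2)).1 (hk1.trans_lt b)
      omega
    have hk : lev f k x = f x := indicator_of_mem (show x ∈ {x | D2 ^ k ≤ f x ∧ f x < D2 ^ (k + 1)} from ⟨hk1, hk2⟩) f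
    by_cases hm : k ∈ Finset.Icc (-(N:ℤ)) N
    · rw [Finset.sum_eq_single_of_mem k hm fun j _ hj => hne j hj, hk]
      simp
    · rw [Finset.sum_eq_zero fun j hj => hne j (fun e => hm (e ▸ hj))]
      have h2 := (zpow_lt_zpow_iff_right₀ (by norm_num : (1:ℝ) < 2)).1 (hk1.trans_lt (hN x))
      rw [Finset.mem_Icc, not_and_or] at hm
      refine ⟨by simpa using h.le, ?_⟩
      rw [sub_zero]
      exact hk2.le.trans ((zpow_le_zpow_iff_right₀ (by norm_num : (1:ℝ) < 2)).2 (by omega))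

lemma lev_norm {f : Rn n → ℝ} (hf : Nice f) (h0 : ∀ x, 0 ≤ f x) {r : ℝ} (hr : 1 ≤ r)
    (hfr : ∫ x, f x ^ r ≤ 1) (i : ℤ) :
    (∀ x, |(D2 ^ (i+1))⁻¹ * lev f i x| ≤ 1) ∧ ∫ x, |(D2 ^ (i+1))⁻¹ * lev f i x| ≤ D2 ^ (-(i:ℝ) * r) := by
  have hp : (0:ℝ) < 2 ^ (i+1) := by positivity
  have h1 : ∀ x, |(D2 ^ (i+1))⁻¹ * lev f i x| ≤ 1 := fun x => by
    rw [abs_of_nonneg (mul_nonneg (by positivity) (lev_nonneg h0 i x)), inv_mul_le_iff₀ hp, mul_one]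
    unfold lev
    apply indicator_le' (g := fun _ => D2^(i+1))
    · intro y hy; exact hy.2.le
    · intro y _; positivity
  refine ⟨h1, ?_⟩
  have h2 : ∀ x, |(D2 ^ (i+1))⁻¹ * lev f i x| ≤ D2 ^ (-(i:ℝ) * r) * f x ^ r := fun x => by
    by_cases hx : x ∈ {x | D2 ^ i ≤ f x ∧ f x < D2 ^ (i + 1)}
    · refine (h1 x).trans ?_
      rw [neg_mul, Real.rpow_neg (by norm_num), le_inv_mul_iff₀ (by positivity), mul_one, Real.rpow_mul (by norm_num), Real.rpow_intCast]
      exact Real.rpow_le_rpow (by positivity) hx.1 (by linarith)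
    · unfold lev
      rw [indicator_of_notMem hx, mul_zero, abs_zero]
      have := Real.rpow_nonneg (h0 x) r
      positivity
  calc _ ≤ ∫ x, D2 ^ (-(i:ℝ) * r) * f x ^ r :=
        integral_mono ((hf.lev i).const_mul _).int.abs ((hf.rpow h0 hr).int.const_mul _) h2
    _ = D2 ^ (-(i:ℝ) * r) * ∫ x, f x ^ r := integral_const_mul _ _
    _ ≤ D2 ^ (-(i:ℝ) * r) * 1 := by gcongr
    _ = _ := mul_one _

lemma lev_exp (i : ℤ) {r θ : ℝ} (hr : 0 < r) : ∃ σ : ℝ, (σ = 1 ∨ σ = -1) ∧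
    D2 ^ (i + 1) * (D2 ^ (-(i:ℝ) * r)) ^ (1/r + σ * θ) = 2 * (D2 ^ (-(r * θ))) ^ i.natAbs := by
  have key : ∀ σ : ℝ, (i:ℝ) * σ = i.natAbs →
      D2 ^ (i + 1) * (D2 ^ (-(i:ℝ) * r)) ^ (1/r + σ * θ) = 2 * (D2 ^ (-(r * θ))) ^ i.natAbs := by
    intro σ h
    rw [← Real.rpow_intCast, ← Real.rpow_natCast, ← Real.rpow_mul (by norm_num), ← Real.rpow_mul (by norm_num), ← Real.rpow_add (by norm_num),
      ← h]
    nth_rw 2 [← Real.rpow_one 2]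
    rw [← Real.rpow_add (by norm_num)]
    congr 1; push_cast; field_simp; ring
  rcases le_total 0 i with h | h
  · refine ⟨1, Or.inl rfl, key 1 ?_⟩
    rw [mul_one, ← Int.cast_natCast, Int.natAbs_of_nonneg h]
  · refine ⟨-1, Or.inr rfl, key (-1) ?_⟩
    rw [← Int.cast_natCast, Int.ofNat_natAbs_of_nonpos h]; push_cast; ring

lemma lev_summable {ρ : ℝ} (h0 : 0 ≤ ρ) (h1 : ρ < 1) : Summable (fun i : ℤ => ρ ^ i.natAbs) := by
  apply Summable.of_nat_of_neg
  · simpa using summable_geometric_of_lt_one h0 h1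
  · simpa using summable_geometric_of_lt_one h0 h1

lemma lev_term (hn : 2 ≤ n) {r s : ℝ} (hr : 1 < r) (hs : 1 < s) {θ : ℝ} (hθ : 0 < θ) (hθ1 : θ < 1)
    (hL : ∀ σ τ : ℝ, (σ = 1 ∨ σ = -1) → (τ = 1 ∨ τ = -1) →
    ((1/r + σ * θ - θ / 2) / (1 - θ), (1/s + τ * θ - θ / 2) / (1 - θ)) ∈ Lregion n) :
    ∃ C : ℝ, 0 ≤ C ∧ ∀ f g : Rn n → ℝ, Nice f → Nice g → (∀ x, 0 ≤ f x) → (∀ x, 0 ≤ g x) →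
    ∫ x, f x ^ r ≤ 1 → ∫ x, g x ^ s ≤ 1 → ∀ (h : ℝ) (v : Fin n → ℝ), 0 < h → h ≤ 4 → ∀ i j : ℤ,
    |Bf 1 h v (lev f i) (lev g j)| ≤ C * h ^ (1/8 * θ) * ((D2 ^ (-(r * θ))) ^ i.natAbs * (D2 ^ (-(s * θ))) ^ j.natAbs) := by
  obtain ⟨C, hC, H⟩ := phi_bound hn
  refine ⟨4 * C, by linarith, ?_⟩
  intro f g hf hg hf0 hg0 hfr hgs h v hh hh4 i j
  obtain ⟨σ, hσ, eσ⟩ := lev_exp i (r := r) (θ := θ) (by linarith)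
  obtain ⟨τ, hτ, eτ⟩ := lev_exp j (r := s) (θ := θ) (by linarith)
  have hF := lev_norm hf hf0 hr.le hfr i
  have hG := lev_norm hg hg0 hs.le hgs j
  obtain ⟨X, hX, x1, x2, x3, x4⟩ := H _ _ ((hf.lev i).const_mul (D2 ^ (i+1))⁻¹) ((hg.lev j).const_mul (D2 ^ (j+1))⁻¹) hF.1 hG.1
    (D2 ^ (-(i:ℝ) * r)) (D2 ^ (-(j:ℝ) * s)) (by positivity) (by positivity) hF.2 hG.2 h v hh hh4
  have h5 := reg_interp (r := r) (s := s) hθ hθ1 (by positivity) (by positivity) (by linarith) (by positivity) (hX ▸ abs_nonneg _) x1 x2 x3 x4 (hL σ τ hσ hτ)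
  have h6 : |Bf 1 h v (lev f i) (lev g j)| = D2 ^ (i+1) * D2 ^ (j+1) * X := by
    have e : X = |Bf 1 h v (fun x => (D2 ^ (i+1))⁻¹ * lev f i x) (fun x => (D2 ^ (j+1))⁻¹ * lev g j x)| := hX
    rw [e, Bf_smul_left, Bf_smul_right, abs_mul, abs_mul, abs_of_pos (inv_pos.2 (show (0:ℝ) < 2 ^ (i+1) by positivity)),
      abs_of_pos (inv_pos.2 (show (0:ℝ) < 2 ^ (j+1) by positivity))]
    field_simp
  rw [h6]
  calc _ ≤ D2 ^ (i+1) * D2 ^ (j+1) * _ := mul_le_mul_of_nonneg_left h5 (by positivity)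
    _ = C * (h ^ (1/8 : ℝ)) ^ θ * ((D2 ^ (i + 1) * (D2 ^ (-(i:ℝ) * r)) ^ (1/r + σ * θ)) *
        (D2 ^ (j + 1) * (D2 ^ (-(j:ℝ) * s)) ^ (1/s + τ * θ))) := by ring
    _ = _ := by rw [eσ, eτ, ← Real.rpow_mul hh.le]; ring

lemma interp_unit (hn : 2 ≤ n) {r s : ℝ} (hr : 1 < r) (hs : 1 < s)
    (hmem : ((1/r, 1/s) : ℝ × ℝ) ∈ interior (Lregion n)) :
    ∃ C η : ℝ, 0 ≤ C ∧ 0 < η ∧ ∀ f g : Rn n → ℝ, Nice f → Nice g → (∀ x, 0 ≤ f x) → (∀ x, 0 ≤ g x) →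
    ∫ x, f x ^ r ≤ 1 → ∫ x, g x ^ s ≤ 1 → ∀ (h : ℝ) (v : Fin n → ℝ), 0 < h → h ≤ 4 →
    |Bf 1 h v f g| ≤ C * h ^ η := by
  obtain ⟨θ, hθ, hθ1, hL⟩ := reg_theta hmem
  obtain ⟨C, hC, H⟩ := lev_term hn hr hs hθ hθ1 hL
  have hρ : ∀ r : ℝ, 1 < r → D2 ^ (-(r * θ)) < 1 := fun r hr => by
    apply Real.rpow_lt_one_of_one_lt_of_neg (by norm_num)
    have : 0 < r * θ := by positivity
    linarith
  have hS : ∀ r : ℝ, 1 < r → Summable (fun i : ℤ => (D2 ^ (-(r * θ))) ^ i.natAbs) := fun r hr =>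
    lev_summable (by positivity) (hρ r hr)
  obtain ⟨W, hW⟩ : ∃ W : ℝ → ℝ, W = fun r => ∑' i : ℤ, (D2 ^ (-(r * θ))) ^ i.natAbs := ⟨_, rfl⟩
  have hW0 : ∀ r, 0 ≤ W r := fun r => by rw [hW]; exact tsum_nonneg fun i => by positivity
  have hWs : ∀ (r : ℝ) (_ : 1 < r) (t : Finset ℤ), ∑ i ∈ t, (D2 ^ (-(r * θ))) ^ i.natAbs ≤ W r := fun r hr t => by
    rw [hW]; exact (hS r hr).sum_le_tsum t fun i _ => by positivity
  refine ⟨C * (W r * W s), 1/8 * θ, mul_nonneg hC (mul_nonneg (hW0 r) (hW0 s)), by positivity, ?_⟩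
  intro f g hf hg hf0 hg0 hfr hgs h v hh hh4
  obtain ⟨M, hM⟩ := hf.bdd
  obtain ⟨M', hM'⟩ := hg.bdd
  have hlim : Filter.Tendsto (fun N : ℕ => C * (W r * W s) * h ^ (1/8 * θ) +
      (2 * (1/2:ℝ)^N * (∫ x, |g x|) + 2 * (1/2:ℝ)^N * ∫ x, |f x|)) Filter.atTop
      (nhds (C * (W r * W s) * h ^ (1/8 * θ) + (2 * 0 * (∫ x, |g x|) + 2 * 0 * ∫ x, |f x|))) := by
    have h0 := tendsto_pow_atTop_nhds_zero_of_lt_one (r := (1/2:ℝ)) (by norm_num) (by norm_num)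
    exact ((((h0.const_mul 2).mul_const _).add ((h0.const_mul 2).mul_const _)).const_add _)
  have h2 : ∀ᶠ N : ℕ in Filter.atTop, M + M' < D2 ^ N :=
    (tendsto_pow_atTop_atTop_of_one_lt (by norm_num : (1:ℝ) < 2)).eventually_gt_atTop _
  have hM0 : 0 ≤ M := (abs_nonneg _).trans (hM 0)
  have hM0' : 0 ≤ M' := (abs_nonneg _).trans (hM' 0)
  rw [show C * (W r * W s) * h ^ (1/8 * θ) = C * (W r * W s) * h ^ (1/8 * θ) + (2 * 0 * (∫ x, |g x|) + 2 * 0 * ∫ x, |f x|) by ring]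
  refine ge_of_tendsto hlim ?_
  filter_upwards [h2] with N hN
  have hN2 : D2 ^ N ≤ D2 ^ ((N:ℤ) + 1) := by
    rw [← zpow_natCast]; exact zpow_le_zpow_right₀ (by norm_num) (by omega)
  have e12 : D2 ^ (-(N:ℤ)) = (1/2:ℝ)^N := by rw [zpow_neg, zpow_natCast]; simp
  have hfs := lev_sum hf0 N (fun x => by linarith [le_abs_self (f x), hM x])
  have hgs' := lev_sum hg0 N (fun x => by linarith [le_abs_self (g x), hM' x])
  rw [e12] at hfs hgs'
  have nf : Nice (fun x => ∑ i ∈ Finset.Icc (-(N:ℤ)) N, lev f i x) := Nice.sum _ fun i _ => hf.lev i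
  have ng : Nice (fun x => ∑ i ∈ Finset.Icc (-(N:ℤ)) N, lev g i x) := Nice.sum _ fun i _ => hg.lev i
  have nf' := hf.sub nf
  have ng' := hg.sub ng
  have e1 : Bf 1 h v f g = Bf 1 h v (fun x => ∑ i ∈ Finset.Icc (-(N:ℤ)) N, lev f i x) (fun x => ∑ i ∈ Finset.Icc (-(N:ℤ)) N, lev g i x)
      + Bf 1 h v (fun x => ∑ i ∈ Finset.Icc (-(N:ℤ)) N, lev f i x) (fun x => g x - ∑ i ∈ Finset.Icc (-(N:ℤ)) N, lev g i x)
      + Bf 1 h v (fun x => f x - ∑ i ∈ Finset.Icc (-(N:ℤ)) N, lev f i x) g := by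
    rw [← Bf_add_right 1 hh v nf ng ng']
    simp only [add_sub_cancel]
    rw [← Bf_add_left 1 hh v nf nf' hg]
    simp only [add_sub_cancel]
  have e2 := (Bf_triv 1 hh v nf ng').2 ((1/2:ℝ)^N) (fun x => by rw [abs_of_nonneg (hgs' x).1]; exact (hgs' x).2)
  have e3 := (Bf_triv 1 hh v nf' hg).1 ((1/2:ℝ)^N) (fun x => by rw [abs_of_nonneg (hfs x).1]; exact (hfs x).2)
  have e4 : ∫ x, |∑ i ∈ Finset.Icc (-(N:ℤ)) N, lev f i x| ≤ ∫ x, |f x| := by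
    refine integral_mono nf.int.abs hf.int.abs fun x => ?_
    simp only
    rw [abs_of_nonneg (Finset.sum_nonneg fun i _ => lev_nonneg hf0 i x), abs_of_nonneg (hf0 x)]
    linarith [(hfs x).1]
  have e5 : |Bf 1 h v (fun x => ∑ i ∈ Finset.Icc (-(N:ℤ)) N, lev f i x) (fun x => ∑ i ∈ Finset.Icc (-(N:ℤ)) N, lev g i x)| ≤
      C * (W r * W s) * h ^ (1/8 * θ) := by
    rw [Bf_sum_left _ 1 hh v (fun i => hf.lev i) ng]
    simp_rw [fun i => Bf_sum_right (Finset.Icc (-(N:ℤ)) N) 1 hh v (hf.lev i) (fun j => hg.lev j)]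
    calc _ ≤ ∑ i ∈ Finset.Icc (-(N:ℤ)) N, ∑ j ∈ Finset.Icc (-(N:ℤ)) N, |Bf 1 h v (lev f i) (lev g j)| :=
          (Finset.abs_sum_le_sum_abs _ _).trans (Finset.sum_le_sum fun i _ => Finset.abs_sum_le_sum_abs _ _)
      _ ≤ ∑ i ∈ Finset.Icc (-(N:ℤ)) N, ∑ j ∈ Finset.Icc (-(N:ℤ)) N,
          C * h ^ (1/8 * θ) * ((D2 ^ (-(r * θ))) ^ i.natAbs * (D2 ^ (-(s * θ))) ^ j.natAbs) :=
          Finset.sum_le_sum fun i _ => Finset.sum_le_sum fun j _ => H f g hf hg hf0 hg0 hfr hgs h v hh hh4 i j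
      _ = C * h ^ (1/8 * θ) * ((∑ i ∈ Finset.Icc (-(N:ℤ)) N, (D2 ^ (-(r * θ))) ^ i.natAbs) *
          ∑ j ∈ Finset.Icc (-(N:ℤ)) N, (D2 ^ (-(s * θ))) ^ j.natAbs) := by
          rw [Finset.sum_mul_sum, Finset.mul_sum]
          simp_rw [Finset.mul_sum]
      _ ≤ C * h ^ (1/8 * θ) * (W r * W s) := by
          apply mul_le_mul_of_nonneg_left _ (by positivity)
          exact mul_le_mul (hWs r hr _) (hWs s hs _) (Finset.sum_nonneg fun i _ => by positivity) (hW0 r)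
      _ = _ := by ring
  rw [e1]
  refine (abs_add_three _ _ _).trans ?_
  have e6 : 2 * (1/2:ℝ)^N * (∫ x, |∑ i ∈ Finset.Icc (-(N:ℤ)) N, lev f i x|) ≤ 2 * (1/2:ℝ)^N * ∫ x, |f x| := by gcongr
  linarith

end Lev

section Dil

lemma interp_scaled (hn : 2 ≤ n) {r s : ℝ} (hr : 1 < r) (hs : 1 < s)
    (hmem : ((1/r, 1/s) : ℝ × ℝ) ∈ interior (Lregion n)) :
    ∃ C η : ℝ, 0 ≤ C ∧ 0 < η ∧ ∀ f g : Rn n → ℝ, Nice f → Nice g → (∀ x, 0 ≤ f x) → (∀ x, 0 ≤ g x) →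
    ∀ (h : ℝ) (v : Fin n → ℝ), 0 < h → h ≤ 4 →
    |Bf 1 h v f g| ≤ C * h ^ η * ((∫ x, f x ^ r) ^ (1/r) * (∫ x, g x ^ s) ^ (1/s)) := by
  obtain ⟨C, η, hC, hη, H⟩ := interp_unit hn hr hs hmem
  refine ⟨C, η, hC, hη, ?_⟩
  intro f g hf hg hf0 hg0 h v hh hh4
  have A0 : 0 ≤ ∫ x, f x ^ r := integral_nonneg fun x => Real.rpow_nonneg (hf0 x) _
  have B0 : 0 ≤ ∫ x, g x ^ s := integral_nonneg fun x => Real.rpow_nonneg (hg0 x) _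
  obtain ⟨A, hA⟩ : ∃ A, A = ∫ x, f x ^ r := ⟨_, rfl⟩
  obtain ⟨B, hB⟩ : ∃ B, B = ∫ x, g x ^ s := ⟨_, rfl⟩
  rw [← hA, ← hB]
  rw [← hA] at A0
  rw [← hB] at B0
  have norm1 : ∀ (F : Rn n → ℝ) (t D c: ℝ), 1 < t → (∀ x, 0 ≤ F x) → D = ∫ x, F x ^ t → D ≤ c → 0 < c →
      ∫ x, ((c ^ (1/t))⁻¹ * F x) ^ t ≤ 1 := by
    intro F t D c ht hF hD hDc hc
    have e : ∀ x, ((c ^ (1/t))⁻¹ * F x) ^ t = c⁻¹ * F x ^ t := fun x => by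
      rw [Real.mul_rpow (by positivity) (hF x), Real.inv_rpow (by positivity), ← Real.rpow_mul hc.le,
        one_div_mul_cancel (by linarith), Real.rpow_one]
    simp_rw [e]
    rw [integral_const_mul, ← hD, inv_mul_le_iff₀ hc]; linarith
  have key : ∀ ε : ℝ, 0 < ε → |Bf 1 h v f g| ≤ C * h ^ η * ((A + ε) ^ (1/r) * (B + ε) ^ (1/s)) := by
    intro ε hε
    have hAε : 0 < A + ε := by linarith
    have hBε : 0 < B + ε := by linarith
    have h1 := H _ _ (hf.const_mul ((A + ε) ^ (1/r))⁻¹) (hg.const_mul ((B + ε) ^ (1/s))⁻¹)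
      (fun x => mul_nonneg (by positivity) (hf0 x)) (fun x => mul_nonneg (by positivity) (hg0 x))
      (norm1 f r A _ hr hf0 hA (by linarith) hAε) (norm1 g s B _ hs hg0 hB (by linarith) hBε) h v hh hh4
    rw [Bf_smul_left, Bf_smul_right, abs_mul, abs_mul, abs_of_pos (show 0 < ((A + ε) ^ (1/r))⁻¹ by positivity),
      abs_of_pos (show 0 < ((B + ε) ^ (1/s))⁻¹ by positivity), inv_mul_le_iff₀ (by positivity),
      inv_mul_le_iff₀ (by positivity)] at h1
    linarith
  have hlim : Filter.Tendsto (fun ε : ℝ => C * h ^ η * ((A + ε) ^ (1/r) * (B + ε) ^ (1/s))) (nhdsWithin 0 (Ioi 0))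
      (nhds (C * h ^ η * ((A + 0) ^ (1/r) * (B + 0) ^ (1/s)))) := by
    refine Filter.Tendsto.mono_left ?_ nhdsWithin_le_nhds
    have c1 := (Real.continuous_rpow_const (q := 1/r) (by positivity)).comp (continuous_const.add continuous_id : Continuous fun ε : ℝ => A + ε)
    have c2 := (Real.continuous_rpow_const (q := 1/s) (by positivity)).comp (continuous_const.add continuous_id : Continuous fun ε : ℝ => B + ε)
    exact ((c1.mul c2).const_mul (C * h ^ η)).tendsto 0
  rw [add_zero, add_zero] at hlim
  exact ge_of_tendsto hlim (eventually_mem_nhdsWithin.mono fun ε hε => key ε hε)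

lemma int_dil {R : ℝ} (hR : 0 < R) (F : Rn n → ℝ) : ∫ x, F x = R ^ n * ∫ x, F (R • x) := by
  rw [Measure.integral_comp_smul]
  simp only [finrank_euclideanSpace, Fintype.card_fin, smul_eq_mul]
  rw [abs_of_pos (by positivity)]
  field_simp

lemma cidx_dil {R h : ℝ} (hR : 0 < R) (v : Fin n → ℝ) (x : Rn n) :
    cidx h v (R • x) = cidx (h / R) (fun i => v i / R) x := by
  ext i
  simp only [cidx, PiLp.smul_apply, smul_eq_mul]
  congr 1
  rcases eq_or_ne h 0 with rfl | hh
  · simp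
  · field_simp

lemma cE_dil {R h : ℝ} (hR : 0 < R) (v : Fin n → ℝ) (f : Rn n → ℝ) (x : Rn n) :
    cE h v f (R • x) = cE (h / R) (fun i => v i / R) (fun y => f (R • y)) x := by
  rw [cE_eq, cE_eq, int_dil hR, cidx_dil hR]
  have : ∀ y, (cell h v (cidx (h / R) (fun i => v i / R) x)).indicator f (R • y) =
      (cell (h / R) (fun i => v i / R) (cidx (h / R) (fun i => v i / R) x)).indicator (fun y => f (R • y)) y := fun y => by
    have hiff : R • y ∈ cell h v (cidx (h / R) (fun i => v i / R) x) ↔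
        y ∈ cell (h / R) (fun i => v i / R) (cidx (h / R) (fun i => v i / R) x) := by
      simp only [cell, mem_ofPred_eq, cidx_dil hR]
    by_cases hc : R • y ∈ cell h v (cidx (h / R) (fun i => v i / R) x)
    · rw [indicator_of_mem hc, indicator_of_mem (hiff.1 hc)]
    · rw [indicator_of_notMem hc, indicator_of_notMem (fun k => hc (hiff.2 k))]
  simp_rw [this]
  rw [← mul_assoc, div_pow]
  congr 1
  field_simp

lemma Nice.dil {R : ℝ} (hR : 0 < R) {f : Rn n → ℝ} (hf : Nice f) : Nice (fun x => f (R • x)) := by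
  obtain ⟨M, hM⟩ := hf.bdd
  exact ⟨hf.meas.comp (by fun_prop), ⟨M, fun x => hM _⟩, hf.int.comp_smul hR.ne'⟩

lemma Bf_dil {R h : ℝ} (hR : 0 < R) (v : Fin n → ℝ) (f g : Rn n → ℝ) :
    Bf R h v f g = R ^ n * Bf 1 (h / R) (fun i => v i / R) (fun x => f (R • x)) (fun x => g (R • x)) := by
  unfold Bf
  rw [int_dil hR]
  congr 2; ext x; congr 1
  unfold sphereAvg
  congr 1; ext y
  rw [← smul_sub, one_smul]
  simp only [cE_dil hR]

lemma interp_dil (hn : 2 ≤ n) {r s : ℝ} (hr : 1 < r) (hs : 1 < s)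
    (hmem : ((1/r, 1/s) : ℝ × ℝ) ∈ interior (Lregion n)) :
    ∃ C η : ℝ, 0 ≤ C ∧ 0 < η ∧ ∀ f g : Rn n → ℝ, Nice f → Nice g → (∀ x, 0 ≤ f x) → (∀ x, 0 ≤ g x) →
    ∀ (R h : ℝ) (v : Fin n → ℝ), 0 < R → 0 < h → h ≤ 4 * R →
    |Bf R h v f g| ≤ C * (h / R) ^ η * (R ^ n) ^ (1 - 1/r - 1/s) * ((∫ x, f x ^ r) ^ (1/r) * (∫ x, g x ^ s) ^ (1/s)) := by
  obtain ⟨C, η, hC, hη, H⟩ := interp_scaled hn hr hs hmem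
  refine ⟨C, η, hC, hη, ?_⟩
  intro f g hf hg hf0 hg0 R h v hR hh hh4
  rw [Bf_dil hR, abs_mul, abs_of_pos (by positivity)]
  have h1 := H _ _ (hf.dil hR) (hg.dil hR) (fun x => hf0 _) (fun x => hg0 _) (h / R) (fun i => v i / R) (by positivity)
    (by rw [div_le_iff₀ hR]; exact hh4)
  have A0 : 0 ≤ ∫ x, f (R • x) ^ r := integral_nonneg fun x => Real.rpow_nonneg (hf0 _) _
  have B0 : 0 ≤ ∫ x, g (R • x) ^ s := integral_nonneg fun x => Real.rpow_nonneg (hg0 _) _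
  have hRn : 0 < R ^ n := by positivity
  rw [int_dil hR (fun x => f x ^ r), int_dil hR (fun x => g x ^ s), Real.mul_rpow hRn.le A0, Real.mul_rpow hRn.le B0]
  calc _ ≤ R ^ n * _ := mul_le_mul_of_nonneg_left h1 hRn.le
    _ = (R ^ n) ^ (1:ℝ) * (C * (h / R) ^ η * ((∫ x, f (R • x) ^ r) ^ (1/r) * (∫ x, g (R • x) ^ s) ^ (1/s))) := by rw [Real.rpow_one]
    _ = ((R ^ n) ^ (1 - 1/r - 1/s) * (R ^ n) ^ (1/r) * (R ^ n) ^ (1/s)) *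
        (C * (h / R) ^ η * ((∫ x, f (R • x) ^ r) ^ (1/r) * (∫ x, g (R • x) ^ s) ^ (1/s))) := by
        rw [← Real.rpow_add hRn, ← Real.rpow_add hRn]; congr 2; ring
    _ = _ := by ring

end Dil

section Loc

lemma cidx_nest {p q : ℤ} (hpq : p ≤ q) (v : Fin n → ℝ) {x y : Rn n}
    (h : cidx (D2^p) v x = cidx (D2^p) v y) : cidx (D2^q) v x = cidx (D2^q) v y := by
  obtain ⟨k, rfl⟩ := Int.le.dest hpq
  have key : ∀ z : Rn n, ∀ i, cidx (D2^(p + (k:ℤ))) v z i = cidx (D2^p) v z i / ((2 ^ k : ℕ) : ℤ) := fun z i => by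
    unfold cidx
    rw [← Int.floor_div_natCast, zpow_add₀ (by norm_num), zpow_natCast, ← div_div]
    push_cast; rfl
  ext i
  rw [key, key, h]

lemma cE_ind (h : ℝ) (v : Fin n → ℝ) (f : Rn n → ℝ) {U : Set (Rn n)}
    (hU : ∀ x y, cidx h v x = cidx h v y → (x ∈ U ↔ y ∈ U)) (x : Rn n) :
    cE h v (U.indicator f) x = U.indicator (cE h v f) x := by
  by_cases hx : x ∈ U
  · rw [indicator_of_mem hx]
    unfold cE
    congr 1
    refine setIntegral_congr_fun (cell_meas _ _ _) fun y hy => ?_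
    exact indicator_of_mem ((hU y x hy).2 hx) f
  · rw [indicator_of_notMem hx]
    unfold cE
    rw [setIntegral_congr_fun (g := fun _ => 0) (cell_meas _ _ _) fun y hy => ?_]
    · simp
    · exact indicator_of_notMem (fun k => hx ((hU y x hy).1 k)) f

lemma ind_rpow (U : Set (Rn n)) (f : Rn n → ℝ) {r : ℝ} (hr : r ≠ 0) (x : Rn n) :
    (U.indicator f x) ^ r = U.indicator (fun y => f y ^ r) x := by
  by_cases hx : x ∈ U
  · rw [indicator_of_mem hx, indicator_of_mem hx]
  · rw [indicator_of_notMem hx, indicator_of_notMem hx, Real.zero_rpow hr]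

lemma hold_sum {ι : Type*} (T : Finset ι) (a b : ι → ℝ) (ha : ∀ i ∈ T, 0 ≤ a i) (hb : ∀ i ∈ T, 0 ≤ b i) {s : ℝ} (hs : 1 < s) :
    ∑ i ∈ T, a i ^ (1 - 1/s) * b i ^ (1/s) ≤ (∑ i ∈ T, a i) ^ (1 - 1/s) * (∑ i ∈ T, b i) ^ (1/s) := by
  have hc := (Real.HolderConjugate.conjExponent hs).symm
  have hs0 : s ≠ 0 := by linarith
  have e1 : 1 / Real.conjExponent s = 1 - 1/s := by
    unfold Real.conjExponent; field_simp
  have e2 : (1 - 1/s) * Real.conjExponent s = 1 := by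
    unfold Real.conjExponent; have : s - 1 ≠ 0 := by linarith
    field_simp
  have h := Real.inner_le_Lp_mul_Lq_of_nonneg T (f := fun i => a i ^ (1-1/s)) (g := fun i => b i ^ (1/s)) hc
    (fun i hi => Real.rpow_nonneg (ha i hi) _) (fun i hi => Real.rpow_nonneg (hb i hi) _)
  have A1 : ∑ i ∈ T, (a i ^ (1-1/s)) ^ (Real.conjExponent s) = ∑ i ∈ T, a i :=
    Finset.sum_congr rfl fun i hi => by rw [← Real.rpow_mul (ha i hi), e2, Real.rpow_one]
  have B1 : ∑ i ∈ T, (b i ^ (1/s)) ^ s = ∑ i ∈ T, b i :=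
    Finset.sum_congr rfl fun i hi => by rw [← Real.rpow_mul (hb i hi), one_div_mul_cancel hs0, Real.rpow_one]
  rw [e1, A1, B1] at h
  exact h

lemma jensen_set {f : Rn n → ℝ} (hf : Nice f) (h0 : ∀ x, 0 ≤ f x) {s : ℝ} (hs : 1 < s) {A : Set (Rn n)}
    (hA : volume A ≠ ⊤) : ∫ x in A, f x ≤ (volume A).toReal ^ (1 - 1/s) * (∫ x in A, f x ^ s) ^ (1/s) := by
  obtain ⟨M, hM⟩ := hf.bdd
  have hc := (Real.HolderConjugate.conjExponent hs).symm
  have hs0 : s ≠ 0 := by linarith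
  have e1 : 1 / Real.conjExponent s = 1 - 1/s := by
    unfold Real.conjExponent; field_simp
  have : IsFiniteMeasure (volume.restrict A) := ⟨by rw [Measure.restrict_apply_univ]; exact hA.lt_top⟩
  have h := integral_mul_le_Lp_mul_Lq_of_nonneg (μ := volume.restrict A) hc (f := fun _ => (1:ℝ)) (g := f)
    (Filter.Eventually.of_forall fun _ => zero_le_one) (Filter.Eventually.of_forall h0) (memLp_const 1)
    (MemLp.of_bound hf.meas.aestronglyMeasurable M (Filter.Eventually.of_forall hM))
  rw [e1] at h
  simpa [Measure.real] using h

lemma sum_ind_le (h : ℝ) (v : Fin n → ℝ) (T : Finset (Fin n → ℤ)) {F : Rn n → ℝ} (h0 : ∀ x, 0 ≤ F x) (hF : Integrable F) :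
    ∑ m ∈ T, ∫ x, (cell h v m).indicator F x ≤ ∫ x, F x := by
  rw [← integral_finsetSum _ fun m _ => hF.indicator (cell_meas h v m)]
  refine integral_mono (integrable_finsetSum _ fun m _ => hF.indicator (cell_meas h v m)) hF fun x => ?_
  simp only
  by_cases hm : cidx h v x ∈ T
  · rw [Finset.sum_eq_single_of_mem _ hm, indicator_of_mem (show x ∈ cell h v (cidx h v x) from rfl)]
    intro m _ hne
    exact indicator_of_notMem (show x ∉ cell h v m from fun k => hne (Eq.symm k)) F
  · rw [Finset.sum_eq_zero]
    · exact h0 x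
    · intro m hmT
      exact indicator_of_notMem (show x ∉ cell h v m from fun k => hm ((show cidx h v x = m from k) ▸ hmT)) F

lemma loc_num {r s a L K : ℝ} (hr : 1 < r) (hs : 1 < s) (hrs : 1 ≤ 1/r + 1/s) (ha : 0 ≤ a) (hL : 0 < L) (hK : 0 < K)
    (haL : a ≤ L * K) : (L / 8 ^ n) ^ (1 - 1/r - 1/s) * a ^ (1/r) ≤ ((8:ℝ) ^ n) ^ (1/r+1/s-1) * K ^ (1/r+1/s-1) * a ^ (1 - 1/s) := by
  have h8 : (0:ℝ) < 8 ^ n := by positivity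
  have hs1 : 1/s ≤ 1 := by rw [div_le_one (by linarith)]; exact hs.le
  have e1 : a ^ (1/r) ≤ a ^ (1 - 1/s) * (L ^ (1/r+1/s-1) * K ^ (1/r+1/s-1)) := by
    rw [← Real.mul_rpow hL.le hK.le]
    calc a ^ (1/r) = a ^ ((1-1/s) + (1/r+1/s-1)) := by congr 1; ring
      _ = a ^ (1-1/s) * a ^ (1/r+1/s-1) := Real.rpow_add_of_nonneg ha (by linarith) (by linarith)
      _ ≤ _ := by
        apply mul_le_mul_of_nonneg_left _ (Real.rpow_nonneg ha _)
        exact Real.rpow_le_rpow ha haL (by linarith)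
  have e2 : (L / 8 ^ n) ^ (1 - 1/r - 1/s) * L ^ (1/r+1/s-1) = ((8:ℝ) ^ n) ^ (1/r+1/s-1) := by
    rw [Real.div_rpow hL.le h8.le, show 1 - 1/r - 1/s = -(1/r+1/s-1) by ring, Real.rpow_neg hL.le, Real.rpow_neg h8.le]
    have := Real.rpow_pos_of_pos hL (1/r+1/s-1)
    have := Real.rpow_pos_of_pos h8 (1/r+1/s-1)
    field_simp
  calc _ ≤ (L / 8 ^ n) ^ (1 - 1/r - 1/s) * (a ^ (1 - 1/s) * (L ^ (1/r+1/s-1) * K ^ (1/r+1/s-1))) := by gcongr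
    _ = ((L / 8 ^ n) ^ (1 - 1/r - 1/s) * L ^ (1/r+1/s-1)) * K ^ (1/r+1/s-1) * a ^ (1 - 1/s) := by ring
    _ = _ := by rw [e2]

set_option maxHeartbeats 1000000 in
lemma loc_pair (hn : 2 ≤ n) {r s : ℝ} (hr : 1 < r) (hs : 1 < s)
    (hmem : ((1/r, 1/s) : ℝ × ℝ) ∈ interior (Lregion n)) :
    ∃ C η : ℝ, 0 ≤ C ∧ 0 < η ∧ ∀ (v : Fin n → ℝ) (f g : Rn n → ℝ), Nice f → Nice g → (∀ x, 0 ≤ f x) → (∀ x, 0 ≤ g x) →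
    ∀ (q t : ℤ), t < q → ∀ (G : Set (Rn n)), MeasurableSet G → ∀ T : Finset (Fin n → ℤ),
    (∀ x ∈ G, cidx (D2^q) v x ∈ T) →
    (∀ x ∈ G, ∀ y : Rn n, ‖y‖ = 1 → cidx (D2^q) v (x - (D2^q / 8) • y) = cidx (D2^q) v x) →
    ∀ K : ℝ, 0 < K → (∀ x ∈ G, cE (D2^q) v (fun y => f y ^ r) x ≤ K) →
    |Bf (D2^q / 8) (D2^t) v f (G.indicator g)| ≤ C * (D2^(t - q)) ^ η * K ^ (1/r+1/s-1) *
      ((∫ x, f x ^ r) ^ (1-1/s) * (∫ x, (G.indicator g x) ^ s) ^ (1/s)) := by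
  obtain ⟨C, η, hC, hη, H⟩ := interp_dil hn hr hs hmem
  have hrs : 1 ≤ 1/r + 1/s := reg_sum hn (interior_subset hmem)
  refine ⟨C * 8 ^ η * ((8:ℝ) ^ n) ^ (1/r+1/s-1), η, by positivity, hη, ?_⟩
  intro v f g hf hg hf0 hg0 q t htq G hG T hT hsph K hK hGK
  have hL : (0:ℝ) < (D2^q)^n := by positivity
  have hq : (0:ℝ) < D2^q := by positivity
  have ht : (0:ℝ) < D2^t := by positivity
  obtain ⟨Qm, hQm⟩ : ∃ Q : (Fin n → ℤ) → Set (Rn n), Q = fun m => cell (D2^q) v m := ⟨_, rfl⟩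
  have hQmeas : ∀ m, MeasurableSet (Qm m) := fun m => by rw [hQm]; exact cell_meas _ _ _
  have hQmem : ∀ m x, x ∈ Qm m ↔ cidx (D2^q) v x = m := fun m x => by rw [hQm]; rfl
  have nG := hg.indicator hG
  have hG0 : ∀ x, 0 ≤ G.indicator g x := fun x => indicator_nonneg (fun y _ => hg0 y) x
  have nf : ∀ m, Nice ((Qm m).indicator f) := fun m => hf.indicator (hQmeas m)
  have ng : ∀ m, Nice ((Qm m).indicator (G.indicator g)) := fun m => nG.indicator (hQmeas m)
  have e1 : Bf (D2^q / 8) (D2^t) v f (G.indicator g) =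
      ∑ m ∈ T, Bf (D2^q / 8) (D2^t) v f ((Qm m).indicator (G.indicator g)) := by
    rw [← Bf_sum_right T _ ht v hf ng]
    congr 1; ext x
    by_cases hx : x ∈ G
    · rw [Finset.sum_eq_single_of_mem _ (hT x hx), indicator_of_mem (s := Qm (cidx (D2^q) v x)) ((hQmem _ _).2 rfl)]
      intro m _ hne
      exact indicator_of_notMem (fun k => hne ((hQmem _ _).1 k).symm) _
    · rw [indicator_of_notMem hx, Finset.sum_eq_zero]
      intro m _
      by_cases hm : x ∈ Qm m
      · rw [indicator_of_mem hm, indicator_of_notMem hx]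
      · rw [indicator_of_notMem hm]
  have e2 : ∀ m, Bf (D2^q / 8) (D2^t) v f ((Qm m).indicator (G.indicator g)) =
      Bf (D2^q / 8) (D2^t) v ((Qm m).indicator f) ((Qm m).indicator (G.indicator g)) := fun m => by
    unfold Bf
    congr 1; ext x
    by_cases hx : x ∈ G
    swap
    · have : (Qm m).indicator (G.indicator g) x = 0 := by
        by_cases hm : x ∈ Qm m
        · rw [indicator_of_mem hm, indicator_of_notMem hx]
        · rw [indicator_of_notMem hm]
      rw [this, mul_zero, mul_zero]
    by_cases hm : x ∈ Qm m
    swap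
    · rw [indicator_of_notMem hm, mul_zero, mul_zero]
    congr 1
    unfold sphereAvg
    apply integral_congr_ae
    filter_upwards [sph_supp (n := n)] with y hy
    have h1 : x - (D2^q / 8) • y ∈ Qm m := (hQmem _ _).2 ((hsph x hx y hy).trans ((hQmem _ _).1 hm))
    rw [cE_ind, indicator_of_mem h1, indicator_of_mem h1]
    intro z w hzw
    rw [hQmem, hQmem, cidx_nest htq.le v hzw]
  have A0 : ∀ m, 0 ≤ ∫ x, ((Qm m).indicator f x) ^ r := fun m => integral_nonneg fun x =>
    Real.rpow_nonneg (indicator_nonneg (fun y _ => hf0 y) x) _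
  have B0 : ∀ m, 0 ≤ ∫ x, ((Qm m).indicator (G.indicator g) x) ^ s := fun m => integral_nonneg fun x =>
    Real.rpow_nonneg (indicator_nonneg (fun y _ => hG0 y) x) _
  have e3 : ∀ m, |Bf (D2^q / 8) (D2^t) v ((Qm m).indicator f) ((Qm m).indicator (G.indicator g))| ≤
      C * 8 ^ η * ((8:ℝ) ^ n) ^ (1/r+1/s-1) * (D2^(t - q)) ^ η * K ^ (1/r+1/s-1) *
      ((∫ x, ((Qm m).indicator f x) ^ r) ^ (1-1/s) * (∫ x, ((Qm m).indicator (G.indicator g) x) ^ s) ^ (1/s)) := fun m => by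
    have h1 := H _ _ (nf m) (ng m) (fun x => indicator_nonneg (fun y _ => hf0 y) x) (fun x => indicator_nonneg (fun y _ => hG0 y) x)
      (D2^q / 8) (D2^t) v (by positivity) ht (by
        have : D2^t ≤ D2^(q-1) := zpow_le_zpow_right₀ (by norm_num) (by omega)
        rw [zpow_sub_one₀ (by norm_num)] at this
        linarith)
    refine h1.trans ?_
    have e4 : D2^t / (D2^q / 8) = 8 * D2^(t-q) := by
      rw [zpow_sub₀ (by norm_num)]; field_simp
    rw [e4, Real.mul_rpow (by norm_num) (by positivity), div_pow]
    have e5 : ((D2^q)^n / 8 ^ n) ^ (1 - 1/r - 1/s) * ((∫ x, ((Qm m).indicator f x) ^ r) ^ (1/r) *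
        (∫ x, ((Qm m).indicator (G.indicator g) x) ^ s) ^ (1/s)) ≤ ((8:ℝ) ^ n) ^ (1/r+1/s-1) * K ^ (1/r+1/s-1) *
        (∫ x, ((Qm m).indicator f x) ^ r) ^ (1 - 1/s) * (∫ x, ((Qm m).indicator (G.indicator g) x) ^ s) ^ (1/s) := by
      rw [← mul_assoc]
      by_cases hne : ∃ x ∈ G, x ∈ Qm m
      · obtain ⟨x, hxG, hxm⟩ := hne
        apply mul_le_mul_of_nonneg_right _ (Real.rpow_nonneg (B0 m) _)
        apply loc_num hr hs hrs (A0 m) hL hK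
        have h3 := hGK x hxG
        unfold cE at h3
        rw [inv_mul_le_iff₀ hL, (hQmem _ _).1 hxm] at h3
        refine le_trans (le_of_eq ?_) h3
        simp_rw [ind_rpow _ _ (show r ≠ 0 by linarith)]
        rw [integral_indicator (hQmeas m), hQm]
      · have : ∀ x, (Qm m).indicator (G.indicator g) x = 0 := fun x => by
          by_cases hm : x ∈ Qm m
          · rw [indicator_of_mem hm, indicator_of_notMem (fun k => hne ⟨x, k, hm⟩)]
          · rw [indicator_of_notMem hm]
        simp_rw [this]
        have hs0 : s ≠ 0 := by linarith
        simp [Real.zero_rpow hs0, Real.zero_rpow (inv_ne_zero hs0)]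
    calc _ = C * (8 ^ η * (D2^(t - q)) ^ η) * (((D2^q)^n / 8 ^ n) ^ (1 - 1/r - 1/s) * ((∫ x, ((Qm m).indicator f x) ^ r) ^ (1/r) *
        (∫ x, ((Qm m).indicator (G.indicator g) x) ^ s) ^ (1/s))) := by ring
      _ ≤ C * (8 ^ η * (D2^(t - q)) ^ η) * _ := mul_le_mul_of_nonneg_left e5 (by positivity)
      _ = _ := by ring
  have e6 : ∑ m ∈ T, ∫ x, ((Qm m).indicator f x) ^ r ≤ ∫ x, f x ^ r := by
    simp_rw [ind_rpow _ _ (show r ≠ 0 by linarith), hQm]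
    exact sum_ind_le _ v T (fun x => Real.rpow_nonneg (hf0 x) _) (hf.rpow hf0 hr.le).int
  have e7 : ∑ m ∈ T, ∫ x, ((Qm m).indicator (G.indicator g) x) ^ s ≤ ∫ x, (G.indicator g x) ^ s := by
    simp_rw [fun m => ind_rpow (Qm m) (G.indicator g) (show s ≠ 0 by linarith), hQm]
    exact sum_ind_le _ v T (fun x => Real.rpow_nonneg (hG0 x) _) (nG.rpow hG0 hs.le).int
  have hs1 : 1/s ≤ 1 := by rw [div_le_one (by linarith)]; exact hs.le
  rw [e1]
  calc _ ≤ ∑ m ∈ T, |Bf (D2^q / 8) (D2^t) v f ((Qm m).indicator (G.indicator g))| := Finset.abs_sum_le_sum_abs _ _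
    _ ≤ ∑ m ∈ T, C * 8 ^ η * ((8:ℝ) ^ n) ^ (1/r+1/s-1) * (D2^(t - q)) ^ η * K ^ (1/r+1/s-1) *
      ((∫ x, ((Qm m).indicator f x) ^ r) ^ (1-1/s) * (∫ x, ((Qm m).indicator (G.indicator g) x) ^ s) ^ (1/s)) :=
      Finset.sum_le_sum fun m _ => by rw [e2]; exact e3 m
    _ = C * 8 ^ η * ((8:ℝ) ^ n) ^ (1/r+1/s-1) * (D2^(t - q)) ^ η * K ^ (1/r+1/s-1) * ∑ m ∈ T,
      ((∫ x, ((Qm m).indicator f x) ^ r) ^ (1-1/s) * (∫ x, ((Qm m).indicator (G.indicator g) x) ^ s) ^ (1/s)) := by rw [Finset.mul_sum]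
    _ ≤ _ := by
      apply mul_le_mul_of_nonneg_left _ (by positivity)
      refine (hold_sum T _ _ (fun m _ => A0 m) (fun m _ => B0 m) hs).trans ?_
      apply mul_le_mul (Real.rpow_le_rpow (Finset.sum_nonneg fun m _ => A0 m) e6 (by linarith))
        (Real.rpow_le_rpow (Finset.sum_nonneg fun m _ => B0 m) e7 (by positivity))
        (Real.rpow_nonneg (Finset.sum_nonneg fun m _ => B0 m) _)
        (Real.rpow_nonneg (integral_nonneg fun x => Real.rpow_nonneg (hf0 x) _) _)

end Loc

section Core

lemma geo_int {η : ℝ} (hη : 0 < η) (A : Finset ℤ) (d : ℤ → ℤ) (hd : ∀ x ∈ A, ∀ y ∈ A, d x = d y → x = y) (h0 : ∀ x ∈ A, 0 < d x) :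
    ∑ q ∈ A, (D2^(-(d q))) ^ η ≤ (1 - (D2⁻¹) ^ η)⁻¹ := by
  have r0 : (0:ℝ) ≤ (D2⁻¹) ^ η := by positivity
  have r1 : (D2⁻¹) ^ η < 1 := Real.rpow_lt_one (by norm_num) (by norm_num) hη
  have e : ∀ q ∈ A, (D2^(-(d q))) ^ η = ((D2⁻¹) ^ η) ^ (d q).toNat := fun q hq => by
    have h1 : d q = ((d q).toNat : ℤ) := (Int.toNat_of_nonneg (h0 q hq).le).symm
    rw [← Real.rpow_mul_natCast (by norm_num), mul_comm, Real.rpow_natCast_mul (by norm_num), inv_pow, ← zpow_natCast, ← h1, zpow_neg]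
  rw [Finset.sum_congr rfl e, ← Finset.sum_image (s := A) (g := fun q => (d q).toNat) (f := fun k => ((D2⁻¹) ^ η) ^ k),
    ← tsum_geometric_of_lt_one r0 r1]
  · exact (summable_geometric_of_lt_one r0 r1).sum_le_tsum _ fun _ _ => by positivity
  · intro x hx y hy hxy
    refine hd x hx y hy ?_
    have := h0 x hx; have := h0 y hy
    simp only at hxy
    omega

lemma schur {η : ℝ} (hη : 0 < η) {s : ℝ} (hs : 1 < s) (A B : Finset ℤ) (a b : ℤ → ℝ) (ha : ∀ i, 0 ≤ a i) (hb : ∀ i, 0 ≤ b i) :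
    ∑ q ∈ A, ∑ t ∈ B.filter (· < q), (D2^(t-q)) ^ η * (a t ^ (1-1/s) * b q ^ (1/s)) ≤
    (1 - (D2⁻¹) ^ η)⁻¹ * ((∑ t ∈ B, a t)^(1-1/s) * (∑ q ∈ A, b q) ^ (1/s)) := by
  have r1 : (D2⁻¹) ^ η < 1 := Real.rpow_lt_one (by norm_num) (by norm_num) hη
  have hs1 : 1/s ≤ 1 := by rw [div_le_one (by linarith)]; exact hs.le
  have hs2 : 0 < 1/s := by positivity
  obtain ⟨W, hW⟩ : ∃ W : ℝ, W = (1 - (D2⁻¹) ^ η)⁻¹ := ⟨_, rfl⟩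
  have W0 : 0 < W := by rw [hW]; exact inv_pos.2 (by linarith)
  obtain ⟨w, hw⟩ : ∃ w : ℤ → ℤ → ℝ, w = fun q t => if t < q then (D2^(t-q)) ^ η else 0 := ⟨_, rfl⟩
  have w0 : ∀ q t, 0 ≤ w q t := fun q t => by rw [hw]; simp only; split_ifs <;> positivity
  have e1 : ∀ q t, w q t * (a t ^ (1-1/s) * b q ^ (1/s)) = (w q t * a t) ^ (1-1/s) * (w q t * b q) ^ (1/s) := fun q t => by
    rw [Real.mul_rpow (w0 _ _) (ha _), Real.mul_rpow (w0 _ _) (hb _)]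
    have : w q t = w q t ^ (1-1/s) * w q t ^ (1/s) := by
      rw [← Real.rpow_add_of_nonneg (w0 _ _) (by linarith) (by linarith), sub_add_cancel, Real.rpow_one]
    nth_rewrite 1 [this]; ring
  have e2 : ∑ q ∈ A, ∑ t ∈ B.filter (· < q), (D2^(t-q)) ^ η * (a t ^ (1-1/s) * b q ^ (1/s)) =
      ∑ x ∈ A ×ˢ B, (w x.1 x.2 * a x.2) ^ (1-1/s) * (w x.1 x.2 * b x.1) ^ (1/s) := by
    rw [Finset.sum_product]
    refine Finset.sum_congr rfl fun q _ => ?_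
    rw [Finset.sum_filter]
    refine Finset.sum_congr rfl fun t _ => ?_
    rw [← e1, hw]; simp only
    split_ifs <;> simp
  have e3 : ∀ t, ∑ q ∈ A, w q t ≤ W := fun t => by
    rw [hw, ← Finset.sum_filter, hW]
    refine le_trans (le_of_eq ?_) (geo_int hη (A.filter (t < ·)) (fun q => q - t) (fun x _ y _ h => by simpa using h)
      (fun x hx => sub_pos.2 (Finset.mem_filter.1 hx).2))
    refine Finset.sum_congr rfl fun q _ => by simp only [neg_sub]
  have e4 : ∀ q, ∑ t ∈ B, w q t ≤ W := fun q => by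
    rw [hw]; simp only; rw [← Finset.sum_filter, hW]
    refine le_trans (le_of_eq ?_) (geo_int hη (B.filter (· < q)) (fun t => q - t) (fun x _ y _ h => by simpa using h)
      (fun x hx => sub_pos.2 (Finset.mem_filter.1 hx).2))
    refine Finset.sum_congr rfl fun q _ => by simp only [neg_sub]
  rw [e2, ← hW]
  refine (hold_sum _ _ _ (fun x _ => mul_nonneg (w0 _ _) (ha _)) (fun x _ => mul_nonneg (w0 _ _) (hb _)) hs).trans ?_
  have e5 : ∑ x ∈ A ×ˢ B, w x.1 x.2 * a x.2 ≤ W * ∑ t ∈ B, a t := by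
    rw [Finset.sum_product_right, Finset.mul_sum]
    refine Finset.sum_le_sum fun t _ => ?_
    simp only
    rw [← Finset.sum_mul]
    exact mul_le_mul_of_nonneg_right (e3 t) (ha t)
  have e6 : ∑ x ∈ A ×ˢ B, w x.1 x.2 * b x.1 ≤ W * ∑ q ∈ A, b q := by
    rw [Finset.sum_product, Finset.mul_sum]
    refine Finset.sum_le_sum fun q _ => ?_
    simp only
    rw [← Finset.sum_mul]
    exact mul_le_mul_of_nonneg_right (e4 q) (hb q)
  have p1 : 0 ≤ ∑ x ∈ A ×ˢ B, w x.1 x.2 * a x.2 := Finset.sum_nonneg fun x _ => mul_nonneg (w0 _ _) (ha _)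
  have p2 : 0 ≤ ∑ x ∈ A ×ˢ B, w x.1 x.2 * b x.1 := Finset.sum_nonneg fun x _ => mul_nonneg (w0 _ _) (hb _)
  calc _ ≤ (W * ∑ t ∈ B, a t) ^ (1-1/s) * (W * ∑ q ∈ A, b q) ^ (1/s) := by
        apply mul_le_mul (Real.rpow_le_rpow p1 e5 (by linarith)) (Real.rpow_le_rpow p2 e6 hs2.le) (Real.rpow_nonneg p2 _)
        exact Real.rpow_nonneg (p1.trans e5) _
    _ = (W ^ (1-1/s) * W ^ (1/s)) * ((∑ t ∈ B, a t)^(1-1/s) * (∑ q ∈ A, b q) ^ (1/s)) := by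
        rw [Real.mul_rpow W0.le (Finset.sum_nonneg fun t _ => ha t), Real.mul_rpow W0.le (Finset.sum_nonneg fun t _ => hb t)]; ring
    _ = _ := by rw [← Real.rpow_add W0, sub_add_cancel, Real.rpow_one]

lemma cE_mono {h : ℝ} (hh : 0 < h) (v : Fin n → ℝ) {F G : Rn n → ℝ} (hF : Nice F) (hG : Nice G) (hFG : ∀ x, F x ≤ G x) (x : Rn n) :
    cE h v F x ≤ cE h v G x := by
  unfold cE
  exact mul_le_mul_of_nonneg_left (setIntegral_mono hF.int.integrableOn hG.int.integrableOn hFG) (by positivity)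

lemma cE_nonneg {h : ℝ} (hh : 0 < h) (v : Fin n → ℝ) {F : Rn n → ℝ} (hF : ∀ x, 0 ≤ F x) (x : Rn n) : 0 ≤ cE h v F x := by
  unfold cE
  exact mul_nonneg (by positivity) (integral_nonneg hF)

lemma cE_step (t : ℤ) (v : Fin n → ℝ) {F : Rn n → ℝ} (hF : Nice F) (h0 : ∀ x, 0 ≤ F x) (x : Rn n) :
    cE (D2^t) v F x ≤ 2 ^ n * cE (D2^(t+1)) v F x := by
  have h1 : ∫ y in cell (D2^t) v (cidx (D2^t) v x), F y ≤ ∫ y in cell (D2^(t+1)) v (cidx (D2^(t+1)) v x), F y := by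
    apply setIntegral_mono_set hF.int.integrableOn (Filter.Eventually.of_forall h0)
    exact LE.le.eventuallyLE fun y (hy : y ∈ cell _ _ _) => cidx_nest (by omega) v hy
  unfold cE
  calc _ ≤ ((D2^t)^n)⁻¹ * _ := mul_le_mul_of_nonneg_left h1 (by positivity)
    _ = _ := by
      rw [zpow_add_one₀ (by norm_num), mul_pow]; field_simp

lemma cE_jensen {h : ℝ} (hh : 0 < h) (v : Fin n → ℝ) {f : Rn n → ℝ} (hf : Nice f) (h0 : ∀ x, 0 ≤ f x) {r : ℝ} (hr : 1 < r) (x : Rn n) :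
    cE h v f x ≤ (cE h v (fun y => f y ^ r) x) ^ (1/r) := by
  have h1 := jensen_set hf h0 hr (A := cell h v (cidx h v x)) (by rw [cell_vol hh]; exact ENNReal.ofReal_ne_top)
  rw [← Measure.real, cell_vol_real hh] at h1
  have hL : (0:ℝ) < h ^ n := by positivity
  have hI : 0 ≤ ∫ x in cell h v (cidx h v x), f x ^ r := integral_nonneg fun y => Real.rpow_nonneg (h0 y) _
  unfold cE
  rw [inv_mul_le_iff₀ hL, Real.mul_rpow (inv_nonneg.2 hL.le) hI, Real.inv_rpow hL.le, ← mul_assoc]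
  refine h1.trans (le_of_eq ?_)
  congr 1
  rw [Real.rpow_sub hL, Real.rpow_one]; rfl

lemma cidx_fin {a h : ℝ} (ha : 0 < a) (hh : 0 < h) (v : Fin n → ℝ) (m : Fin n → ℤ) :
    ∃ T : Finset (Fin n → ℤ), ∀ x, cidx a v x = m → cidx h v x ∈ T := by
  refine ⟨Finset.Icc (fun i => ⌊a * m i / h⌋) (fun i => ⌊(a * m i + a) / h⌋), fun x hx => ?_⟩
  have h1 := (mem_cell ha (v := v) (m := m) (x := x)).1 hx
  rw [Finset.mem_Icc]
  constructor <;> intro i <;> apply Int.floor_mono <;> apply div_le_div_of_nonneg_right _ hh.le <;> have := h1 i <;> linarith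

end Core

section Core2

def Ust (v : Fin n → ℝ) (F : Rn n → ℝ) (K : ℝ) (q0 p : ℤ) (m0 : Fin n → ℤ) (t : ℤ) : Set (Rn n) :=
  {x | cidx (D2^p) v x = m0 ∧ (t = q0 - 1 ∨ K < cE (D2^t) v F x) ∧ ∀ t' ∈ Finset.Ioc t p, cE (D2^t') v F x ≤ K}

lemma cE_congr {p q : ℤ} (hpq : p ≤ q) (v : Fin n → ℝ) (F : Rn n → ℝ) {x y : Rn n}
    (h : cidx (D2^p) v x = cidx (D2^p) v y) : cE (D2^q) v F x = cE (D2^q) v F y := by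
  unfold cE; rw [cidx_nest hpq v h]

lemma Ust_meas (v : Fin n → ℝ) (F : Rn n → ℝ) (K : ℝ) (q0 p : ℤ) (m0 : Fin n → ℤ) (t : ℤ) : MeasurableSet (Ust v F K q0 p m0 t) := by
  have h1 : MeasurableSet {x : Rn n | t = q0 - 1 ∨ K < cE (D2^t) v F x} :=
    (MeasurableSet.const _).union (measurableSet_lt measurable_const (cE_measurable _ v F))
  have h2 : MeasurableSet {x : Rn n | ∀ t' ∈ Finset.Ioc t p, cE (D2^t') v F x ≤ K} := by
    have : {x : Rn n | ∀ t' ∈ Finset.Ioc t p, cE (D2^t') v F x ≤ K} = ⋂ t' ∈ Finset.Ioc t p, {x | cE (D2^t') v F x ≤ K} := by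
      ext x; simp
    rw [this]
    exact Finset.measurableSet_biInter _ fun t' _ => measurableSet_le (cE_measurable _ v F) measurable_const
  exact (cell_meas _ v m0).inter (h1.inter h2)

lemma Ust_inv (v : Fin n → ℝ) (F : Rn n → ℝ) (K : ℝ) (q0 p : ℤ) (m0 : Fin n → ℤ) {t : ℤ} (htp : t ≤ p) {x y : Rn n}
    (h : cidx (D2^t) v x = cidx (D2^t) v y) (hx : x ∈ Ust v F K q0 p m0 t) : y ∈ Ust v F K q0 p m0 t := by
  obtain ⟨h1, h2, h3⟩ := hx
  refine ⟨by rw [← cidx_nest htp v h]; exact h1, by rw [← cE_congr le_rfl v F h]; exact h2, fun t' ht' => ?_⟩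
  rw [← cE_congr (Finset.mem_Ioc.1 ht').1.le v F h]; exact h3 t' ht'

lemma Ust_disj (v : Fin n → ℝ) (F : Rn n → ℝ) (K : ℝ) (q0 p : ℤ) (m0 : Fin n → ℤ) {t u : ℤ} (ht : q0 - 1 ≤ t)
    (htu : t < u) (hu : u ≤ p) {x : Rn n} (h1 : x ∈ Ust v F K q0 p m0 t) (h2 : x ∈ Ust v F K q0 p m0 u) : False := by
  rcases h2.2.1 with h | h
  · omega
  · exact absurd (h1.2.2 u (Finset.mem_Ioc.2 ⟨htu, hu⟩)) (not_le.2 h)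

lemma Ust_uniq (v : Fin n → ℝ) (F : Rn n → ℝ) (K : ℝ) (q0 p : ℤ) (m0 : Fin n → ℤ) {t u : ℤ} (ht : q0 - 1 ≤ t) (hu' : q0 - 1 ≤ u)
    (ht' : t ≤ p) (hu : u ≤ p) {x : Rn n} (h1 : x ∈ Ust v F K q0 p m0 t) (h2 : x ∈ Ust v F K q0 p m0 u) : t = u := by
  rcases lt_trichotomy t u with h | h | h
  · exact (Ust_disj v F K q0 p m0 ht h hu h1 h2).elim
  · exact h
  · exact (Ust_disj v F K q0 p m0 hu' h ht' h2 h1).elim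

lemma Ust_ex (v : Fin n → ℝ) (F : Rn n → ℝ) (K : ℝ) (q0 p : ℤ) (m0 : Fin n → ℤ) {x : Rn n} (hx : cidx (D2^p) v x = m0) (k : ℕ) :
    (∀ t' ∈ Finset.Ioc (q0 - 1 + k) p, cE (D2^t') v F x ≤ K) →
    ∃ t, q0 - 1 ≤ t ∧ t ≤ q0 - 1 + k ∧ x ∈ Ust v F K q0 p m0 t := by
  induction k with
  | zero => intro h; exact ⟨q0 - 1, le_rfl, by simp, hx, Or.inl rfl, by simpa using h⟩
  | succ k ih =>
    intro h
    by_cases hK : K < cE (D2^(q0 - 1 + ((k+1:ℕ):ℤ))) v F x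
    · exact ⟨_, by omega, le_rfl, hx, Or.inr hK, h⟩
    · obtain ⟨t, h1, h2, h3⟩ := ih fun t' ht' => by
        rw [Finset.mem_Ioc] at ht'
        by_cases e : t' = q0 - 1 + ((k+1:ℕ):ℤ)
        · rw [e]; exact not_lt.1 hK
        · exact h t' (Finset.mem_Ioc.2 ⟨by push_cast at e ⊢; omega, ht'.2⟩)
      exact ⟨t, h1, by push_cast; omega, h3⟩

lemma sum_ind_disj {ι : Type*} (B : Finset ι) (U : ι → Set (Rn n)) (hU : ∀ i ∈ B, ∀ j ∈ B, ∀ x, x ∈ U i → x ∈ U j → i = j)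
    (f : ι → Rn n → ℝ) {x : Rn n} {i : ι} (hi : i ∈ B) (hx : x ∈ U i) : ∑ j ∈ B, (U j).indicator (f j) x = f i x := by
  rw [Finset.sum_eq_single_of_mem i hi, indicator_of_mem hx]
  intro j hj hne
  exact indicator_of_notMem (fun k => hne (hU j hj i hi x k hx)) _

lemma sum_ind_disj_le {ι : Type*} (B : Finset ι) (U : ι → Set (Rn n)) (hU : ∀ i ∈ B, ∀ j ∈ B, ∀ x, x ∈ U i → x ∈ U j → i = j)
    (f : ι → Rn n → ℝ) {x : Rn n} {M : ℝ} (h0 : 0 ≤ M) (hM : ∀ i ∈ B, x ∈ U i → f i x ≤ M) : ∑ j ∈ B, (U j).indicator (f j) x ≤ M := by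
  by_cases h : ∃ i ∈ B, x ∈ U i
  · obtain ⟨i, hi, hx⟩ := h
    rw [sum_ind_disj B U hU f hi hx]; exact hM i hi hx
  · rw [Finset.sum_eq_zero]
    · exact h0
    · intro i hi; exact indicator_of_notMem (fun k => h ⟨i, hi, k⟩) _

lemma int_sum_disj {ι : Type*} (B : Finset ι) (U : ι → Set (Rn n)) (hU : ∀ i ∈ B, ∀ j ∈ B, ∀ x, x ∈ U i → x ∈ U j → i = j)
    (hm : ∀ i, MeasurableSet (U i)) {S : Set (Rn n)} (hS : MeasurableSet S) (hUS : ∀ i ∈ B, U i ⊆ S) {F : Rn n → ℝ} (h0 : ∀ x, 0 ≤ F x) (hF : IntegrableOn F S) :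
    ∑ i ∈ B, ∫ x, (U i).indicator F x ≤ ∫ x in S, F x := by
  have hi : ∀ i ∈ B, Integrable ((U i).indicator F) := fun i hi => (integrable_indicator_iff (hm i)).2 (hF.mono_set (hUS i hi))
  rw [← integral_finsetSum _ hi, ← integral_indicator hS]
  refine integral_mono (integrable_finsetSum _ hi) ((integrable_indicator_iff hS).2 hF) fun x => ?_
  refine sum_ind_disj_le B U hU (fun _ => F) (indicator_nonneg (fun y _ => h0 y) x) fun i hi hx => ?_
  rw [indicator_of_mem (hUS i hi hx)]

lemma good_part (v : Fin n → ℝ) {f : Rn n → ℝ} (hf : Nice f) (h0 : ∀ x, 0 ≤ f x) {r : ℝ} (hr : 1 < r) {K : ℝ} (hK : 0 < K) (q0 p : ℤ) (m0 : Fin n → ℤ)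
    (B : Finset ℤ) (hB : ∀ t ∈ B, q0 - 1 ≤ t ∧ t < p) (z : Rn n) :
    |∑ t ∈ B, cE (D2^t) v ((Ust v (fun y => f y ^ r) K q0 p m0 t).indicator f) z| ≤ (2 ^ n * K) ^ (1/r) := by
  have nr := hf.rpow h0 hr.le
  rw [abs_of_nonneg (Finset.sum_nonneg fun t _ => cE_nonneg (by positivity) v (fun x => indicator_nonneg (fun y _ => h0 y) x) z)]
  rw [Finset.sum_congr rfl fun t ht => cE_ind (D2^t) v f (U := Ust v (fun y => f y ^ r) K q0 p m0 t)
    (fun x y h => ⟨Ust_inv v _ K q0 p m0 (hB t ht).2.le h, Ust_inv v _ K q0 p m0 (hB t ht).2.le h.symm⟩) z]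
  apply sum_ind_disj_le
  · intro i hi j hj x hx hy
    exact Ust_uniq v _ K q0 p m0 (hB i hi).1 (hB j hj).1 (hB i hi).2.le (hB j hj).2.le hx hy
  · positivity
  · intro t ht hz
    refine (cE_jensen (by positivity) v hf h0 hr z).trans (Real.rpow_le_rpow (cE_nonneg (by positivity) v (fun x => Real.rpow_nonneg (h0 x) _) z) ?_ (by positivity))
    refine (cE_step t v nr (fun x => Real.rpow_nonneg (h0 x) _) z).trans (mul_le_mul_of_nonneg_left ?_ (by positivity))
    exact hz.2.2 (t+1) (Finset.mem_Ioc.2 ⟨by omega, by have := (hB t ht).2; omega⟩)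

end Core2

section Core3

lemma split_q (v : Fin n → ℝ) {f g : Rn n → ℝ} (hf : Nice f) (hg : Nice g) (h0 : ∀ x, 0 ≤ f x) (hg0 : ∀ x, 0 ≤ g x)
    {r : ℝ} (hr : 1 < r) {K : ℝ} (hK : 0 < K) (q0 p q : ℤ) (hq0 : q0 ≤ q) (hqp : q ≤ p) (m0 : Fin n → ℤ) {G : Set (Rn n)} (hG : MeasurableSet G)
    (hGS : ∀ x ∈ G, cidx (D2^p) v x = m0)
    (hsph : ∀ x ∈ G, ∀ y : Rn n, ‖y‖ = 1 → cidx (D2^q) v (x - (D2^q / 8) • y) = cidx (D2^q) v x)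
    (hGK : ∀ x ∈ G, ∀ p' ∈ Finset.Icc q p, cE (D2^p') v (fun y => f y ^ r) x ≤ K) :
    ∫ x, sphereAvg n (D2^q / 8) f x * G.indicator g x ≤
      ∑ t ∈ (Finset.Ico (q0-1) p).filter (· < q), |Bf (D2^q / 8) (D2^t) v ((Ust v (fun y => f y ^ r) K q0 p m0 t).indicator f) (G.indicator g)|
      + (2 ^ n * K) ^ (1/r) * ∫ x, G.indicator g x := by
  obtain ⟨U, hU⟩ : ∃ U, U = Ust v (fun y => f y ^ r) K q0 p m0 := ⟨_, rfl⟩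
  obtain ⟨B, hB⟩ : ∃ B, B = (Finset.Ico (q0-1) p).filter (· < q) := ⟨_, rfl⟩
  have hBm : ∀ t, t ∈ B ↔ q0 - 1 ≤ t ∧ t < p ∧ t < q := fun t => by rw [hB, Finset.mem_filter, Finset.mem_Ico, and_assoc]
  rw [← hU, ← hB]
  have nU : ∀ t, Nice ((U t).indicator f) := fun t => hf.indicator (by rw [hU]; exact Ust_meas _ _ _ _ _ _ _)
  have nE : ∀ t : ℤ, Nice (cE (D2^t) v ((U t).indicator f)) := fun t => (nU t).cE (by positivity) v
  have nG := hg.indicator hG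
  obtain ⟨R, hR⟩ : ∃ R, R = D2^q/8 := ⟨_, rfl⟩
  rw [← hR] at hsph ⊢
  -- pointwise decomposition
  have e1 : ∀ x, sphereAvg n R f x * G.indicator g x =
      ∑ t ∈ B, sphereAvg n R (fun z => (U t).indicator f z - cE (D2^t) v ((U t).indicator f) z) x * G.indicator g x
      + sphereAvg n R (fun z => ∑ t ∈ B, cE (D2^t) v ((U t).indicator f) z) x * G.indicator g x := fun x => by
    by_cases hx : x ∈ G
    swap
    · simp [indicator_of_notMem hx]
    rw [← Finset.sum_mul, ← add_mul]
    congr 1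
    rw [sphereAvg_sum B (fun i _ => nE i), Finset.sum_congr rfl fun t _ => sphereAvg_sub (nU t) (nE t) R x, ← Finset.sum_add_distrib,
      Finset.sum_congr rfl fun t _ => sub_add_cancel _ _, ← sphereAvg_sum B (fun i _ => nU i)]
    unfold sphereAvg
    apply integral_congr_ae
    filter_upwards [sph_supp (n := n)] with y hy
    have hz := hsph x hx y hy
    obtain ⟨k, hk⟩ := Int.le.dest hq0
    obtain ⟨t, ht1, ht2, ht3⟩ := Ust_ex v (fun y => f y ^ r) K q0 p m0 (x := x - R • y) ((cidx_nest hqp v hz).trans (hGS x hx)) k (fun t' ht' => by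
      rw [Finset.mem_Ioc] at ht'
      rw [cE_congr (show q ≤ t' by omega) v _ hz]
      exact hGK x hx t' (Finset.mem_Icc.2 ⟨by omega, ht'.2⟩))
    rw [← hU] at ht3
    refine (sum_ind_disj B U ?_ (fun _ => f) ((hBm t).2 ⟨ht1, by omega, by omega⟩) ht3).symm
    intro i hi j hj w hw1 hw2
    rw [hBm] at hi hj
    rw [hU] at hw1 hw2
    exact Ust_uniq v _ K q0 p m0 hi.1 hj.1 hi.2.1.le hj.2.1.le hw1 hw2
  simp_rw [e1]
  have i1 : ∀ t ∈ B, Integrable fun x => sphereAvg n R (fun z => (U t).indicator f z - cE (D2^t) v ((U t).indicator f) z) x * G.indicator g x :=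
    fun t _ => (((nU t).sub (nE t)).sphereAvg R).mul nG
  have nS : Nice (fun z => ∑ t ∈ B, cE (D2^t) v ((U t).indicator f) z) := Nice.sum B fun t _ => nE t
  have i2 := (nS.sphereAvg R).mul nG
  rw [integral_add (integrable_finsetSum _ i1) i2, integral_finsetSum _ i1]
  apply add_le_add
  · exact Finset.sum_le_sum fun t _ => le_abs_self _
  · rw [← integral_const_mul]
    refine integral_mono i2 (nG.int.const_mul _) fun x => ?_
    apply mul_le_mul_of_nonneg_right _ (indicator_nonneg (fun y _ => hg0 y) x)
    refine (le_abs_self _).trans (sphereAvg_bound (fun z => ?_) R x)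
    rw [hU]
    exact good_part v hf h0 hr hK q0 p m0 B (fun t ht => ⟨((hBm t).1 ht).1, ((hBm t).1 ht).2.1⟩) z

set_option maxHeartbeats 1000000 in
lemma core (hn : 2 ≤ n) {r s : ℝ} (hr : 1 < r) (hs : 1 < s)
    (hmem : ((1/r, 1/s) : ℝ × ℝ) ∈ interior (Lregion n)) :
    ∃ C : ℝ, 0 ≤ C ∧ ∀ (v : Fin n → ℝ) (f g : Rn n → ℝ), Nice f → Nice g → (∀ x, 0 ≤ f x) → (∀ x, 0 ≤ g x) →
    ∀ (q0 p : ℤ) (m0 : Fin n → ℤ) (G : ℤ → Set (Rn n)), (∀ q, MeasurableSet (G q)) →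
    (∀ q ∈ Finset.Icc q0 p, ∀ x ∈ G q, cidx (D2^p) v x = m0) →
    (∀ q ∈ Finset.Icc q0 p, ∀ q' ∈ Finset.Icc q0 p, ∀ x, x ∈ G q → x ∈ G q' → q = q') →
    (∀ q ∈ Finset.Icc q0 p, ∀ x ∈ G q, ∀ y : Rn n, ‖y‖ = 1 → cidx (D2^q) v (x - (D2^q / 8) • y) = cidx (D2^q) v x) →
    ∀ K : ℝ, 0 < K → (∀ q ∈ Finset.Icc q0 p, ∀ x ∈ G q, ∀ p' ∈ Finset.Icc q p, cE (D2^p') v (fun y => f y ^ r) x ≤ K) →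
    ∫ x in cell (D2^p) v m0, f x ^ r ≤ (D2^p)^n * K →
    ∑ q ∈ Finset.Icc q0 p, ∫ x, sphereAvg n (D2^q / 8) f x * (G q).indicator g x ≤
      C * (((D2^p)^n) ^ (1-1/s) * K ^ (1/r) * (∑ q ∈ Finset.Icc q0 p, ∫ x, ((G q).indicator g x) ^ s) ^ (1/s)) := by
  obtain ⟨D, η, hD, hη, H⟩ := loc_pair hn hr hs hmem
  have r1 : (D2⁻¹) ^ η < 1 := Real.rpow_lt_one (by norm_num) (by norm_num) hη
  obtain ⟨W, hW⟩ : ∃ W : ℝ, W = (1 - (D2⁻¹) ^ η)⁻¹ := ⟨_, rfl⟩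
  have W0 : 0 < W := by rw [hW]; exact inv_pos.2 (by linarith)
  refine ⟨D * W + (2^n) ^ (1/r), by positivity, ?_⟩
  intro v f g hf hg h0 hg0 q0 p m0 G hG hGS hdisj hsph K hK hGK hS
  have hs1 : 1/s ≤ 1 := by rw [div_le_one (by linarith)]; exact hs.le
  have nr := hf.rpow h0 hr.le
  have hL : (0:ℝ) < (D2^p)^n := by positivity
  obtain ⟨U, hU⟩ : ∃ U, U = Ust v (fun y => f y ^ r) K q0 p m0 := ⟨_, rfl⟩
  have mU : ∀ t, MeasurableSet (U t) := fun t => by rw [hU]; exact Ust_meas _ _ _ _ _ _ _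
  obtain ⟨A, hA⟩ : ∃ A, A = Finset.Icc q0 p := ⟨_, rfl⟩
  obtain ⟨B, hB⟩ : ∃ B, B = Finset.Ico (q0-1) p := ⟨_, rfl⟩
  have hBm : ∀ t, t ∈ B ↔ q0 - 1 ≤ t ∧ t < p := fun t => by rw [hB, Finset.mem_Ico]
  have hAm : ∀ t, t ∈ A ↔ q0 ≤ t ∧ t ≤ p := fun t => by rw [hA, Finset.mem_Icc]
  rw [← hA] at hGS hdisj hsph hGK ⊢
  obtain ⟨a, ha⟩ : ∃ a : ℤ → ℝ, a = fun t => ∫ x, ((U t).indicator f x) ^ r := ⟨_, rfl⟩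
  obtain ⟨b, hb⟩ : ∃ b : ℤ → ℝ, b = fun q => ∫ x, ((G q).indicator g x) ^ s := ⟨_, rfl⟩
  have a0 : ∀ t, 0 ≤ a t := fun t => by rw [ha]; exact integral_nonneg fun x => Real.rpow_nonneg (indicator_nonneg (fun y _ => h0 y) x) _
  have b0 : ∀ t, 0 ≤ b t := fun t => by rw [hb]; exact integral_nonneg fun x => Real.rpow_nonneg (indicator_nonneg (fun y _ => hg0 y) x) _
  have sumB0 : 0 ≤ ∑ q ∈ A, b q := Finset.sum_nonneg fun q _ => b0 q
  -- sum of a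
  have ha_sum : ∑ t ∈ B, a t ≤ (D2^p)^n * K := by
    refine le_trans ?_ hS
    rw [ha]
    simp_rw [ind_rpow _ _ (show r ≠ 0 by linarith)]
    refine int_sum_disj B U ?_ mU (cell_meas _ _ _) ?_ (fun x => Real.rpow_nonneg (h0 x) _) nr.int.integrableOn
    · intro i hi j hj w hw1 hw2
      rw [hBm] at hi hj
      rw [hU] at hw1 hw2
      exact Ust_uniq v _ K q0 p m0 hi.1 hj.1 hi.2.le hj.2.le hw1 hw2
    · intro i _ x hx; rw [hU] at hx; exact hx.1
  -- good part
  have hgood : ∑ q ∈ A, ∫ x, (G q).indicator g x ≤ ((D2^p)^n) ^ (1-1/s) * (∑ q ∈ A, b q) ^ (1/s) := by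
    have hfin : ∀ q ∈ A, volume (G q) ≠ ⊤ := fun q hq => by
      have h1 : volume (G q) ≤ volume (cell (D2^p) v m0) := measure_mono fun x hx => hGS q hq x hx
      rw [cell_vol (by positivity)] at h1
      exact (h1.trans_lt ENNReal.ofReal_lt_top).ne
    have h2 : ∀ q ∈ A, ∫ x, (G q).indicator g x ≤ ((volume (G q)).toReal) ^ (1-1/s) * b q ^ (1/s) := fun q hq => by
      have := jensen_set hg hg0 hs (hfin q hq)
      rw [hb]
      simp_rw [ind_rpow _ _ (show s ≠ 0 by linarith)]
      rwa [integral_indicator (hG q), integral_indicator (hG q)]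
    refine (Finset.sum_le_sum h2).trans ((hold_sum A _ _ (fun _ _ => ENNReal.toReal_nonneg) (fun q _ => b0 q) hs).trans ?_)
    apply mul_le_mul_of_nonneg_right _ (Real.rpow_nonneg sumB0 _)
    apply Real.rpow_le_rpow (Finset.sum_nonneg fun _ _ => ENNReal.toReal_nonneg) _ (by linarith)
    have h3 := int_sum_disj A G hdisj hG (cell_meas (D2^p) v m0) (fun q hq x hx => hGS q hq x hx) (F := fun _ => 1) (fun _ => zero_le_one)
      (integrableOn_const (by rw [cell_vol (by positivity)]; exact ENNReal.ofReal_ne_top))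
    rw [setIntegral_const, cell_vol_real (by positivity)] at h3
    refine le_trans (le_of_eq ?_) (h3.trans_eq (by simp))
    refine Finset.sum_congr rfl fun q _ => ?_
    rw [integral_indicator (hG q), setIntegral_const]; simp [Measure.real]
  -- bad part
  have hbad : ∑ q ∈ A, ∑ t ∈ B.filter (· < q), |Bf (D2^q / 8) (D2^t) v ((U t).indicator f) ((G q).indicator g)| ≤
      D * K ^ (1/r+1/s-1) * (W * (((D2^p)^n * K) ^ (1-1/s) * (∑ q ∈ A, b q) ^ (1/s))) := by
    calc _ ≤ ∑ q ∈ A, ∑ t ∈ B.filter (· < q), D * K ^ (1/r+1/s-1) * ((D2^(t-q)) ^ η * (a t ^ (1-1/s) * b q ^ (1/s))) := by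
          refine Finset.sum_le_sum fun q hq => Finset.sum_le_sum fun t ht => ?_
          have htq := (Finset.mem_filter.1 ht).2
          obtain ⟨T, hT⟩ := cidx_fin (a := D2^p) (h := D2^q) (by positivity) (by positivity) v m0
          have h1 := H v ((U t).indicator f) g (hf.indicator (mU t)) hg (fun x => indicator_nonneg (fun y _ => h0 y) x) hg0 q t htq (G q) (hG q) T
            (fun x hx => hT x (hGS q hq x hx)) (hsph q hq) K hK (fun x hx => ?_)
          · refine h1.trans (le_of_eq ?_)
            rw [ha, hb]; ring
          · refine le_trans ?_ (hGK q hq x hx q (Finset.mem_Icc.2 ⟨le_rfl, ((hAm q).1 hq).2⟩))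
            simp_rw [ind_rpow _ _ (show r ≠ 0 by linarith)]
            exact cE_mono (by positivity) v (nr.indicator (mU t)) nr (fun y => indicator_le_self' (fun z _ => Real.rpow_nonneg (h0 z) _) y) x
      _ = D * K ^ (1/r+1/s-1) * ∑ q ∈ A, ∑ t ∈ B.filter (· < q), (D2^(t-q)) ^ η * (a t ^ (1-1/s) * b q ^ (1/s)) := by
          simp_rw [Finset.mul_sum]
      _ ≤ D * K ^ (1/r+1/s-1) * (W * ((∑ t ∈ B, a t)^(1-1/s) * (∑ q ∈ A, b q) ^ (1/s))) := by
          rw [hW]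
          exact mul_le_mul_of_nonneg_left (schur hη hs A B a b a0 b0) (by positivity)
      _ ≤ _ := by
          gcongr
          · exact Finset.sum_nonneg fun t _ => a0 t
  have hKK : K ^ (1/r+1/s-1) * K ^ (1-1/s) = K ^ (1/r) := by
    rw [← Real.rpow_add hK]; congr 1; ring
  calc _ ≤ ∑ q ∈ A, (∑ t ∈ B.filter (· < q), |Bf (D2^q / 8) (D2^t) v ((U t).indicator f) ((G q).indicator g)|
          + (2 ^ n * K) ^ (1/r) * ∫ x, (G q).indicator g x) := by
        refine Finset.sum_le_sum fun q hq => ?_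
        rw [hU, hB]
        exact split_q v hf hg h0 hg0 hr hK q0 p q ((hAm q).1 hq).1 ((hAm q).1 hq).2 m0 (hG q) (hGS q hq) (hsph q hq) (hGK q hq)
    _ = ∑ q ∈ A, ∑ t ∈ B.filter (· < q), |Bf (D2^q / 8) (D2^t) v ((U t).indicator f) ((G q).indicator g)|
          + (2 ^ n * K) ^ (1/r) * ∑ q ∈ A, ∫ x, (G q).indicator g x := by rw [Finset.sum_add_distrib, Finset.mul_sum]
    _ ≤ D * K ^ (1/r+1/s-1) * (W * (((D2^p)^n * K) ^ (1-1/s) * (∑ q ∈ A, b q) ^ (1/s))) +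
          (2 ^ n * K) ^ (1/r) * (((D2^p)^n) ^ (1-1/s) * (∑ q ∈ A, b q) ^ (1/s)) :=
        add_le_add hbad (mul_le_mul_of_nonneg_left hgood (by positivity))
    _ = D * W * (((D2^p)^n) ^ (1-1/s) * (K ^ (1/r+1/s-1) * K ^ (1-1/s)) * (∑ q ∈ A, b q) ^ (1/s)) +
          (2 ^ n) ^ (1/r) * (((D2^p)^n) ^ (1-1/s) * K ^ (1/r) * (∑ q ∈ A, b q) ^ (1/s)) := by
        rw [Real.mul_rpow hL.le hK.le, Real.mul_rpow (by positivity) hK.le]; ring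
    _ = _ := by rw [hKK, hb]; ring

end Core3

section Stop

lemma sparse_fin {r s : ℝ} {f g : Rn n → ℝ} {ι : Type*} (I : Finset ι) (c : ι → Cube n)
    (hinj : ∀ i ∈ I, ∀ j ∈ I, c i = c j → i = j) (E Fm : ι → Set (Rn n)) (hE : ∀ i ∈ I, MeasurableSet (E i)) (hF : ∀ i ∈ I, MeasurableSet (Fm i))
    (hEs : ∀ i ∈ I, E i ⊆ (c i).toSet) (hFs : ∀ i ∈ I, Fm i ⊆ (c i).toSet) (hv : ∀ i ∈ I, volume (c i).toSet < 4 * volume (E i))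
    (hEd : ∀ i ∈ I, ∀ j ∈ I, ∀ x, x ∈ E i → x ∈ E j → i = j) (hFd : ∀ i ∈ I, ∀ j ∈ I, ∀ x, x ∈ Fm i → x ∈ Fm j → i = j) :
    ∑ i ∈ I, volume (c i).toSet * ENNReal.ofReal (cubeAvg (c i) r f) * ENNReal.ofReal (cubeAvg (c i) s ((Fm i).indicator g)) ≤
      supSparseFormM n r s f g := by
  classical
  rcases I.eq_empty_or_nonempty with rfl | ⟨i0, hi0⟩
  · simp
  have : Nonempty ι := ⟨i0⟩
  have hIn : InjOn c (I : Set ι) := fun i hi j hj h => hinj i hi j hj h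
  obtain ⟨d, hd⟩ : ∃ d : Cube n → ι, ∀ i ∈ I, d (c i) = i :=
    ⟨Function.invFunOn c I, fun i hi => hIn.leftInvOn_invFunOn hi⟩
  have h1 : IsSparse (c '' (I : Set ι)) := by
    refine ⟨fun Q => E (d Q), ?_, ?_, ?_, ?_⟩
    · rintro _ ⟨i, hi, rfl⟩; beta_reduce; rw [hd i hi]; exact hE i hi
    · rintro _ ⟨i, hi, rfl⟩; beta_reduce; rw [hd i hi]; exact hEs i hi
    · rintro _ ⟨i, hi, rfl⟩; beta_reduce; rw [hd i hi]; exact hv i hi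
    · rintro _ ⟨i, hi, rfl⟩ _ ⟨j, hj, rfl⟩ hne
      rw [Function.onFun, hd i hi, hd j hj, Set.disjoint_left]
      intro x hx hy
      exact hne (by rw [hEd i hi j hj x hx hy])
  have h2 : IsAdmissible (c '' (I : Set ι)) (fun Q => Fm (d Q)) := by
    refine ⟨?_, ?_, ?_⟩
    · rintro _ ⟨i, hi, rfl⟩; beta_reduce; rw [hd i hi]; exact hF i hi
    · rintro _ ⟨i, hi, rfl⟩; beta_reduce; rw [hd i hi]; exact hFs i hi
    · rintro _ ⟨i, hi, rfl⟩ _ ⟨j, hj, rfl⟩ hne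
      rw [Function.onFun, hd i hi, hd j hj, Set.disjoint_left]
      intro x hx hy
      exact hne (by rw [hFd i hi j hj x hx hy])
  unfold supSparseFormM
  refine le_trans (le_of_eq ?_) (le_iSup₂_of_le (c '' (I : Set ι)) (fun Q => Fm (d Q)) (le_iSup₂_of_le h1 h2 le_rfl))
  unfold sparseFormM
  rw [tsum_image (f := fun Q : Cube n => volume Q.toSet * ENNReal.ofReal (cubeAvg Q r f) *
    ENNReal.ofReal (cubeAvg Q s ((Fm (d Q)).indicator g))) hIn]
  rw [Finset.tsum_subtype' I (fun i => volume (c i).toSet * ENNReal.ofReal (cubeAvg (c i) r f) *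
    ENNReal.ofReal (cubeAvg (c i) s ((Fm (d (c i))).indicator g)))]
  exact Finset.sum_congr rfl fun i hi => by rw [hd i hi]

noncomputable def cubeOf (p : ℤ) (v : Fin n → ℝ) (m : Fin n → ℤ) : Cube n :=
  ⟨fun i => D2^p * m i - v i, D2^p, by positivity⟩

lemma cubeOf_inj {p p' : ℤ} {v : Fin n → ℝ} {m m' : Fin n → ℤ} (h : cubeOf p v m = cubeOf p' v m') : p = p' ∧ m = m' := by
  unfold cubeOf at h
  rw [Cube.mk.injEq] at h
  have hp : p = p' := zpow_right_injective₀ (a := D2) (by norm_num) (by norm_num) h.2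
  subst hp
  refine ⟨rfl, funext fun i => ?_⟩
  have h1 := congrFun h.1 i
  simp only [sub_left_inj] at h1
  have h2 := mul_left_cancel₀ (zpow_ne_zero p two_ne_zero) h1
  exact_mod_cast h2

lemma cubeOf_vol (p : ℤ) (v : Fin n → ℝ) (m : Fin n → ℤ) : volume (cubeOf p v m).toSet = ENNReal.ofReal ((D2^p)^n) :=
  (box_vol (fun i => D2^p * m i - v i) (h := D2^p) (by positivity)).2

lemma cell_sub_cube (p : ℤ) (v : Fin n → ℝ) (m : Fin n → ℤ) : cell (D2^p) v m ⊆ (cubeOf p v m).toSet := by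
  intro x hx i
  have := (mem_cell (by positivity)).1 hx i
  exact ⟨this.1, this.2.le⟩

lemma cubeAvg_ge (p : ℤ) (v : Fin n → ℝ) (m : Fin n → ℤ) {f : Rn n → ℝ} (hf : Nice f) (h0 : ∀ x, 0 ≤ f x) {r : ℝ} (hr : 1 < r) :
    (((D2^p)^n)⁻¹ * ∫ x in cell (D2^p) v m, f x ^ r) ^ (1/r) ≤ cubeAvg (cubeOf p v m) r f := by
  have hI : 0 ≤ ∫ x in cell (D2^p) v m, f x ^ r := integral_nonneg fun y => Real.rpow_nonneg (h0 y) _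
  unfold cubeAvg
  rw [cubeOf_vol, ENNReal.toReal_ofReal (by positivity)]
  simp_rw [fun x => abs_of_nonneg (h0 x)]
  refine Real.rpow_le_rpow (by positivity) (mul_le_mul_of_nonneg_left ?_ (by positivity)) (by positivity)
  exact setIntegral_mono_set (hf.rpow h0 hr.le).int.integrableOn (Filter.Eventually.of_forall fun x => Real.rpow_nonneg (h0 x) _)
    (LE.le.eventuallyLE (cell_sub_cube p v m))

lemma meas_inv (h : ℝ) (v : Fin n → ℝ) {P : Rn n → Prop} (hP : ∀ x y, cidx h v x = cidx h v y → P x → P y) : MeasurableSet {x | P x} := by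
  have : {x | P x} = cidx h v ⁻¹' (cidx h v '' {x | P x}) := by
    ext x
    constructor
    · intro hx; exact ⟨x, hx, rfl⟩
    · rintro ⟨y, hy, e⟩; exact hP y x e hy
  rw [this]
  exact cidx_meas h v (Set.to_countable _).measurableSet

lemma cE_ind_int {h : ℝ} (hh : 0 < h) (v : Fin n → ℝ) {F : Rn n → ℝ} (hF : Nice F) {V : Set (Rn n)} (hV : ∀ x y, cidx h v x = cidx h v y → (x ∈ V ↔ y ∈ V))
    (hm : MeasurableSet V) (hfin : volume V ≠ ⊤) : ∫ x in V, cE h v F x = ∫ x in V, F x := by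
  have n1 : Nice (V.indicator (fun _ => (1:ℝ))) := ⟨measurable_const.indicator hm, ⟨1, fun x => by by_cases hx : x ∈ V <;> simp [hx]⟩,
    (integrable_indicator_iff hm).2 (integrableOn_const hfin)⟩
  have e := cE_adj hh v hF n1
  have e1 : ∀ x, cE h v (V.indicator (fun _ => (1:ℝ))) x = V.indicator (fun _ => 1) x := fun x => by
    rw [cE_ind h v _ hV]
    congr 1
    ext y
    unfold cE
    rw [setIntegral_const, cell_vol_real hh]
    have : h ^ n ≠ 0 := by positivity
    simp [this]
  simp_rw [e1] at e
  have e2 : ∀ (H : Rn n → ℝ) x, H x * V.indicator (fun _ => (1:ℝ)) x = V.indicator H x := fun H x => by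
    by_cases hx : x ∈ V <;> simp [hx]
  simp_rw [e2] at e
  rwa [integral_indicator hm, integral_indicator hm] at e

lemma weak_type (v : Fin n → ℝ) {F : Rn n → ℝ} (hF : Nice F) (h0 : ∀ x, 0 ≤ F x) (q0 p : ℤ) (m : Fin n → ℤ) {a : ℝ} (ha : 0 < a)
    (hS : ∫ x in cell (D2^p) v m, F x = (D2^p)^n * a) {N : Set (Rn n)}
    (hN : ∀ x ∈ N, x ∈ cell (D2^p) v m ∧ ∃ p', q0 ≤ p' ∧ p' < p ∧ 2 * a < cE (D2^p') v F x) :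
    2 * volume N ≤ volume (cell (D2^p) v m) := by
  have hL : (0:ℝ) < (D2^p)^n := by positivity
  have hfin : volume (cell (D2^p) v m) ≠ ⊤ := by rw [cell_vol (by positivity)]; exact ENNReal.ofReal_ne_top
  obtain ⟨U, hU⟩ : ∃ U, U = Ust v F (2*a) q0 p m := ⟨_, rfl⟩
  obtain ⟨B, hB⟩ : ∃ B, B = Finset.Ico q0 p := ⟨_, rfl⟩
  have hBm : ∀ t, t ∈ B ↔ q0 ≤ t ∧ t < p := fun t => by rw [hB, Finset.mem_Ico]
  have mU : ∀ t, MeasurableSet (U t) := fun t => by rw [hU]; exact Ust_meas _ _ _ _ _ _ _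
  have sU : ∀ t, U t ⊆ cell (D2^p) v m := fun t x hx => by rw [hU] at hx; exact hx.1
  have fU : ∀ t, volume (U t) ≠ ⊤ := fun t => ((measure_mono (sU t)).trans_lt hfin.lt_top).ne
  have hcov : N ⊆ ⋃ t ∈ B, U t := by
    intro x hx
    obtain ⟨h1, p', h2, h3, h4⟩ := hN x hx
    obtain ⟨k, hk⟩ := Int.le.dest (show q0 - 1 ≤ p by omega)
    obtain ⟨t, ht1, ht2, ht3⟩ := Ust_ex v F (2*a) q0 p m h1 k (fun t' ht' => by rw [Finset.mem_Ioc] at ht'; omega)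
    have ht4 : p' ≤ t := by
      by_contra hlt
      exact absurd (ht3.2.2 p' (Finset.mem_Ioc.2 ⟨by omega, h3.le⟩)) (not_le.2 h4)
    have ht5 : t ≠ p := by
      rintro rfl
      rcases ht3.2.1 with e | e
      · omega
      · unfold cE at e
        rw [show cidx (D2^t) v x = m from h1, hS, inv_mul_cancel_left₀ hL.ne'] at e
        linarith
    rw [mem_iUnion₂]
    exact ⟨t, (hBm t).2 ⟨by omega, by omega⟩, by rw [hU]; exact ht3⟩
  have h1 : ∀ t ∈ B, 2 * a * volume.real (U t) ≤ ∫ x, (U t).indicator F x := fun t ht => by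
    have ht' := (hBm t).1 ht
    rw [integral_indicator (mU t), ← cE_ind_int (h := D2^t) (by positivity) v hF ?_ (mU t) (fU t)]
    · have h2 : ∫ x in U t, (2 * a : ℝ) ≤ ∫ x in U t, cE (D2^t) v F x := by
        refine setIntegral_mono_on (integrableOn_const (fU t)) (hF.cE (by positivity) v).int.integrableOn (mU t) fun x hx => ?_
        rw [hU] at hx
        rcases hx.2.1 with e | e
        · omega
        · exact e.le
      rw [setIntegral_const, smul_eq_mul] at h2
      linarith
    · intro x y h
      rw [hU]
      exact ⟨Ust_inv v _ _ q0 p m ht'.2.le h, Ust_inv v _ _ q0 p m ht'.2.le h.symm⟩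
  have h2 : ∑ t ∈ B, ∫ x, (U t).indicator F x ≤ (D2^p)^n * a := by
    rw [← hS]
    refine int_sum_disj B U ?_ mU (cell_meas _ _ _) (fun t _ => sU t) h0 hF.int.integrableOn
    intro i hi j hj w hw1 hw2
    rw [hBm] at hi hj
    rw [hU] at hw1 hw2
    exact Ust_uniq v _ _ q0 p m (by omega) (by omega) hi.2.le hj.2.le hw1 hw2
  have h3 : 2 * a * ∑ t ∈ B, volume.real (U t) ≤ (D2^p)^n * a := by
    rw [Finset.mul_sum]; exact (Finset.sum_le_sum h1).trans h2
  have h4 : 2 * ∑ t ∈ B, volume.real (U t) ≤ (D2^p)^n := by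
    have : (2 * ∑ t ∈ B, volume.real (U t)) * a ≤ (D2^p)^n * a := by linarith
    exact le_of_mul_le_mul_right this ha
  calc 2 * volume N ≤ 2 * ∑ t ∈ B, volume (U t) := by
        gcongr; exact (measure_mono hcov).trans (measure_biUnion_finset_le _ _)
    _ = ENNReal.ofReal (2 * ∑ t ∈ B, volume.real (U t)) := by
        rw [ENNReal.ofReal_mul (by norm_num), ENNReal.ofReal_sum_of_nonneg (fun _ _ => measureReal_nonneg)]
        congr 1
        · simp
        · exact Finset.sum_congr rfl fun t _ => (ofReal_measureReal (fU t)).symm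
    _ ≤ _ := by rw [cell_vol (by positivity)]; exact ENNReal.ofReal_le_ofReal h4

end Stop

section Stop2

noncomputable def kap (a : ℝ) : ℤ := Int.clog 2 a - 1

lemma kap_spec {a : ℝ} (ha : 0 < a) : D2 ^ kap a < a ∧ a ≤ D2 ^ (kap a + 1) := by
  unfold kap
  have h1 := Int.zpow_pred_clog_lt_self (b := 2) (by norm_num) ha
  have h2 := Int.self_le_zpow_clog (b := 2) (by norm_num) a
  refine ⟨by exact_mod_cast h1, by rw [sub_add_cancel]; exact_mod_cast h2⟩

def Stp (v : Fin n → ℝ) (F : Rn n → ℝ) (q1 p : ℤ) (x : Rn n) : Prop :=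
  0 < cE (D2^p) v F x ∧ ∀ p' ∈ Finset.Ioc p q1, cE (D2^p') v F x ≤ D2 ^ kap (cE (D2^p) v F x)

def Asg (v : Fin n → ℝ) (F : Rn n → ℝ) (q1 q p : ℤ) (x : Rn n) : Prop :=
  q ≤ p ∧ p ≤ q1 ∧ Stp v F q1 p x ∧ ∀ p' ∈ Finset.Icc q p, cE (D2^p') v F x ≤ D2 ^ (kap (cE (D2^p) v F x) + 1)

lemma two_lt {a b : ℤ} (h : D2^a < D2^b) : a < b := (zpow_lt_zpow_iff_right₀ (by norm_num)).1 h

lemma Stp_inv (v : Fin n → ℝ) (F : Rn n → ℝ) (q1 p : ℤ) {x y : Rn n} (h : cidx (D2^p) v x = cidx (D2^p) v y)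
    (hx : Stp v F q1 p x) : Stp v F q1 p y := by
  unfold Stp at *
  rw [← cE_congr le_rfl v F h]
  refine ⟨hx.1, fun p' hp' => ?_⟩
  rw [← cE_congr (Finset.mem_Ioc.1 hp').1.le v F h]
  exact hx.2 p' hp'

lemma Asg_inv (v : Fin n → ℝ) (F : Rn n → ℝ) (q1 q p : ℤ) {x y : Rn n} (h : cidx (D2^q) v x = cidx (D2^q) v y)
    (hx : Asg v F q1 q p x) : Asg v F q1 q p y := by
  obtain ⟨h1, h1', h2, h3⟩ := hx
  refine ⟨h1, h1', Stp_inv v F q1 p (cidx_nest h1 v h) h2, fun p' hp' => ?_⟩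
  rw [← cE_congr h1 v F h, ← cE_congr (Finset.mem_Icc.1 hp').1 v F h]
  exact h3 p' hp'

lemma Asg_lt {v : Fin n → ℝ} {F : Rn n → ℝ} {q1 q p u : ℤ} {x : Rn n} (h1 : Asg v F q1 q p x) (h2 : Asg v F q1 q u x) (hpu : p < u) : False := by
  have e1 := h1.2.2.1.2 u (Finset.mem_Ioc.2 ⟨hpu, h2.2.1⟩)
  have e2 := h2.2.2.2 p (Finset.mem_Icc.2 ⟨h1.1, hpu.le⟩)
  have k1 := kap_spec h1.2.2.1.1
  have k2 := kap_spec h2.2.2.1.1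
  have := two_lt (k2.1.trans_le e1)
  have := two_lt (k1.1.trans_le e2)
  omega

lemma Asg_uniq {v : Fin n → ℝ} {F : Rn n → ℝ} {q1 q p u : ℤ} {x : Rn n} (h1 : Asg v F q1 q p x) (h2 : Asg v F q1 q u x) : p = u := by
  rcases lt_trichotomy p u with h | h | h
  · exact (Asg_lt h1 h2 h).elim
  · exact h
  · exact (Asg_lt h2 h1 h).elim

lemma Asg_ex (v : Fin n → ℝ) (F : Rn n → ℝ) (q1 : ℤ) {x : Rn n} (hx : 0 < cE (D2^q1) v F x) (k : ℕ) :
    ∃ p, Asg v F q1 (q1 - k) p x := by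
  induction k with
  | zero =>
    refine ⟨q1, by simp, le_rfl, ⟨hx, by simp⟩, fun p' hp' => ?_⟩
    simp at hp'; subst hp'
    exact (kap_spec hx).2
  | succ k ih =>
    obtain ⟨p, h1, h1', h2, h3⟩ := ih
    by_cases hc : cE (D2^(q1 - ((k+1:ℕ):ℤ))) v F x ≤ D2 ^ (kap (cE (D2^p) v F x) + 1)
    · refine ⟨p, by push_cast; omega, h1', h2, fun p' hp' => ?_⟩
      rw [Finset.mem_Icc] at hp'
      by_cases e : p' = q1 - ((k+1:ℕ):ℤ)
      · rw [e]; exact hc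
      · exact h3 p' (Finset.mem_Icc.2 ⟨by push_cast at hp' e; omega, hp'.2⟩)
    · push Not at hc
      have hpos : 0 < cE (D2^(q1 - ((k+1:ℕ):ℤ))) v F x := lt_trans (by positivity) hc
      have ks := kap_spec hpos
      have hk := two_lt (hc.trans_le ks.2)
      refine ⟨q1 - ((k+1:ℕ):ℤ), le_rfl, by push_cast; omega, ⟨hpos, fun p' hp' => ?_⟩, fun p' hp' => ?_⟩
      · rw [Finset.mem_Ioc] at hp'
        by_cases e : p' ≤ p
        · exact (h3 p' (Finset.mem_Icc.2 ⟨by push_cast at hp'; omega, e⟩)).trans (zpow_le_zpow_right₀ (by norm_num) (by omega))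
        · exact (h2.2 p' (Finset.mem_Ioc.2 ⟨by omega, hp'.2⟩)).trans (zpow_le_zpow_right₀ (by norm_num) (by omega))
      · rw [Finset.mem_Icc] at hp'
        have : p' = q1 - ((k+1:ℕ):ℤ) := by omega
        rw [this]; exact ks.2

lemma zero_part {f h : Rn n → ℝ} (hf : Nice f) (h0 : ∀ x, 0 ≤ f x) (hh : Nice h) {r : ℝ} (hr : 1 < r) (v : Fin n → ℝ) {q q1 : ℤ} (hq : q ≤ q1)
    (T : Finset (Fin n → ℤ)) (hT : ∀ x, h x ≠ 0 → cidx (D2^q1) v x ∈ T) (hE : ∀ x, h x ≠ 0 → cE (D2^q1) v (fun y => f y ^ r) x = 0)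
    (hsph : ∀ x, h x ≠ 0 → ∀ y : Rn n, ‖y‖ = 1 → cidx (D2^q) v (x - (D2^q / 8) • y) = cidx (D2^q) v x) :
    ∫ x, sphereAvg n (D2^q / 8) f x * h x = 0 := by
  obtain ⟨Z, hZ⟩ : ∃ Z, Z = {x | cidx (D2^q1) v x ∈ T ∧ cE (D2^q1) v (fun y => f y ^ r) x = 0} := ⟨_, rfl⟩
  have inv : ∀ x y, cidx (D2^q1) v x = cidx (D2^q1) v y → x ∈ Z → y ∈ Z := fun x y h hx => by
    rw [hZ] at *
    exact ⟨h ▸ hx.1, by rw [← cE_congr le_rfl v _ h]; exact hx.2⟩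
  have mZ : MeasurableSet Z := meas_inv _ v inv
  have fZ : volume Z ≠ ⊤ := by
    have h1 : Z ⊆ ⋃ m ∈ T, cell (D2^q1) v m := fun x hx => by
      rw [hZ] at hx
      rw [mem_iUnion₂]; exact ⟨_, hx.1, rfl⟩
    refine ((measure_mono h1).trans (measure_biUnion_finset_le _ _)).trans_lt (ENNReal.sum_lt_top.2 fun m _ => ?_) |>.ne
    rw [cell_vol (by positivity)]; exact ENNReal.ofReal_lt_top
  have nr := hf.rpow h0 hr.le
  have e1 : ∫ x in Z, f x ^ r = 0 := by
    rw [← cE_ind_int (h := D2^q1) (by positivity) v nr (fun x y h => ⟨inv x y h, inv y x h.symm⟩) mZ fZ]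
    rw [setIntegral_congr_fun (g := fun _ => 0) mZ (fun x hx => by rw [hZ] at hx; exact hx.2)]
    simp
  have e2 : ∀ᵐ x ∂(volume : Measure (Rn n)), Z.indicator f x = 0 := by
    rw [setIntegral_eq_zero_iff_of_nonneg_ae (Filter.Eventually.of_forall fun x => Real.rpow_nonneg (h0 x) _) nr.int.integrableOn] at e1
    have e1' := (ae_restrict_iff' mZ).1 e1
    filter_upwards [e1'] with x hx
    by_cases hxZ : x ∈ Z
    · rw [indicator_of_mem hxZ]
      exact (Real.rpow_eq_zero (h0 x) (by linarith)).1 (hx hxZ)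
    · rw [indicator_of_notMem hxZ]
  have e3 : ∀ x, sphereAvg n (D2^q / 8) f x * h x = sphereAvg n (D2^q / 8) (Z.indicator f) x * h x := fun x => by
    by_cases hx : h x = 0
    · rw [hx, mul_zero, mul_zero]
    congr 1
    unfold sphereAvg
    apply integral_congr_ae
    filter_upwards [sph_supp (n := n)] with y hy
    have hz := cidx_nest hq v (hsph x hx y hy)
    rw [indicator_of_mem (inv _ _ hz.symm (by rw [hZ]; exact ⟨hT x hx, hE x hx⟩))]
  simp_rw [e3]
  rw [sphereAvg_adj (hf.indicator mZ) hh]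
  apply integral_eq_zero_of_ae
  filter_upwards [e2] with x hx
  rw [hx, zero_mul]; rfl

end Stop2

section Stop3

def Gp (v : Fin n → ℝ) (F : Rn n → ℝ) (q1 : ℤ) (G : ℤ → Set (Rn n)) (i : ℤ × (Fin n → ℤ)) (q : ℤ) : Set (Rn n) :=
  {x | x ∈ G q ∧ Asg v F q1 q i.1 x ∧ cidx (D2^i.1) v x = i.2}

lemma Gp_meas (v : Fin n → ℝ) (F : Rn n → ℝ) (q1 : ℤ) {G : ℤ → Set (Rn n)} (hG : ∀ q, MeasurableSet (G q)) (i : ℤ × (Fin n → ℤ)) (q : ℤ) :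
    MeasurableSet (Gp v F q1 G i q) :=
  (hG q).inter ((meas_inv (D2^q) v fun _ _ h hx => Asg_inv v F q1 q i.1 h hx).inter (cell_meas _ v i.2))

lemma cell_nonempty (p : ℤ) (v : Fin n → ℝ) (m : Fin n → ℤ) : ∃ x, cidx (D2^p) v x = m := by
  have : volume (cell (D2^p) v m) ≠ 0 := by
    rw [cell_vol (by positivity)]; exact (ENNReal.ofReal_pos.2 (by positivity)).ne'
  exact nonempty_of_measure_ne_zero this

lemma one_cell (hn : 2 ≤ n) {r s : ℝ} (hr : 1 < r) (hs : 1 < s)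
    (hmem : ((1/r, 1/s) : ℝ × ℝ) ∈ interior (Lregion n)) :
    ∃ C : ℝ, 0 ≤ C ∧ ∀ (v : Fin n → ℝ) (f g : Rn n → ℝ), Nice f → Nice g → (∀ x, 0 ≤ f x) → (∀ x, 0 ≤ g x) →
    ∀ (q0 q1 : ℤ) (G : ℤ → Set (Rn n)), (∀ q, MeasurableSet (G q)) → (∀ q q' x, x ∈ G q → x ∈ G q' → q = q') →
    (∀ q, ∀ x ∈ G q, ∀ y : Rn n, ‖y‖ = 1 → cidx (D2^q) v (x - (D2^q / 8) • y) = cidx (D2^q) v x) →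
    ∀ i : ℤ × (Fin n → ℤ), (∀ x, cidx (D2^i.1) v x = i.2 → Stp v (fun y => f y ^ r) q1 i.1 x) →
    ENNReal.ofReal (∑ q ∈ Finset.Icc q0 i.1, ∫ x, sphereAvg n (D2^q / 8) f x * (Gp v (fun y => f y ^ r) q1 G i q).indicator g x) ≤
      ENNReal.ofReal C * (volume (cubeOf i.1 v i.2).toSet * ENNReal.ofReal (cubeAvg (cubeOf i.1 v i.2) r f) *
        ENNReal.ofReal (cubeAvg (cubeOf i.1 v i.2) s ((⋃ q ∈ Finset.Icc q0 i.1, Gp v (fun y => f y ^ r) q1 G i q).indicator g))) := by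
  obtain ⟨C, hC, H⟩ := core hn hr hs hmem
  refine ⟨C * 2, by positivity, ?_⟩
  intro v f g hf hg h0 hg0 q0 q1 G hG hdisj hsph i hi
  obtain ⟨p, m⟩ := i
  simp only at *
  obtain ⟨x0, hx0⟩ := cell_nonempty p v m
  obtain ⟨P, hP⟩ : ∃ P, P = Gp v (fun y => f y ^ r) q1 G (p, m) := ⟨_, rfl⟩
  have mP : ∀ q, MeasurableSet (P q) := fun q => by rw [hP]; exact Gp_meas _ _ _ hG _ _
  obtain ⟨V, hV⟩ : ∃ V, V = ⋃ q ∈ Finset.Icc q0 p, P q := ⟨_, rfl⟩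
  have mV : MeasurableSet V := by rw [hV]; exact Finset.measurableSet_biUnion _ fun q _ => mP q
  rw [← hP, ← hV]
  have hL : (0:ℝ) < (D2^p)^n := by positivity
  have hSt := hi x0 hx0
  obtain ⟨a, ha⟩ : ∃ a, a = cE (D2^p) v (fun y => f y ^ r) x0 := ⟨_, rfl⟩
  have haI : a = ((D2^p)^n)⁻¹ * ∫ x in cell (D2^p) v m, f x ^ r := by rw [ha]; unfold cE; rw [hx0]
  have ha0 : 0 < a := by rw [ha]; exact hSt.1
  have ks := kap_spec ha0
  have hEa : ∀ x, cidx (D2^p) v x = m → cE (D2^p) v (fun y => f y ^ r) x = a := fun x hx => by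
    rw [ha]; exact cE_congr le_rfl v _ (hx.trans hx0.symm)
  have nV := hg.indicator mV
  have hV0 : ∀ x, 0 ≤ V.indicator g x := fun x => indicator_nonneg (fun y _ => hg0 y) x
  have h1 := H v f g hf hg h0 hg0 q0 p m P mP (fun q _ x hx => by rw [hP] at hx; exact hx.2.2)
    (fun q _ q' _ x hx hy => by rw [hP] at hx hy; exact hdisj q q' x hx.1 hy.1)
    (fun q _ x hx => by rw [hP] at hx; exact hsph q x hx.1) (D2^(kap a + 1)) (by positivity)
    (fun q _ x hx p' hp' => by
      rw [hP] at hx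
      have := hx.2.1.2.2.2 p' hp'
      simp only at this
      rwa [hEa x hx.2.2] at this)
    (by
      have : (D2^p)^n * a = ∫ x in cell (D2^p) v m, f x ^ r := by rw [haI]; field_simp
      rw [← this]
      exact mul_le_mul_of_nonneg_left ks.2 hL.le)
  have h2 : (D2^(kap a + 1)) ^ (1/r) ≤ 2 * a ^ (1/r) := by
    rw [zpow_add_one₀ (by norm_num), mul_comm, Real.mul_rpow (by norm_num) (by positivity)]
    apply mul_le_mul _ (Real.rpow_le_rpow (by positivity) ks.1.le (by positivity)) (by positivity) (by norm_num)
    calc D2 ^ (1/r) ≤ 2 ^ (1:ℝ) := Real.rpow_le_rpow_of_exponent_le (by norm_num) (by rw [div_le_one (by linarith)]; exact hr.le)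
      _ = 2 := by norm_num
  have h3 : ∑ q ∈ Finset.Icc q0 p, ∫ x, ((P q).indicator g x) ^ s ≤ ∫ x in cell (D2^p) v m, (V.indicator g x) ^ s := by
    have e : ∀ q ∈ Finset.Icc q0 p, ∀ x, ((P q).indicator g x) ^ s = (P q).indicator (fun y => (V.indicator g y) ^ s) x := fun q hq x => by
      rw [ind_rpow _ _ (show s ≠ 0 by linarith)]
      by_cases hx : x ∈ P q
      · rw [indicator_of_mem hx, indicator_of_mem hx, indicator_of_mem]
        rw [hV, mem_iUnion₂]; exact ⟨q, hq, hx⟩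
      · rw [indicator_of_notMem hx, indicator_of_notMem hx]
    rw [Finset.sum_congr rfl fun q hq => integral_congr_ae (Filter.Eventually.of_forall (e q hq))]
    refine int_sum_disj _ P ?_ mP (cell_meas _ _ _) ?_ (fun x => Real.rpow_nonneg (hV0 x) _) (nV.rpow hV0 hs.le).int.integrableOn
    · intro q _ q' _ x hx hy; rw [hP] at hx hy; exact hdisj q q' x hx.1 hy.1
    · intro q _ x hx; rw [hP] at hx; exact hx.2.2
  have s0 : 0 ≤ ∑ q ∈ Finset.Icc q0 p, ∫ x, ((P q).indicator g x) ^ s := Finset.sum_nonneg fun q _ => integral_nonneg fun x =>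
    Real.rpow_nonneg (indicator_nonneg (fun y _ => hg0 y) x) _
  have c1 := cubeAvg_ge p v m hf h0 hr
  have c2 := cubeAvg_ge p v m nV hV0 hs
  rw [← haI] at c1
  have c1' : 0 ≤ a ^ (1/r) := by positivity
  have c2' : 0 ≤ (((D2^p)^n)⁻¹ * ∫ x in cell (D2^p) v m, (V.indicator g x) ^ s) ^ (1/s) :=
    Real.rpow_nonneg (mul_nonneg (by positivity) (s0.trans h3)) _
  have h4 : ((D2^p)^n) ^ (1-1/s) * (∫ x in cell (D2^p) v m, (V.indicator g x) ^ s) ^ (1/s) =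
      (D2^p)^n * (((D2^p)^n)⁻¹ * ∫ x in cell (D2^p) v m, (V.indicator g x) ^ s) ^ (1/s) := by
    rw [Real.mul_rpow (by positivity) (s0.trans h3), Real.inv_rpow hL.le, Real.rpow_sub hL, Real.rpow_one, ← mul_assoc]; rfl
  rw [cubeOf_vol, ← ENNReal.ofReal_mul hL.le, ← ENNReal.ofReal_mul (mul_nonneg hL.le (c1'.trans c1)), ← ENNReal.ofReal_mul (by positivity)]
  apply ENNReal.ofReal_le_ofReal
  refine h1.trans ?_
  calc _ ≤ C * (((D2^p)^n) ^ (1-1/s) * (2 * a ^ (1/r)) * (∫ x in cell (D2^p) v m, (V.indicator g x) ^ s) ^ (1/s)) := by gcongr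
    _ = C * 2 * ((a ^ (1/r)) * (((D2^p)^n) ^ (1-1/s) * (∫ x in cell (D2^p) v m, (V.indicator g x) ^ s) ^ (1/s))) := by ring
    _ = C * 2 * ((D2^p)^n * a ^ (1/r) * (((D2^p)^n)⁻¹ * ∫ x in cell (D2^p) v m, (V.indicator g x) ^ s) ^ (1/s)) := by rw [h4]; ring
    _ ≤ _ := by
      apply mul_le_mul_of_nonneg_left _ (by positivity)
      exact mul_le_mul (mul_le_mul_of_nonneg_left c1 hL.le) c2 c2' (mul_nonneg hL.le (c1'.trans c1))

lemma ofReal_sum_le' {ι : Type*} (s : Finset ι) (f : ι → ℝ) : ENNReal.ofReal (∑ i ∈ s, f i) ≤ ∑ i ∈ s, ENNReal.ofReal (f i) := by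
  classical
  induction s using Finset.induction_on with
  | empty => simp
  | insert a s ha ih =>
    rw [Finset.sum_insert ha, Finset.sum_insert ha]
    exact ENNReal.ofReal_add_le.trans (by gcongr)

lemma par_bound (hn : 2 ≤ n) {r s : ℝ} (hr : 1 < r) (hs : 1 < s)
    (hmem : ((1/r, 1/s) : ℝ × ℝ) ∈ interior (Lregion n)) :
    ∃ C : ℝ, 0 ≤ C ∧ ∀ (v : Fin n → ℝ) (f g : Rn n → ℝ), Nice f → Nice g → (∀ x, 0 ≤ f x) → (∀ x, 0 ≤ g x) →
    ∀ (q0 q1 : ℤ) (G : ℤ → Set (Rn n)), (∀ q, MeasurableSet (G q)) → (∀ q q' x, x ∈ G q → x ∈ G q' → q = q') →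
    (∀ q, ∀ x ∈ G q, ∀ y : Rn n, ‖y‖ = 1 → cidx (D2^q) v (x - (D2^q / 8) • y) = cidx (D2^q) v x) →
    ∀ I : Finset (ℤ × (Fin n → ℤ)), (∀ i ∈ I, q0 ≤ i.1 ∧ i.1 ≤ q1) →
    (∀ i ∈ I, ∀ x, cidx (D2^i.1) v x = i.2 → Stp v (fun y => f y ^ r) q1 i.1 x) →
    (∀ i ∈ I, ∀ j ∈ I, ∀ x, cidx (D2^i.1) v x = i.2 → ∀ y, cidx (D2^j.1) v y = j.2 →
      (kap (cE (D2^i.1) v (fun y => f y ^ r) x) - kap (cE (D2^j.1) v (fun y => f y ^ r) y)) % 2 = 0) →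
    ENNReal.ofReal (∑ i ∈ I, ∑ q ∈ Finset.Icc q0 i.1, ∫ x, sphereAvg n (D2^q / 8) f x * (Gp v (fun y => f y ^ r) q1 G i q).indicator g x) ≤
      ENNReal.ofReal C * supSparseFormM n r s f g := by
  obtain ⟨C, hC, H⟩ := one_cell hn hr hs hmem
  refine ⟨C, hC, ?_⟩
  intro v f g hf hg h0 hg0 q0 q1 G hG hdisj hsph I hI hSt hpar
  have nr := hf.rpow h0 hr.le
  obtain ⟨N, hN⟩ : ∃ N : ℤ × (Fin n → ℤ) → Set (Rn n), N = fun i => {x | cidx (D2^i.1) v x = i.2 ∧ ∃ p', q0 ≤ p' ∧ p' < i.1 ∧ (p', cidx (D2^p') v x) ∈ I} := ⟨_, rfl⟩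
  have hNm : ∀ i x, x ∈ N i ↔ (cidx (D2^i.1) v x = i.2 ∧ ∃ p', q0 ≤ p' ∧ p' < i.1 ∧ (p', cidx (D2^p') v x) ∈ I) := fun i x => by rw [hN]; rfl
  have mN : ∀ i ∈ I, MeasurableSet (N i) := fun i hi => by
    rw [hN]
    apply meas_inv (D2^q0) v
    rintro x y h ⟨h1, p', h2, h3, h4⟩
    exact ⟨by rw [← cidx_nest (hI i hi).1 v h]; exact h1, p', h2, h3, by rw [← cidx_nest h2 v h]; exact h4⟩
  have key : ∑ i ∈ I, volume (cubeOf i.1 v i.2).toSet * ENNReal.ofReal (cubeAvg (cubeOf i.1 v i.2) r f) *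
        ENNReal.ofReal (cubeAvg (cubeOf i.1 v i.2) s ((⋃ q ∈ Finset.Icc q0 i.1, Gp v (fun y => f y ^ r) q1 G i q).indicator g)) ≤ supSparseFormM n r s f g := by
    refine sparse_fin I (fun i => cubeOf i.1 v i.2) ?_ (fun i => cell (D2^i.1) v i.2 \ N i)
      (fun i => ⋃ q ∈ Finset.Icc q0 i.1, Gp v (fun y => f y ^ r) q1 G i q) ?_ ?_ ?_ ?_ ?_ ?_ ?_
    · intro i _ j _ h
      exact Prod.ext (cubeOf_inj h).1 (cubeOf_inj h).2
    · intro i hi; exact (cell_meas _ _ _).diff (mN i hi)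
    · intro i _; exact Finset.measurableSet_biUnion _ fun q _ => Gp_meas v _ q1 hG i q
    · intro i _ x hx; exact cell_sub_cube _ _ _ hx.1
    · intro i _ x hx
      obtain ⟨q, _, hx⟩ := mem_iUnion₂.1 hx
      exact cell_sub_cube _ _ _ hx.2.2
    · intro i hi
      obtain ⟨x0, hx0⟩ := cell_nonempty i.1 v i.2
      obtain ⟨a, ha⟩ : ∃ a, a = cE (D2^i.1) v (fun y => f y ^ r) x0 := ⟨_, rfl⟩
      have ha0 : 0 < a := by rw [ha]; exact (hSt i hi x0 hx0).1
      have hL : (0:ℝ) < (D2^i.1)^n := by positivity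
      have haI : ∫ x in cell (D2^i.1) v i.2, f x ^ r = (D2^i.1)^n * a := by rw [ha]; unfold cE; rw [hx0]; field_simp
      have hw : 2 * volume (N i) ≤ volume (cell (D2^i.1) v i.2) := by
        refine weak_type v nr (fun x => Real.rpow_nonneg (h0 x) _) q0 i.1 i.2 ha0 haI fun x hx => ?_
        obtain ⟨h1, p', h2, h3, h4⟩ := (hNm i x).1 hx
        refine ⟨h1, p', h2, h3, ?_⟩
        have st := hSt _ h4 x rfl
        have par := hpar _ h4 i hi x rfl x0 hx0
        simp only at st par
        have e1 := st.2 i.1 (Finset.mem_Ioc.2 ⟨h3, (hI i hi).2⟩)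
        rw [cE_congr le_rfl v _ (h1.trans hx0.symm), ← ha] at e1
        rw [← ha] at par
        have k1 := kap_spec ha0
        have k2 := kap_spec st.1
        have := two_lt (k1.1.trans_le e1)
        calc 2 * a ≤ 2 * D2^(kap a + 1) := by linarith [k1.2]
          _ = D2^(kap a + 1 + 1) := by rw [zpow_add_one₀ (by norm_num) (kap a + 1)]; ring
          _ ≤ D2^(kap (cE (D2^p') v (fun y => f y ^ r) x)) := zpow_le_zpow_right₀ (by norm_num) (by omega)
          _ < _ := k2.1
      have hsub : N i ⊆ cell (D2^i.1) v i.2 := fun x hx => ((hNm i x).1 hx).1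
      have hfin : volume (cell (D2^i.1) v i.2) ≠ ⊤ := by rw [cell_vol (by positivity)]; exact ENNReal.ofReal_ne_top
      have hpos : 0 < volume (cell (D2^i.1) v i.2) := by rw [cell_vol (by positivity)]; exact ENNReal.ofReal_pos.2 hL
      have hvol : volume (cubeOf i.1 v i.2).toSet = volume (cell (D2^i.1) v i.2) := by rw [cubeOf_vol, cell_vol (by positivity)]
      rw [hvol]
      have hsum : volume (cell (D2^i.1) v i.2) ≤ volume (N i) + volume (cell (D2^i.1) v i.2 \ N i) := by
        refine (measure_mono fun x hx => ?_).trans (measure_union_le _ _)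
        by_cases h : x ∈ N i
        · exact Or.inl h
        · exact Or.inr ⟨hx, h⟩
      by_contra hcon
      push Not at hcon
      have hd : volume (cell (D2^i.1) v i.2 \ N i) ≠ ⊤ := ((measure_mono diff_subset).trans_lt hfin.lt_top).ne
      have hNf : volume (N i) ≠ ⊤ := ((measure_mono hsub).trans_lt hfin.lt_top).ne
      rw [← ENNReal.toReal_le_toReal (by finiteness) (by finiteness)] at hw hsum hcon
      rw [ENNReal.toReal_add hNf hd] at hsum
      rw [ENNReal.toReal_mul] at hw hcon
      have := ENNReal.toReal_pos hpos.ne' hfin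
      norm_num at hw hcon
      linarith
    · intro i hi j hj x hx hy
      have hx1 : cidx (D2^i.1) v x = i.2 := hx.1
      have hy1 : cidx (D2^j.1) v x = j.2 := hy.1
      rcases lt_trichotomy i.1 j.1 with h | h | h
      · exact (hy.2 ((hNm j x).2 ⟨hy1, i.1, (hI i hi).1, h, by rw [hx1]; exact hi⟩)).elim
      · exact Prod.ext h (by rw [← hx1, ← hy1, h])
      · exact (hx.2 ((hNm i x).2 ⟨hx1, j.1, (hI j hj).1, h, by rw [hy1]; exact hj⟩)).elim
    · intro i _ j _ x hx hy
      obtain ⟨q, _, hx⟩ := mem_iUnion₂.1 hx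
      obtain ⟨q', _, hy⟩ := mem_iUnion₂.1 hy
      have hq := hdisj q q' x hx.1 hy.1
      subst hq
      have h := Asg_uniq hx.2.1 hy.2.1
      exact Prod.ext h (by rw [← hx.2.2, ← hy.2.2, h])
  refine le_trans ?_ (mul_le_mul_right key _)
  rw [Finset.mul_sum]
  refine (ofReal_sum_le' _ _).trans (Finset.sum_le_sum fun i hi => ?_)
  exact H v f g hf hg h0 hg0 q0 q1 G hG hdisj hsph i (hSt i hi)

end Stop3

section Stop4

lemma stop_bound (hn : 2 ≤ n) {r s : ℝ} (hr : 1 < r) (hs : 1 < s)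
    (hmem : ((1/r, 1/s) : ℝ × ℝ) ∈ interior (Lregion n)) :
    ∃ C : ℝ, 0 ≤ C ∧ ∀ (v : Fin n → ℝ) (f g : Rn n → ℝ), Nice f → Nice g → (∀ x, 0 ≤ f x) → (∀ x, 0 ≤ g x) →
    ∀ (q0 q1 : ℤ) (G : ℤ → Set (Rn n)), (∀ q, MeasurableSet (G q)) → (∀ q q' x, x ∈ G q → x ∈ G q' → q = q') →
    (∀ q, ∀ x ∈ G q, ∀ y : Rn n, ‖y‖ = 1 → cidx (D2^q) v (x - (D2^q / 8) • y) = cidx (D2^q) v x) →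
    ∀ T : Finset (Fin n → ℤ), (∀ q, ∀ x ∈ G q, cidx (D2^q1) v x ∈ T) →
    ENNReal.ofReal (∑ q ∈ Finset.Icc q0 q1, ∫ x, sphereAvg n (D2^q / 8) f x * (G q).indicator g x) ≤
      ENNReal.ofReal C * supSparseFormM n r s f g := by
  classical
  obtain ⟨C, hC, H⟩ := par_bound hn hr hs hmem
  refine ⟨C + C, by positivity, ?_⟩
  intro v f g hf hg h0 hg0 q0 q1 G hG hdisj hsph T hT
  have nr := hf.rpow h0 hr.le
  obtain ⟨F, hF⟩ : ∃ F, F = fun y => f y ^ r := ⟨_, rfl⟩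
  have F0 : ∀ x, 0 ≤ F x := fun x => by rw [hF]; exact Real.rpow_nonneg (h0 x) _
  choose W hW using fun (p : ℤ) (m : Fin n → ℤ) => cidx_fin (a := D2^q1) (h := D2^p) (by positivity) (by positivity) v m
  obtain ⟨J, hJ⟩ : ∃ J, J = (Finset.Icc q0 q1) ×ˢ ((Finset.Icc q0 q1).biUnion fun p => T.biUnion fun m => W p m) := ⟨_, rfl⟩
  have hJm : ∀ p x, p ∈ Finset.Icc q0 q1 → cidx (D2^q1) v x ∈ T → (p, cidx (D2^p) v x) ∈ J := fun p x hp hx => by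
    rw [hJ, Finset.mem_product]
    refine ⟨hp, Finset.mem_biUnion.2 ⟨p, hp, Finset.mem_biUnion.2 ⟨_, hx, hW p _ x rfl⟩⟩⟩
  have hJI : ∀ i ∈ J, q0 ≤ i.1 ∧ i.1 ≤ q1 := fun i hi => by
    rw [hJ, Finset.mem_product] at hi; exact Finset.mem_Icc.1 hi.1
  have step1 : ∀ q ∈ Finset.Icc q0 q1, ∫ x, sphereAvg n (D2^q / 8) f x * (G q).indicator g x =
      ∑ i ∈ J, ∫ x, sphereAvg n (D2^q / 8) f x * (Gp v F q1 G i q).indicator g x := by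
    intro q hq
    have hq' := Finset.mem_Icc.1 hq
    obtain ⟨Z, hZ⟩ : ∃ Z, Z = {x | x ∈ G q ∧ ¬ ∃ p, Asg v F q1 q p x} := ⟨_, rfl⟩
    have mZ : MeasurableSet Z := by
      rw [hZ]
      refine (hG q).inter (meas_inv (D2^q) v fun x y h hx => ?_)
      rintro ⟨p, hp⟩
      exact hx ⟨p, Asg_inv v F q1 q p h.symm hp⟩
    have e : ∀ x, (G q).indicator g x = Z.indicator g x + ∑ i ∈ J, (Gp v F q1 G i q).indicator g x := by
      intro x
      by_cases hx : x ∈ G q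
      · rw [indicator_of_mem hx]
        by_cases hE : ∃ p, Asg v F q1 q p x
        · obtain ⟨p, hp⟩ := hE
          rw [indicator_of_notMem (by rw [hZ]; exact fun k => k.2 ⟨p, hp⟩), zero_add]
          have hi := hJm p x (Finset.mem_Icc.2 ⟨hq'.1.trans hp.1, hp.2.1⟩) (hT q x hx)
          rw [sum_ind_disj J (fun i => Gp v F q1 G i q) _ (fun _ => g) hi ⟨hx, hp, rfl⟩]
          intro i _ j _ y hy hy'
          have h := Asg_uniq hy.2.1 hy'.2.1
          exact Prod.ext h (by rw [← hy.2.2, ← hy'.2.2, h])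
        · rw [indicator_of_mem (by rw [hZ]; exact ⟨hx, hE⟩), Finset.sum_eq_zero, add_zero]
          intro i _
          exact indicator_of_notMem (fun k => hE ⟨_, k.2.1⟩) _
      · rw [indicator_of_notMem hx, indicator_of_notMem (by rw [hZ]; exact fun k => hx k.1), Finset.sum_eq_zero, add_zero]
        intro i _
        exact indicator_of_notMem (fun k => hx k.1) _
    have nA := hf.sphereAvg (D2^q/8)
    simp_rw [e, mul_add, Finset.mul_sum]
    rw [integral_add (nA.mul (hg.indicator mZ)) (integrable_finsetSum _ fun i _ => nA.mul (hg.indicator (Gp_meas _ _ _ hG _ _))),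
      integral_finsetSum _ fun i _ => nA.mul (hg.indicator (Gp_meas _ _ _ hG _ _))]
    have hmemZ : ∀ x, Z.indicator g x ≠ 0 → x ∈ G q ∧ cE (D2^q1) v F x = 0 := fun x hx => by
      have := mem_of_indicator_ne_zero hx
      rw [hZ] at this
      refine ⟨this.1, ?_⟩
      by_contra hE
      have hE' : 0 < cE (D2^q1) v F x := lt_of_le_of_ne (cE_nonneg (by positivity) v F0 x) (Ne.symm hE)
      obtain ⟨p, hp⟩ := Asg_ex v F q1 hE' (q1 - q).toNat
      have e : q1 - ((q1 - q).toNat : ℤ) = q := by omega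
      rw [e] at hp
      exact this.2 ⟨p, hp⟩
    rw [zero_part hf h0 (hg.indicator mZ) hr v hq'.2 T (fun x hx => hT q x (hmemZ x hx).1) (fun x hx => by rw [← hF]; exact (hmemZ x hx).2)
      (fun x hx => hsph q x (hmemZ x hx).1), zero_add]
  obtain ⟨t, ht⟩ : ∃ t : ℤ × (Fin n → ℤ) → ℝ, t = fun i => ∑ q ∈ Finset.Icc q0 i.1, ∫ x, sphereAvg n (D2^q / 8) f x * (Gp v F q1 G i q).indicator g x := ⟨_, rfl⟩
  have step2 : ∑ q ∈ Finset.Icc q0 q1, ∫ x, sphereAvg n (D2^q / 8) f x * (G q).indicator g x = ∑ i ∈ J, t i := by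
    rw [Finset.sum_congr rfl step1, Finset.sum_comm, ht]
    refine Finset.sum_congr rfl fun i hi => (Finset.sum_subset (Finset.Icc_subset_Icc le_rfl (hJI i hi).2) fun q hq hq' => ?_).symm
    have : ∀ x, (Gp v F q1 G i q).indicator g x = 0 := fun x => indicator_of_notMem (fun k => hq' (Finset.mem_Icc.2 ⟨(Finset.mem_Icc.1 hq).1, k.2.1.1⟩)) _
    simp [this]
  choose c hc using fun i : ℤ × (Fin n → ℤ) => cell_nonempty i.1 v i.2
  have hcE : ∀ i : ℤ × (Fin n → ℤ), ∀ x, cidx (D2^i.1) v x = i.2 → cE (D2^i.1) v F x = cE (D2^i.1) v F (c i) := fun i x hx =>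
    cE_congr le_rfl v F (hx.trans (hc i).symm)
  have step3 : ∑ i ∈ J, t i = ∑ i ∈ J.filter (fun i => Stp v F q1 i.1 (c i)), t i := by
    symm
    apply Finset.sum_filter_of_ne
    intro i _ hne
    by_contra hcon
    apply hne
    rw [ht]
    refine Finset.sum_eq_zero fun q _ => ?_
    have : ∀ x, (Gp v F q1 G i q).indicator g x = 0 := fun x => indicator_of_notMem (fun k => hcon (Stp_inv v F q1 i.1 (k.2.2.trans (hc i).symm) k.2.1.2.2.1)) _
    simp [this]
  rw [step2, step3, ← Finset.sum_filter_add_sum_filter_not _ (fun i => kap (cE (D2^i.1) v F (c i)) % 2 = 0)]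
  refine ENNReal.ofReal_add_le.trans ?_
  rw [ENNReal.ofReal_add hC hC, add_mul]
  rw [ht, hF]
  apply add_le_add
  · apply H v f g hf hg h0 hg0 q0 q1 G hG hdisj hsph
    · intro i hi; exact hJI i (Finset.mem_filter.1 (Finset.mem_filter.1 hi).1).1
    · intro i hi x hx; rw [← hF] at hi ⊢
      exact Stp_inv v F q1 i.1 ((hc i).trans hx.symm) (Finset.mem_filter.1 (Finset.mem_filter.1 hi).1).2
    · intro i hi j hj x hx y hy
      rw [← hF] at hi hj ⊢
      have e1 := (Finset.mem_filter.1 hi).2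
      have e2 := (Finset.mem_filter.1 hj).2
      rw [hcE i x hx, hcE j y hy]
      omega
  · apply H v f g hf hg h0 hg0 q0 q1 G hG hdisj hsph
    · intro i hi; exact hJI i (Finset.mem_filter.1 (Finset.mem_filter.1 hi).1).1
    · intro i hi x hx; rw [← hF] at hi ⊢
      exact Stp_inv v F q1 i.1 ((hc i).trans hx.symm) (Finset.mem_filter.1 (Finset.mem_filter.1 hi).1).2
    · intro i hi j hj x hx y hy
      rw [← hF] at hi hj ⊢
      have e1 := (Finset.mem_filter.1 hi).2
      have e2 := (Finset.mem_filter.1 hj).2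
      rw [hcE i x hx, hcE j y hy]
      omega

end Stop4

section Red

lemma third_aux (a : ℝ) (k : ℕ) : (1/8 < Int.fract a ∧ Int.fract a < 7/8) ∨ (1/8 < Int.fract (a + 2^k/3) ∧ Int.fract (a + 2^k/3) < 7/8) := by
  have bad : ∀ a : ℝ, ¬ (1/8 < Int.fract a ∧ Int.fract a < 7/8) → ∃ m : ℤ, |a - m| ≤ 1/8 := by
    intro a h
    have e := Int.self_sub_floor a
    have h0 := Int.fract_nonneg a
    have h1 := Int.fract_lt_one a
    by_cases h2 : 1/8 < Int.fract a
    · refine ⟨⌊a⌋ + 1, ?_⟩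
      have : 7/8 ≤ Int.fract a := by by_contra hc; exact h ⟨h2, not_le.1 hc⟩
      push_cast
      rw [abs_le]; constructor <;> linarith
    · refine ⟨⌊a⌋, ?_⟩
      rw [abs_le]; constructor <;> linarith
  by_contra hcon
  push Not at hcon
  obtain ⟨m, hm⟩ := bad a (fun h => absurd (hcon.1 h.1) (not_le.2 h.2))
  obtain ⟨m', hm'⟩ := bad _ (fun h => absurd (hcon.2 h.1) (not_le.2 h.2))
  rw [abs_le] at hm hm'
  have h1 : ((2^k - 3 * (m' - m) : ℤ) : ℝ) < 1 := by push_cast; linarith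
  have h2 : (-1:ℝ) < ((2^k - 3 * (m' - m) : ℤ) : ℝ) := by push_cast; linarith
  have h1' : (2:ℤ)^k - 3 * (m' - m) < 1 := by exact_mod_cast h1
  have h2' : -1 < (2:ℤ)^k - 3 * (m' - m) := by exact_mod_cast h2
  have h3 : (3:ℤ) ∣ 2^k := ⟨m' - m, by omega⟩
  have := Int.Prime.dvd_pow' (p := 3) (by norm_num) h3
  norm_num at this

noncomputable def shv (q1 : ℤ) (u : Fin n → Bool) : Fin n → ℝ := fun i => if u i then D2^q1/3 else 0

def Good (q1 q : ℤ) (u : Fin n → Bool) : Set (Rn n) :=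
  {x | ∀ i, Int.fract ((x i + shv q1 u i) / D2^q) ∈ Ioo (1/8 : ℝ) (7/8)}

lemma Good_meas (q1 q : ℤ) (u : Fin n → Bool) : MeasurableSet (Good q1 q u) := by
  unfold Good
  rw [ofPred_forall]
  refine MeasurableSet.iInter fun i => ?_
  exact (measurable_fract.comp (show Measurable fun x : Rn n => (x i + shv q1 u i) / D2^q by fun_prop)) measurableSet_Ioo

lemma Good_ex {q1 q : ℤ} (hq : q ≤ q1) (x : Rn n) : ∃ u, x ∈ Good q1 q u := by
  have : ∀ i, ∃ b : Bool, Int.fract ((x i + if b then D2^q1/3 else 0) / D2^q) ∈ Ioo (1/8 : ℝ) (7/8) := by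
    intro i
    rcases third_aux (x i / D2^q) (q1 - q).toNat with h | h
    · exact ⟨false, by simpa using h⟩
    · refine ⟨true, ?_⟩
      have e : (x i + D2^q1/3) / D2^q = x i / D2^q + 2^(q1-q).toNat/3 := by
        rw [← zpow_natCast, Int.toNat_of_nonneg (by omega), zpow_sub₀ (by norm_num)]
        ring
      simpa [e] using h
  choose u hu using this
  exact ⟨u, fun i => hu i⟩

lemma Good_sph {q1 q : ℤ} {u : Fin n → Bool} {x : Rn n} (hx : x ∈ Good q1 q u) (y : Rn n) (hy : ‖y‖ = 1) :
    cidx (D2^q) (shv q1 u) (x - (D2^q / 8) • y) = cidx (D2^q) (shv q1 u) x := by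
  funext i
  unfold cidx
  have h1 := hx i
  have hyi : |y i| ≤ 1 := by rw [← hy, ← Real.norm_eq_abs]; exact PiLp.norm_apply_le y i
  rw [abs_le] at hyi
  have hp : (0:ℝ) < D2^q := by positivity
  have e : ((x - (D2^q / 8) • y) i + shv q1 u i) / D2^q = (x i + shv q1 u i) / D2^q - y i / 8 := by
    simp; field_simp; ring
  rw [e]
  have e2 := Int.self_sub_floor ((x i + shv q1 u i) / D2^q)
  rw [Int.floor_eq_iff]
  constructor <;> linarith [h1.1, h1.2]

def Arg (N : ℕ) (a : ℤ → Rn n → ℝ) (j : ℤ) : Set (Rn n) :=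
  {x | ∀ i ∈ Finset.Icc (-(N:ℤ)) N, a i x ≤ a j x ∧ (i < j → a i x < a j x)}

lemma Arg_meas (N : ℕ) {a : ℤ → Rn n → ℝ} (ha : ∀ j, Measurable (a j)) (j : ℤ) : MeasurableSet (Arg N a j) := by
  have : Arg N a j = ⋂ i ∈ Finset.Icc (-(N:ℤ)) N, ({x | a i x ≤ a j x} ∩ {x | i < j → a i x < a j x}) := by
    ext x; simp [Arg]
  rw [this]
  refine Finset.measurableSet_biInter _ fun i _ => (measurableSet_le (ha i) (ha j)).inter ?_
  by_cases h : i < j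
  · simpa [h] using measurableSet_lt (ha i) (ha j)
  · simp [h]

lemma Arg_disj {N : ℕ} {a : ℤ → Rn n → ℝ} {j k : ℤ} (hj : j ∈ Finset.Icc (-(N:ℤ)) N) (hk : k ∈ Finset.Icc (-(N:ℤ)) N) {x : Rn n}
    (h1 : x ∈ Arg N a j) (h2 : x ∈ Arg N a k) : j = k := by
  rcases lt_trichotomy j k with h | h | h
  · exact absurd ((h2 j hj).2 h) (not_lt.2 (h1 k hk).1)
  · exact h
  · exact absurd ((h1 k hk).2 h) (not_lt.2 (h2 j hj).1)

lemma Icc_ne (N : ℕ) : (Finset.Icc (-(N:ℤ)) N).Nonempty := ⟨0, by simp⟩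

lemma Arg_ex (N : ℕ) (a : ℤ → Rn n → ℝ) (x : Rn n) : ∃ j ∈ Finset.Icc (-(N:ℤ)) N, x ∈ Arg N a j ∧
    (Finset.Icc (-(N:ℤ)) N).sup' (Icc_ne N) (fun j => a j x) = a j x := by
  obtain ⟨j0, hj0, e⟩ := Finset.exists_mem_eq_sup' (Icc_ne N) (fun j => a j x)
  obtain ⟨j, hj, hmin⟩ := Finset.exists_min_image ((Finset.Icc (-(N:ℤ)) N).filter fun j => a j x = a j0 x) id ⟨j0, Finset.mem_filter.2 ⟨hj0, rfl⟩⟩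
  rw [Finset.mem_filter] at hj
  have hle : ∀ i ∈ Finset.Icc (-(N:ℤ)) N, a i x ≤ a j x := fun i hi => by
    rw [hj.2, ← e]; exact Finset.le_sup' (fun j => a j x) hi
  refine ⟨j, hj.1, fun i hi => ⟨hle i hi, fun hij => lt_of_le_of_ne (hle i hi) fun he => ?_⟩, by rw [e, hj.2]⟩
  have := hmin i (Finset.mem_filter.2 ⟨hi, he.trans hj.2⟩)
  simp at this; omega

lemma trunc_bound (hn : 2 ≤ n) {r s : ℝ} (hr : 1 < r) (hs : 1 < s)
    (hmem : ((1/r, 1/s) : ℝ × ℝ) ∈ interior (Lregion n)) :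
    ∃ C : ℝ, 0 ≤ C ∧ ∀ (f g : Rn n → ℝ), Nice f → Nice g → (∀ x, 0 ≤ f x) → (∀ x, 0 ≤ g x) → HasCompactSupport g → ∀ N : ℕ,
    ENNReal.ofReal (∫ x, (Finset.Icc (-(N:ℤ)) N).sup' (Icc_ne N) (fun j => sphereAvg n (D2^j) f x) * g x) ≤
      ENNReal.ofReal C * supSparseFormM n r s f g := by
  classical
  obtain ⟨C, hC, H⟩ := stop_bound hn hr hs hmem
  refine ⟨(Finset.univ : Finset (Fin n → Bool)).card * C, by positivity, ?_⟩
  intro f g hf hg h0 hg0 hcs N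
  obtain ⟨a, ha⟩ : ∃ a : ℤ → Rn n → ℝ, a = fun j => sphereAvg n (D2^j) f := ⟨_, rfl⟩
  have nA : ∀ j, Nice (a j) := fun j => by rw [ha]; exact hf.sphereAvg _
  have a0 : ∀ j x, 0 ≤ a j x := fun j x => by rw [ha]; exact integral_nonneg fun y => h0 _
  obtain ⟨B, hB⟩ : ∃ B : ℝ, ∀ x, g x ≠ 0 → ‖x‖ ≤ B := by
    obtain ⟨B, hB⟩ := hcs.isCompact.isBounded.exists_norm_le
    exact ⟨B, fun x hx => hB x (subset_tsupport _ hx)⟩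
  obtain ⟨q1, hq1⟩ : ∃ q1 : ℤ, q1 = N + 3 := ⟨_, rfl⟩
  obtain ⟨G, hGd⟩ : ∃ G : (Fin n → Bool) → ℤ → Set (Rn n), G = fun u q =>
    {x | q - 3 ∈ Finset.Icc (-(N:ℤ)) N ∧ x ∈ Arg N a (q-3) ∧ x ∈ Good q1 q u ∧ g x ≠ 0} := ⟨_, rfl⟩
  have hGi : ∀ u q x, x ∈ G u q ↔ q - 3 ∈ Finset.Icc (-(N:ℤ)) N ∧ x ∈ Arg N a (q-3) ∧ x ∈ Good q1 q u ∧ g x ≠ 0 := fun u q x => by rw [hGd]; rfl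
  have mG : ∀ u q, MeasurableSet (G u q) := fun u q => by
    rw [hGd]
    exact (MeasurableSet.const _).inter ((Arg_meas N (fun j => (nA j).meas) _).inter ((Good_meas _ _ _).inter (hg.meas (measurableSet_singleton 0).compl)))
  have hu : ∀ u, ENNReal.ofReal (∑ q ∈ Finset.Icc (-(N:ℤ)+3) q1, ∫ x, sphereAvg n (D2^q / 8) f x * (G u q).indicator g x) ≤
      ENNReal.ofReal C * supSparseFormM n r s f g := by
    intro u
    refine H (shv q1 u) f g hf hg h0 hg0 _ q1 (G u) (mG u) ?_ ?_
      (Finset.Icc (fun i => ⌊(-B + shv q1 u i) / D2^q1⌋) (fun i => ⌊(B + shv q1 u i) / D2^q1⌋)) ?_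
    · intro q q' x hx hy
      rw [hGi] at hx hy
      have := Arg_disj hx.1 hy.1 hx.2.1 hy.2.1
      omega
    · intro q x hx y hy
      rw [hGi] at hx
      exact Good_sph hx.2.2.1 y hy
    · intro q x hx
      rw [hGi] at hx
      have hb := hB x hx.2.2.2
      have hi : ∀ i, -B ≤ x i ∧ x i ≤ B := fun i => by
        rw [← abs_le, ← Real.norm_eq_abs]; exact (PiLp.norm_apply_le x i).trans hb
      rw [Finset.mem_Icc]
      constructor <;> intro i <;> apply Int.floor_le_floor <;> gcongr
      · exact (hi i).1
      · exact (hi i).2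
  have ind0 : ∀ u q x, 0 ≤ (G u q).indicator g x := fun u q x => indicator_nonneg (fun y _ => hg0 y) x
  have e8 : ∀ q : ℤ, sphereAvg n (D2^q / 8) f = a (q - 3) := fun q => by
    rw [ha]; beta_reduce; rw [zpow_sub₀ (by norm_num)]; norm_num
  have pt : ∀ x, (Finset.Icc (-(N:ℤ)) N).sup' (Icc_ne N) (fun j => sphereAvg n (D2^j) f x) * g x ≤
      ∑ u : Fin n → Bool, ∑ q ∈ Finset.Icc (-(N:ℤ)+3) q1, sphereAvg n (D2^q / 8) f x * (G u q).indicator g x := by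
    intro x
    have nn : ∀ u q, 0 ≤ sphereAvg n (D2^q / 8) f x * (G u q).indicator g x := fun u q =>
      mul_nonneg (by rw [e8]; exact a0 _ _) (ind0 u q x)
    by_cases hgx : g x = 0
    · rw [hgx, mul_zero]
      exact Finset.sum_nonneg fun u _ => Finset.sum_nonneg fun q _ => nn u q
    obtain ⟨j, hj, hx, e⟩ := Arg_ex N a x
    have hj' := Finset.mem_Icc.1 hj
    obtain ⟨u, hu⟩ := Good_ex (q1 := q1) (q := j + 3) (by omega) x
    have e' : (Finset.Icc (-(N:ℤ)) N).sup' (Icc_ne N) (fun j => sphereAvg n (D2^j) f x) = a j x := by rw [← e, ha]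
    rw [e']
    have hm : x ∈ G u (j+3) := by
      rw [hGi, add_sub_cancel_right]; exact ⟨hj, hx, hu, hgx⟩
    calc a j x * g x = sphereAvg n (D2^(j+3) / 8) f x * (G u (j+3)).indicator g x := by
          rw [e8, add_sub_cancel_right, indicator_of_mem hm]
      _ ≤ ∑ q ∈ Finset.Icc (-(N:ℤ)+3) q1, sphereAvg n (D2^q / 8) f x * (G u q).indicator g x :=
          Finset.single_le_sum (f := fun q => sphereAvg n (D2^q / 8) f x * (G u q).indicator g x) (fun q _ => nn u q) (Finset.mem_Icc.2 ⟨by omega, by omega⟩)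
      _ ≤ _ := Finset.single_le_sum (f := fun u => ∑ q ∈ Finset.Icc (-(N:ℤ)+3) q1, sphereAvg n (D2^q / 8) f x * (G u q).indicator g x)
          (fun u _ => Finset.sum_nonneg fun q _ => nn u q) (Finset.mem_univ u)
  have ii : ∀ u q, Integrable (fun x => sphereAvg n (D2^q / 8) f x * (G u q).indicator g x) := fun u q =>
    (hf.sphereAvg _).mul (hg.indicator (mG u q))
  have main : ∫ x, (Finset.Icc (-(N:ℤ)) N).sup' (Icc_ne N) (fun j => sphereAvg n (D2^j) f x) * g x ≤
      ∑ u : Fin n → Bool, ∑ q ∈ Finset.Icc (-(N:ℤ)+3) q1, ∫ x, sphereAvg n (D2^q / 8) f x * (G u q).indicator g x := by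
    refine (integral_mono_of_nonneg (Filter.Eventually.of_forall fun x => ?_)
      (integrable_finsetSum _ fun u _ => integrable_finsetSum _ fun q _ => ii u q) (Filter.Eventually.of_forall pt)).trans (le_of_eq ?_)
    · obtain ⟨j, hj, hx, e⟩ := Arg_ex N a x
      have e' : (Finset.Icc (-(N:ℤ)) N).sup' (Icc_ne N) (fun j => sphereAvg n (D2^j) f x) = a j x := by rw [← e, ha]
      beta_reduce
      rw [e']; exact mul_nonneg (a0 _ _) (hg0 x)
    · rw [integral_finsetSum _ fun u _ => integrable_finsetSum _ fun q _ => ii u q]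
      exact Finset.sum_congr rfl fun u _ => integral_finsetSum _ fun q _ => ii u q
  refine (ENNReal.ofReal_le_ofReal main).trans ((ofReal_sum_le' _ _).trans ((Finset.sum_le_sum fun u _ => hu u).trans (le_of_eq ?_)))
  rw [Finset.sum_const, nsmul_eq_mul, ENNReal.ofReal_mul (by positivity), ENNReal.ofReal_natCast, mul_assoc]

lemma final_bound (hn : 2 ≤ n) {r s : ℝ} (hr : 1 < r) (hs : 1 < s)
    (hmem : ((1/r, 1/s) : ℝ × ℝ) ∈ interior (Lregion n)) : SparseBoundM n r s (Mlac n) := by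
  obtain ⟨C, hC, H⟩ := trunc_bound hn hr hs hmem
  refine ⟨C, hC, ?_⟩
  intro f g mf mg f0 g0 bf bg cf cg
  have nice : ∀ f : Rn n → ℝ, Measurable f → (∀ x, 0 ≤ f x) → (∃ M, ∀ x, f x ≤ M) → HasCompactSupport f → Nice f := by
    rintro f mf f0 ⟨M, hM⟩ cf
    have hM' : ∀ x, |f x| ≤ M := fun x => by rw [abs_of_nonneg (f0 x)]; exact hM x
    refine ⟨mf, ⟨M, hM'⟩, ?_⟩
    rw [← integrableOn_iff_integrable_of_support_subset (subset_tsupport f)]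
    exact Measure.integrableOn_of_bounded (M := M) cf.isCompact.measure_lt_top.ne mf.aestronglyMeasurable (Filter.Eventually.of_forall hM')
  have nf := nice f mf f0 bf cf
  have ng := nice g mg g0 bg cg
  obtain ⟨M, hM⟩ := nf.bdd
  have hab : (fun z => |f z|) = f := funext fun z => abs_of_nonneg (f0 z)
  obtain ⟨b, hb⟩ : ∃ b : ℕ → Rn n → ℝ, b = fun (N : ℕ) x => (Finset.Icc (-(N:ℤ)) N).sup' (Icc_ne N) (fun j => sphereAvg n (D2^j) f x) := ⟨_, rfl⟩
  have bound : ∀ N x, |b N x| ≤ M := fun N x => by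
    obtain ⟨j, _, e⟩ := Finset.exists_mem_eq_sup' (Icc_ne N) (fun j => sphereAvg n (D2^j) f x)
    rw [hb]; beta_reduce; rw [e]; exact sphereAvg_bound hM _ x
  have bmeas : ∀ N, Measurable (b N) := fun N => by
    rw [hb]
    have := Finset.measurable_sup' (Icc_ne N) (f := fun j => sphereAvg n (D2^j) f) (fun j _ => sphereAvg_measurable mf _)
    convert this using 1
    funext x
    rw [Finset.sup'_apply]
  have conv : ∀ x, Filter.Tendsto (fun N => b N x) Filter.atTop (nhds (Mlac n f x)) := fun x => by
    have mono : Monotone fun N => b N x := by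
      intro N N' h
      rw [hb]
      exact Finset.sup'_mono _ (Finset.Icc_subset_Icc (by omega) (by omega)) _
    have bdd : BddAbove (range fun N => b N x) := ⟨M, by rintro _ ⟨N, rfl⟩; exact (le_abs_self _).trans (bound N x)⟩
    have bdd' : BddAbove (range fun j : ℤ => sphereAvg n (D2^j) f x) := ⟨M, by rintro _ ⟨N, rfl⟩; exact (le_abs_self _).trans (sphereAvg_bound hM _ x)⟩
    have e : Mlac n f x = ⨆ N, b N x := by
      unfold Mlac
      rw [hab]
      apply le_antisymm
      · refine ciSup_le fun j => le_trans ?_ (le_ciSup bdd j.natAbs)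
        rw [hb]
        exact Finset.le_sup' (fun j : ℤ => sphereAvg n (D2^j) f x) (Finset.mem_Icc.2 ⟨by omega, by omega⟩)
      · refine ciSup_le fun N => ?_
        rw [hb]
        exact Finset.sup'_le _ _ fun j _ => le_ciSup bdd' j
    rw [e]
    exact tendsto_atTop_ciSup mono bdd
  have lim : Filter.Tendsto (fun N => ∫ x, b N x * g x) Filter.atTop (nhds (∫ x, Mlac n f x * g x)) := by
    refine tendsto_integral_of_dominated_convergence (fun x => M * g x) (fun N => ((bmeas N).mul mg).aestronglyMeasurable) (ng.int.const_mul M)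
      (fun N => Filter.Eventually.of_forall fun x => ?_) (Filter.Eventually.of_forall fun x => (conv x).mul_const _)
    rw [norm_mul, Real.norm_eq_abs, Real.norm_eq_abs, abs_of_nonneg (g0 x)]
    exact mul_le_mul_of_nonneg_right (bound N x) (g0 x)
  refine le_of_tendsto ((ENNReal.continuous_ofReal.tendsto _).comp lim) (Filter.Eventually.of_forall fun N => ?_)
  have := H f g nf ng f0 g0 cg N
  rw [hb]
  exact this

end Red

end Aux

/-- If `(1/r, 1/s)` lies in the interior of the triangle `L_n`, then
the lacunary spherical maximal function satisfies the sparse bound `‖M_lac : (r,s)_m‖ < ∞`. -/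
theorem lacunary_sparse_bound (n : ℕ) (hn : 2 ≤ n) (r s : ℝ) (hr : 1 < r) (hs : 1 < s)
    (hmem : ((1/r, 1/s) : ℝ × ℝ) ∈ interior (Lregion n)) :
    SparseBoundM n r s (Mlac n) := by
  exact final_bound hn hr hs hmem
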